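/- Let (A, G) be any of the pairs defining a quantum Kleinian singularity: (i) A = k_q[u,v] with G cyclic of order n acting by g·u = ωu, g·v = ω^{−1}v for ω a primitive nth root of unity; (ii) A = k_{−1}[u,v] with G = S_2 acting by h·u = v, h·v = u; (iii) A = k_{−1}[u,v] with G = D_n the dihedral group of order 2n acting by g·u = ωu, g·v = ω^{−1}v, h·u = v, h·v = u; (iv) A = k_J[u,v] with G = C_2 acting by u ↦ −u, v ↦ −v. Then the skew group ring T = A # G is a prime noetherian finitely generated k-algebra which is GK-Cohen-Macaulay and of Gelfand-Kirillov dimension 2. -/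

import Mathlib

universe u

/-- A (possibly noncommutative) ring is *prime* if `a R b = 0` implies `a = 0` or `b = 0`. -/
def IsPrimeRing (R : Type*) [Ring R] : Prop :=
  ∀ a b : R, (∀ x : R, a * x * b = 0) → a = 0 ∨ b = 0

/-- A ring is *two-sided noetherian* if it is both left and right noetherian. -/
def IsTwoSidedNoetherianRing (R : Type*) [Ring R] : Prop :=
  IsNoetherianRing R ∧ IsNoetherianRing Rᵐᵒᵖ

/-- `T` together with `ι : A →+* T` and `j : G → T` is the skew group ring `A # G`
for the action of the finite group `G` on `A`. -/
structure IsSkewGroupRing (A : Type*) [Ring A] (G : Type*) [Group G] [Fintype G]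
    [MulSemiringAction G A] (T : Type*) [Ring T] (ι : A →+* T) (j : G → T) : Prop where
  injective : Function.Injective ι
  j_one : j 1 = 1
  j_mul : ∀ g h : G, j g * j h = j (g * h)
  comm : ∀ (g : G) (a : A), j g * ι a = ι (g • a) * j g
  basis : ∀ t : T, ∃! c : G → A, t = ∑ g : G, ι (c g) * j g

/-- The relation defining the quantum plane `K_q[u,v]`: `v u = q · u v`. -/
inductive QuantumRel (K : Type*) [CommRing K] (q : K) :
    FreeAlgebra K (Fin 2) → FreeAlgebra K (Fin 2) → Prop
  | rel : QuantumRel K q (FreeAlgebra.ι K 1 * FreeAlgebra.ι K 0)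
      (q • (FreeAlgebra.ι K 0 * FreeAlgebra.ι K 1))

/-- The quantum plane `K_q[u,v] = K⟨u,v⟩/(vu - q·uv)`. -/
abbrev QuantumPlane (K : Type*) [CommRing K] (q : K) := RingQuot (QuantumRel K q)

/-- The generator `u` of the quantum plane. -/
noncomputable def qU (K : Type*) [CommRing K] (q : K) : QuantumPlane K q :=
  RingQuot.mkAlgHom K (QuantumRel K q) (FreeAlgebra.ι K 0)

/-- The generator `v` of the quantum plane. -/
noncomputable def qV (K : Type*) [CommRing K] (q : K) : QuantumPlane K q :=
  RingQuot.mkAlgHom K (QuantumRel K q) (FreeAlgebra.ι K 1)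

/-- The relation defining the Jordan plane `K_J[u,v]`: `v u = u v + u²`. -/
inductive JordanRel (K : Type*) [CommRing K] :
    FreeAlgebra K (Fin 2) → FreeAlgebra K (Fin 2) → Prop
  | rel : JordanRel K (FreeAlgebra.ι K 1 * FreeAlgebra.ι K 0)
      (FreeAlgebra.ι K 0 * FreeAlgebra.ι K 1 + FreeAlgebra.ι K 0 * FreeAlgebra.ι K 0)

/-- The Jordan plane `K_J[u,v] = K⟨u,v⟩/(vu - uv - u²)`. -/
abbrev JordanPlane (K : Type*) [CommRing K] := RingQuot (JordanRel K)

/-- The generator `u` of the Jordan plane. -/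
noncomputable def jU (K : Type*) [CommRing K] : JordanPlane K :=
  RingQuot.mkAlgHom K (JordanRel K) (FreeAlgebra.ι K 0)

/-- The generator `v` of the Jordan plane. -/
noncomputable def jV (K : Type*) [CommRing K] : JordanPlane K :=
  RingQuot.mkAlgHom K (JordanRel K) (FreeAlgebra.ι K 1)

/-- Gelfand–Kirillov dimension of a `K`-algebra `A`. -/
noncomputable def gkDim (K : Type*) (A : Type*) [Field K] [Ring A] [Algebra K A] : ℝ :=
  ⨆ V : {V : Submodule K A // V.FG ∧ 1 ∈ V},
    Filter.limsup
      (fun n : ℕ => Real.logb n (Module.finrank K ↥((V.1 : Submodule K A) ^ n)))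
      Filter.atTop

/-- Gelfand–Kirillov dimension of an `A`-module `M`, for a `K`-algebra `A`. -/
noncomputable def gkModuleDim (K : Type*) (A : Type*) (M : Type*) [Field K] [Ring A]
    [Algebra K A] [AddCommGroup M] [Module K M] [Module A M] [IsScalarTower K A M] : ℝ :=
  ⨆ p : {VF : Submodule K A × Submodule K M // VF.1.FG ∧ 1 ∈ VF.1 ∧ VF.2.FG},
    Filter.limsup
      (fun n : ℕ => Real.logb n (Module.finrank K
        ↥(Submodule.span K
            (Set.image2 (fun (a : A) (m : M) => a • m) ↑(p.1.1 ^ n) ↑(p.1.2)))))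
      Filter.atTop

open CategoryTheory in
/-- The grade `j(M) = inf {i : Ext^i_A(M, A) ≠ 0}` of a left `A`-module `M`. -/
noncomputable def moduleGrade (A : Type u) [Ring A] (M : Type u) [AddCommGroup M]
    [Module A M] : ℕ∞ :=
  sInf {n : ℕ∞ | ∃ i : ℕ, n = (i : ℕ∞) ∧
    Nontrivial (((Ext ℤ (ModuleCat A) i).obj (Opposite.op (ModuleCat.of A M))).obj
      (ModuleCat.of A A))}

/-- A `K`-algebra `A` is *GK-Cohen-Macaulay* if `GKdim M + j(M) = GKdim A` for all
nonzero finitely generated left and right `A`-modules `M`. -/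
def IsGKCohenMacaulay (K : Type*) (A : Type u) [Field K] [Ring A] [Algebra K A] : Prop :=
  (∀ (M : Type u) [AddCommGroup M] [Module K M] [Module A M] [IsScalarTower K A M],
      Module.Finite A M → Nontrivial M →
      ∃ jM : ℕ, moduleGrade A M = (jM : ℕ∞) ∧
        gkModuleDim K A M + (jM : ℝ) = gkDim K A) ∧
  (∀ (M : Type u) [AddCommGroup M] [Module K M] [Module Aᵐᵒᵖ M] [IsScalarTower K Aᵐᵒᵖ M],
      Module.Finite Aᵐᵒᵖ M → Nontrivial M →
      ∃ jM : ℕ, moduleGrade Aᵐᵒᵖ M = (jM : ℕ∞) ∧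
        gkModuleDim K Aᵐᵒᵖ M + (jM : ℝ) = gkDim K A)

/-- The algebra `A` is generated by `u, v` subject to `v u = q u v + c u²`, and the ordered
monomials `uⁱ vʲ` form a basis. -/
structure PlaneData (k : Type*) {A : Type*} [Field k] [Ring A] [Algebra k A] (q c : k) (u v : A) :
    Prop where
  q_ne : q ≠ 0
  rel : v * u = q • (u * v) + c • (u * u)
  li : LinearIndependent k (fun p : ℕ × ℕ => u ^ p.1 * v ^ p.2)
  span : ⊤ ≤ Submodule.span k (Set.range (fun p : ℕ × ℕ => u ^ p.1 * v ^ p.2))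

namespace PlaneData

variable {k A : Type*} [Field k] [Ring A] [Algebra k A] {q c : k} {u v : A}
  (P : PlaneData k q c u v)

/-- The monomial order: total degree first, then the exponent of `v`. -/
def lt (p r : ℕ × ℕ) : Prop := p.1 + p.2 < r.1 + r.2 ∨ (p.1 + p.2 = r.1 + r.2 ∧ p.2 < r.2)

lemma lt_trichotomy (p r : ℕ × ℕ) : lt p r ∨ p = r ∨ lt r p := by
  simp only [lt, Prod.ext_iff]; omega

lemma lt_trans {p r s : ℕ × ℕ} (h : lt p r) (h' : lt r s) : lt p s := by
  simp only [lt] at *; omega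

lemma lt_add {p r s : ℕ × ℕ} (h : lt p r) : lt (p + s) (r + s) := by
  simp only [lt, Prod.fst_add, Prod.snd_add] at *; omega

lemma lt_wf : WellFounded lt :=
  Subrelation.wf (r := InvImage (· < ·) (fun p : ℕ × ℕ => toLex (p.1 + p.2, p.2)))
    (fun {p r} h => by
      simp only [InvImage, Prod.Lex.toLex_lt_toLex]
      exact h) (InvImage.wf _ wellFounded_lt)

/-- The monomial basis. -/
noncomputable def basis : Module.Basis (ℕ × ℕ) k A := Module.Basis.mk P.li P.span

lemma basis_apply (p : ℕ × ℕ) : P.basis p = u ^ p.1 * v ^ p.2 := by simp [basis]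

/-- The span of a set of monomials. -/
noncomputable def sp (S : Set (ℕ × ℕ)) : Submodule k A := Submodule.span k (P.basis '' S)

lemma mem_sp {S : Set (ℕ × ℕ)} {x : A} : x ∈ P.sp S ↔ ∀ r, r ∉ S → P.basis.repr x r = 0 := by
  rw [sp, Module.Basis.mem_span_image]
  constructor
  · intro h r hr
    by_contra h'
    exact hr (h (Finsupp.mem_support_iff.2 h'))
  · intro h r hr
    by_contra h'
    exact Finsupp.mem_support_iff.1 hr (h r h')

lemma sp_mono {S S' : Set (ℕ × ℕ)} (h : S ⊆ S') : P.sp S ≤ P.sp S' :=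
  Submodule.span_mono (Set.image_mono h)

lemma basis_mem_sp {S : Set (ℕ × ℕ)} {p : ℕ × ℕ} (h : p ∈ S) : P.basis p ∈ P.sp S :=
  Submodule.subset_span ⟨p, h, rfl⟩

lemma sp_le {S : Set (ℕ × ℕ)} {N : Submodule k A} (h : ∀ r ∈ S, P.basis r ∈ N) : P.sp S ≤ N := by
  rw [sp, Submodule.span_le]
  rintro _ ⟨r, hr, rfl⟩
  exact h r hr

lemma map_mem_of_mem_sp {B : Type*} [AddCommGroup B] [Module k B] {S : Set (ℕ × ℕ)}
    {N : Submodule k B} (f : A →ₗ[k] B) (h : ∀ r ∈ S, f (P.basis r) ∈ N) {x : A}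
    (hx : x ∈ P.sp S) : f x ∈ N :=
  P.sp_le (N := N.comap f) h hx

/-- The span of the monomials below `p`. -/
noncomputable def below (p : ℕ × ℕ) : Submodule k A := P.sp {r | lt r p}

lemma below_mono {p r : ℕ × ℕ} (h : lt p r) : P.below p ≤ P.below r :=
  P.sp_mono fun _ h' => lt_trans h' h

/-- `x` is `α` times the monomial `p`, up to smaller monomials. -/
def Ld (x : A) (p : ℕ × ℕ) (α : k) : Prop := x - α • P.basis p ∈ P.below p

variable {P}

lemma Ld.repr {x : A} {p : ℕ × ℕ} {α : k} (h : P.Ld x p α) : P.basis.repr x p = α := by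
  have := P.mem_sp.1 h p (by simp [lt])
  simpa [sub_eq_zero] using this

lemma Ld.repr_eq_zero {x : A} {p : ℕ × ℕ} {α : k} (h : P.Ld x p α) {r : ℕ × ℕ} (hr : lt p r) :
    P.basis.repr x r = 0 := by
  have := P.mem_sp.1 h r (by simp only [lt, Set.mem_ofPred_eq] at *; omega)
  have hne : p ≠ r := by rintro rfl; simp [lt] at hr
  simpa [Finsupp.single_apply, hne] using this

lemma Ld.zero {x : A} {p : ℕ × ℕ} (h : P.Ld x p 0) : x ∈ P.below p := by simpa [Ld] using h

lemma ld_zero_iff {x : A} {p : ℕ × ℕ} : P.Ld x p 0 ↔ x ∈ P.below p := by simp [Ld]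

lemma Ld.of_lt {x : A} {p r : ℕ × ℕ} {α : k} (h : P.Ld x p α) (hr : lt p r) : x ∈ P.below r := by
  have := (P.below r).add_mem (P.below_mono hr h)
    ((P.below r).smul_mem α (P.basis_mem_sp (S := {s | lt s r}) hr))
  simpa using this

lemma Ld.ne_zero {x : A} {p : ℕ × ℕ} {α : k} (h : P.Ld x p α) (hα : α ≠ 0) : x ≠ 0 := by
  rintro rfl
  exact hα (by simpa using h.repr.symm)

lemma Ld.add {x y : A} {p : ℕ × ℕ} {α β : k} (h : P.Ld x p α) (h' : P.Ld y p β) :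
    P.Ld (x + y) p (α + β) := by
  have := (P.below p).add_mem h h'
  rw [Ld, add_smul]; convert this using 1; abel

lemma Ld.smul {x : A} {p : ℕ × ℕ} {α : k} (h : P.Ld x p α) (β : k) :
    P.Ld (β • x) p (β * α) := by
  have := (P.below p).smul_mem β h
  rw [Ld, mul_smul]; convert this using 1; rw [smul_sub]

lemma Ld.sum {ι : Type*} (s : Finset ι) {x : ι → A} {p : ℕ × ℕ} {α : ι → k}
    (h : ∀ i ∈ s, P.Ld (x i) p (α i)) : P.Ld (∑ i ∈ s, x i) p (∑ i ∈ s, α i) := by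
  classical
  induction s using Finset.induction_on with
  | empty => simp [Ld]
  | insert i s hi ih =>
    rw [Finset.sum_insert hi, Finset.sum_insert hi]
    exact (h i (by simp)).add (ih fun j hj => h j (by simp [hj]))

lemma ld_basis (p : ℕ × ℕ) : P.Ld (P.basis p) p 1 := by simp [Ld]

variable (P)

lemma u_mul_basis (p : ℕ × ℕ) : u * P.basis p = P.basis (p.1 + 1, p.2) := by
  simp [basis_apply, pow_succ', mul_assoc]

/-- The coefficients appearing in `v uⁱ = qⁱ uⁱ v + cᵢ uⁱ⁺¹`. -/
def shiftCoeff (q c : k) : ℕ → k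
  | 0 => 0
  | i + 1 => shiftCoeff q c i + q ^ i * c

lemma mul_pow_of_rel (h : v * u = q • (u * v) + c • (u * u)) (i : ℕ) :
    v * u ^ i = q ^ i • (u ^ i * v) + shiftCoeff q c i • u ^ (i + 1) := by
  induction i with
  | zero => simp [shiftCoeff]
  | succ i ih =>
    rw [pow_succ, ← mul_assoc, ih, add_mul, smul_mul_assoc, smul_mul_assoc, mul_assoc, h,
      mul_add, mul_smul_comm, mul_smul_comm, smul_add, smul_smul, smul_smul, ← pow_succ, shiftCoeff,
      add_smul]
    simp only [pow_succ, mul_assoc]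
    abel

include P in
lemma v_mul_u_pow (i : ℕ) : v * u ^ i = q ^ i • (u ^ i * v) + shiftCoeff q c i • u ^ (i + 1) :=
  mul_pow_of_rel P.rel i

lemma v_mul_basis (p : ℕ × ℕ) : v * P.basis p =
    q ^ p.1 • P.basis (p.1, p.2 + 1) + shiftCoeff q c p.1 • P.basis (p.1 + 1, p.2) := by
  simp only [basis_apply]
  rw [← mul_assoc, P.v_mul_u_pow, add_mul, smul_mul_assoc, smul_mul_assoc, mul_assoc,
    ← pow_succ']

variable {P}

lemma Ld.u_mul {x : A} {p : ℕ × ℕ} {α : k} (h : P.Ld x p α) :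
    P.Ld (u * x) (p.1 + 1, p.2) α := by
  have : u * (x - α • P.basis p) ∈ P.below (p.1 + 1, p.2) :=
    P.map_mem_of_mem_sp (LinearMap.mulLeft k u) (fun r hr => by
      rw [LinearMap.mulLeft_apply, u_mul_basis]
      exact P.basis_mem_sp (by simp only [lt, Set.mem_ofPred_eq] at *; omega)) h
  rwa [mul_sub, mul_smul_comm, u_mul_basis] at this

lemma Ld.v_mul {x : A} {p : ℕ × ℕ} {α : k} (h : P.Ld x p α) :
    P.Ld (v * x) (p.1, p.2 + 1) (q ^ p.1 * α) := by
  have : v * (x - α • P.basis p) ∈ P.below (p.1, p.2 + 1) :=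
    P.map_mem_of_mem_sp (LinearMap.mulLeft k v) (fun r hr => by
      rw [LinearMap.mulLeft_apply, v_mul_basis]
      refine Submodule.add_mem _ (Submodule.smul_mem _ _ (P.basis_mem_sp ?_))
        (Submodule.smul_mem _ _ (P.basis_mem_sp ?_)) <;>
      · simp only [lt, Set.mem_ofPred_eq] at *; omega) h
  rw [mul_sub, mul_smul_comm, v_mul_basis] at this
  have h2 : P.basis (p.1 + 1, p.2) ∈ P.below (p.1, p.2 + 1) :=
    P.basis_mem_sp (by simp only [lt, Set.mem_ofPred_eq]; omega)
  have := (P.below (p.1, p.2 + 1)).add_mem this ((P.below _).smul_mem (α * shiftCoeff q c p.1) h2)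
  rw [Ld]
  convert this using 1
  rw [smul_add, smul_smul, smul_smul, mul_comm α]
  abel

lemma Ld.v_pow_mul {x : A} {p : ℕ × ℕ} {α : k} (h : P.Ld x p α) (j : ℕ) :
    P.Ld (v ^ j * x) (p.1, p.2 + j) (q ^ (j * p.1) * α) := by
  induction j with
  | zero => simpa using h
  | succ j ih =>
    rw [show q ^ ((j + 1) * p.1) * α = q ^ p.1 * (q ^ (j * p.1) * α) by ring, pow_succ',
      mul_assoc]
    exact ih.v_mul

lemma Ld.u_pow_mul {x : A} {p : ℕ × ℕ} {α : k} (h : P.Ld x p α) (i : ℕ) :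
    P.Ld (u ^ i * x) (p.1 + i, p.2) α := by
  induction i with
  | zero => simpa using h
  | succ j ih =>
    have := ih.u_mul
    rw [pow_succ', mul_assoc]
    exact this

lemma Ld.basis_mul {x : A} {p : ℕ × ℕ} {α : k} (h : P.Ld x p α) (s : ℕ × ℕ) :
    P.Ld (P.basis s * x) (s + p) (q ^ (s.2 * p.1) * α) := by
  rw [basis_apply, mul_assoc]
  convert (h.v_pow_mul s.2).u_pow_mul s.1 using 1
  ext <;> simp [add_comm]

lemma Ld.mul {x y : A} {p r : ℕ × ℕ} {α β : k} (hx : P.Ld x p α) (hy : P.Ld y r β) :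
    P.Ld (x * y) (p + r) (α * (q ^ (p.2 * r.1) * β)) := by
  have h1 : (x - α • P.basis p) * y ∈ P.below (p + r) :=
    P.map_mem_of_mem_sp (LinearMap.mulRight k y) (fun s hs =>
      (hy.basis_mul s).of_lt (lt_add hs)) hx
  have h2 := ((hy.basis_mul p).smul α).add (ld_zero_iff.2 h1)
  rw [add_zero] at h2
  convert h2 using 1
  simp [sub_mul]

variable (P)

/-- Any finite family which is not identically zero has a common leading monomial. -/
lemma exists_ld_family {ι : Type*} [Fintype ι] (x : ι → A) (hx : x ≠ 0) :
    ∃ (p : ℕ × ℕ) (α : ι → k), (∀ i, P.Ld (x i) p (α i)) ∧ α ≠ 0 := by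
  classical
  let s : Finset (ℕ × ℕ) := Finset.univ.biUnion fun i => (P.basis.repr (x i)).support
  have hs : s.Nonempty := by
    obtain ⟨i, hi⟩ := Function.ne_iff.1 hx
    have : P.basis.repr (x i) ≠ 0 := by simpa using hi
    obtain ⟨p, hp⟩ := Finsupp.support_nonempty_iff.2 this
    exact ⟨p, Finset.mem_biUnion.2 ⟨i, by simp, hp⟩⟩
  obtain ⟨p, hp, hmax⟩ := s.exists_max_image (fun p => toLex (p.1 + p.2, p.2)) hs
  refine ⟨p, fun i => P.basis.repr (x i) p, fun i => P.mem_sp.2 fun r hr => ?_, ?_⟩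
  · rcases lt_trichotomy r p with h | rfl | h
    · exact absurd h hr
    · simp
    · have hne : p ≠ r := by rintro rfl; simp [lt] at h
      have : P.basis.repr (x i) r = 0 := by
        by_contra h'
        have hle := hmax r (Finset.mem_biUnion.2 ⟨i, by simp, Finsupp.mem_support_iff.2 h'⟩)
        rw [Prod.Lex.toLex_le_toLex] at hle
        simp only [lt] at h; simp only at hle; omega
      simp [this, hne]
  · obtain ⟨i, -, hi⟩ := Finset.mem_biUnion.1 hp
    exact Function.ne_iff.2 ⟨i, Finsupp.mem_support_iff.1 hi⟩

lemma exists_ld {x : A} (hx : x ≠ 0) : ∃ (p : ℕ × ℕ) (α : k), P.Ld x p α ∧ α ≠ 0 := by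
  obtain ⟨p, α, h, hα⟩ := P.exists_ld_family (fun _ : Unit => x)
    (Function.ne_iff.2 ⟨(), hx⟩)
  obtain ⟨i, hi⟩ := Function.ne_iff.1 hα
  exact ⟨p, α i, h i, hi⟩

include P in
lemma nontrivial : Nontrivial A := ⟨P.basis 0, 0, P.basis.ne_zero 0⟩

include P in
lemma mul_ne_zero {x y : A} (hx : x ≠ 0) (hy : y ≠ 0) : x * y ≠ 0 := by
  obtain ⟨p, α, h, hα⟩ := P.exists_ld hx
  obtain ⟨r, β, h', hβ⟩ := P.exists_ld hy
  exact (h.mul h').ne_zero (_root_.mul_ne_zero hα (_root_.mul_ne_zero (pow_ne_zero _ P.q_ne) hβ))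

include P in
lemma noZeroDivisors : NoZeroDivisors A :=
  ⟨fun {x y} h => by by_contra h'; push Not at h'; exact P.mul_ne_zero h'.1 h'.2 h⟩

include P in
lemma u_ne_zero : u ≠ 0 := by
  have := P.basis.ne_zero (1, 0)
  simpa [basis_apply] using this

include P in
lemma isNoetherianRing : IsNoetherianRing A := by
  rw [isNoetherianRing_iff, isNoetherian_iff']
  refine ⟨wellFounded_iff_isEmpty_descending_chain.2 ⟨fun ⟨f, hf⟩ => ?_⟩⟩
  have hmono : Monotone f := monotone_nat_of_le_succ fun n => (hf n).le
  have key : ∀ n, ∃ p, (∃ x ∈ f (n + 1), P.Ld x p 1) ∧ ¬ ∃ x ∈ f n, P.Ld x p 1 := by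
    intro n
    by_contra! hcon
    refine (hf n).not_ge ?_
    have : ∀ p, ∀ x ∈ f (n + 1), ∀ α, P.Ld x p α → x ∈ f n := by
      intro p
      induction p using lt_wf.induction with
      | _ p ih =>
      intro x hx α hxp
      by_cases hα : α = 0
      · subst hα
        by_cases hx0 : x = 0
        · rw [hx0]; exact zero_mem _
        · obtain ⟨r, β, hr, hβ⟩ := P.exists_ld hx0
          refine ih r ?_ x hx β hr
          by_contra hlt
          exact hβ (hr.repr.symm.trans (P.mem_sp.1 hxp.zero r hlt))
      · obtain ⟨y, hy, hyp⟩ := hcon p ⟨α⁻¹ • x, by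
          rw [Algebra.smul_def]; exact (f (n + 1)).smul_mem _ hx, by
          simpa [hα] using hxp.smul α⁻¹⟩
        have hy' : α • y ∈ f n := by rw [Algebra.smul_def]; exact (f n).smul_mem _ hy
        have hz := hxp.add (hyp.smul (-α))
        have hzm : x + (-α) • y ∈ f (n + 1) := by
          rw [neg_smul]
          exact add_mem hx (neg_mem (hmono n.le_succ hy'))
        have hz0 : x + (-α) • y ∈ f n := by
          by_cases hx0 : x + (-α) • y = 0
          · rw [hx0]; exact zero_mem _
          · obtain ⟨r, β, hr, hβ⟩ := P.exists_ld hx0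
            refine ih r ?_ _ hzm β hr
            by_contra hlt
            rw [mul_one, add_neg_cancel] at hz
            exact hβ (hr.repr.symm.trans (P.mem_sp.1 hz.zero r hlt))
        have := add_mem hz0 hy'
        simpa using this
    intro x hx
    by_cases hx0 : x = 0
    · rw [hx0]; exact zero_mem _
    · obtain ⟨r, β, hr, -⟩ := P.exists_ld hx0
      exact this r x hx β hr
  choose p hp hp' using key
  obtain ⟨m, n, hmn, hle⟩ := wellQuasiOrdered_le p
  obtain ⟨x, hx, hxp⟩ := hp m
  obtain ⟨s, hs⟩ := le_iff_exists_add.1 hle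
  refine hp' n ⟨(q ^ (s.2 * (p m).1))⁻¹ • (P.basis s * x), ?_, ?_⟩
  · rw [Algebra.smul_def]
    exact (f n).smul_mem _ ((f n).smul_mem _ (hmono (Nat.succ_le_of_lt hmn) hx))
  · have := (hxp.basis_mul s).smul (q ^ (s.2 * (p m).1))⁻¹
    rw [mul_one, inv_mul_cancel₀ (pow_ne_zero _ P.q_ne)] at this
    rwa [hs, add_comm]

end PlaneData

namespace PlaneData

variable {k A : Type*} [Field k] [Ring A] [Algebra k A] {q c : k} {u v : A}
  (P : PlaneData k q c u v)

/-- Elements of degree less than `d`. -/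
noncomputable def fl (d : ℕ) : Submodule k A := P.sp {r | r.1 + r.2 < d}

lemma mem_fl {d : ℕ} {x : A} : x ∈ P.fl d ↔ ∀ r : ℕ × ℕ, d ≤ r.1 + r.2 → P.basis.repr x r = 0 := by
  simp [fl, mem_sp]

lemma fl_mono {d e : ℕ} (h : d ≤ e) : P.fl d ≤ P.fl e :=
  P.sp_mono fun _ hr => lt_of_lt_of_le hr h

lemma basis_mem_fl {p : ℕ × ℕ} {d : ℕ} (h : p.1 + p.2 < d) : P.basis p ∈ P.fl d :=
  P.basis_mem_sp h

lemma mem_fl_zero {x : A} : x ∈ P.fl 0 ↔ x = 0 := by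
  rw [mem_fl, ← P.basis.repr.map_eq_zero_iff]
  constructor
  · intro h; ext r; exact h r (Nat.zero_le _)
  · intro h r _; rw [h]; rfl

lemma exists_mem_fl (x : A) : ∃ d, x ∈ P.fl d := by
  classical
  refine ⟨(P.basis.repr x).support.sup (fun r => r.1 + r.2) + 1, P.mem_fl.2 fun r hr => ?_⟩
  by_contra h
  have := Finset.le_sup (f := fun r : ℕ × ℕ => r.1 + r.2) (Finsupp.mem_support_iff.2 h)
  omega

/-- Finitely many elements have bounded degree. -/
lemma exists_forall_mem_fl {ι : Type*} [Finite ι] (x : ι → A) : ∃ d, ∀ i, x i ∈ P.fl d := by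
  cases nonempty_fintype ι
  choose d hd using fun i => P.exists_mem_fl (x i)
  exact ⟨Finset.univ.sup d, fun i => P.fl_mono (Finset.le_sup (by simp)) (hd i)⟩

lemma basis_zero : P.basis 0 = 1 := by simp [basis_apply]

lemma one_mem_fl : (1 : A) ∈ P.fl 1 := by
  rw [← P.basis_zero]; exact P.basis_mem_fl (by simp)

lemma u_mul_mem_fl {d : ℕ} {x : A} (hx : x ∈ P.fl d) : u * x ∈ P.fl (d + 1) :=
  P.map_mem_of_mem_sp (LinearMap.mulLeft k u) (fun r hr => by
    rw [LinearMap.mulLeft_apply, u_mul_basis]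
    exact P.basis_mem_fl (by simp only [Set.mem_ofPred_eq] at *; omega)) hx

lemma v_mul_mem_fl {d : ℕ} {x : A} (hx : x ∈ P.fl d) : v * x ∈ P.fl (d + 1) :=
  P.map_mem_of_mem_sp (LinearMap.mulLeft k v) (fun r hr => by
    rw [LinearMap.mulLeft_apply, v_mul_basis]
    refine Submodule.add_mem _ (Submodule.smul_mem _ _ (P.basis_mem_fl ?_))
        (Submodule.smul_mem _ _ (P.basis_mem_fl ?_)) <;>
      · simp only [Set.mem_ofPred_eq] at *; omega) hx

lemma basis_mul_mem_fl (p : ℕ × ℕ) {d : ℕ} {x : A} (hx : x ∈ P.fl d) :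
    P.basis p * x ∈ P.fl (p.1 + p.2 + d) := by
  have h1 : ∀ j, v ^ j * x ∈ P.fl (j + d) := by
    intro j
    induction j with
    | zero => simpa using hx
    | succ j ih =>
      rw [pow_succ', mul_assoc, show j + 1 + d = j + d + 1 by ring]
      exact P.v_mul_mem_fl ih
  have h2 : ∀ i, u ^ i * (v ^ p.2 * x) ∈ P.fl (i + (p.2 + d)) := by
    intro j
    induction j with
    | zero => simpa using h1 p.2
    | succ j ih =>
      rw [pow_succ', mul_assoc, show j + 1 + (p.2 + d) = j + (p.2 + d) + 1 by ring]
      exact P.u_mul_mem_fl ih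
  rw [basis_apply, mul_assoc, add_assoc]
  exact h2 p.1

lemma mul_mem_fl {d e : ℕ} {x y : A} (hx : x ∈ P.fl (d + 1)) (hy : y ∈ P.fl e) :
    x * y ∈ P.fl (d + e) :=
  P.map_mem_of_mem_sp (LinearMap.mulRight k y) (fun r hr => by
    rw [LinearMap.mulRight_apply]
    refine P.fl_mono ?_ (P.basis_mul_mem_fl r hy)
    simp only [Set.mem_ofPred_eq] at hr; omega) hx

lemma not_mem_fl_mul {d e : ℕ} {x y : A} (hx : x ∉ P.fl d) (hy : y ∉ P.fl e) :
    x * y ∉ P.fl (d + e) := by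
  have key : ∀ {z : A} {f : ℕ}, z ∉ P.fl f → ∃ p α, P.Ld z p α ∧ α ≠ 0 ∧ f ≤ p.1 + p.2 := by
    intro z f hz
    have hz0 : z ≠ 0 := by rintro rfl; exact hz (zero_mem _)
    obtain ⟨p, α, h, hα⟩ := P.exists_ld hz0
    refine ⟨p, α, h, hα, ?_⟩
    by_contra! hlt
    refine hz (P.mem_fl.2 fun r hr => h.repr_eq_zero ?_)
    simp only [lt]; omega
  obtain ⟨p, α, h, hα, hp⟩ := key hx
  obtain ⟨r, β, h', hβ, hr⟩ := key hy
  intro hxy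
  have := P.mem_fl.1 hxy (p + r) (by simp only [Prod.fst_add, Prod.snd_add]; omega)
  rw [(h.mul h').repr] at this
  exact _root_.mul_ne_zero hα (_root_.mul_ne_zero (pow_ne_zero _ P.q_ne) hβ) this

lemma mem_fl_of_u_mul {d : ℕ} {x : A} (h : u * x ∈ P.fl (d + 1)) : x ∈ P.fl d := by
  by_contra hx
  refine P.not_mem_fl_mul (d := 1) (e := d) (x := u) (y := x) ?_ hx (by rwa [add_comm])
  intro hu
  have h1 := P.mem_fl.1 hu (1, 0) (by simp)
  have h2 : P.basis (1, 0) = u := by simp [basis_apply]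
  have h3 : P.basis.repr (P.basis (1, 0)) (1, 0) = 0 := by rw [h2]; exact h1
  simp at h3

/-- The projection onto the homogeneous component of degree `d`. -/
noncomputable def pr (d : ℕ) : A →ₗ[k] A :=
  P.basis.constr k fun p => if p.1 + p.2 = d then P.basis p else 0

lemma pr_basis (d : ℕ) (p : ℕ × ℕ) :
    P.pr d (P.basis p) = if p.1 + p.2 = d then P.basis p else 0 := by
  simp [pr]

lemma repr_pr (d : ℕ) (x : A) (r : ℕ × ℕ) :
    P.basis.repr (P.pr d x) r = if r.1 + r.2 = d then P.basis.repr x r else 0 := by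
  have : (P.basis.coord r) ∘ₗ (P.pr d) = if r.1 + r.2 = d then P.basis.coord r else 0 := by
    refine P.basis.ext fun p => ?_
    rw [LinearMap.comp_apply, pr_basis]
    by_cases hpr : p = r
    · subst hpr; split_ifs <;> simp
    · split_ifs <;> simp [hpr]
  have := LinearMap.congr_fun this x
  split_ifs at this ⊢ <;> simpa using this

lemma ext_repr {x y : A} (h : ∀ r, P.basis.repr x r = P.basis.repr y r) : x = y :=
  P.basis.ext_elem h

lemma pr_mem_fl (d : ℕ) (x : A) : P.pr d x ∈ P.fl (d + 1) :=
  P.mem_fl.2 fun r hr => by rw [repr_pr, if_neg (by omega)]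

lemma sub_pr_mem_fl {d : ℕ} {x : A} (hx : x ∈ P.fl (d + 1)) : x - P.pr d x ∈ P.fl d :=
  P.mem_fl.2 fun r hr => by
    rw [map_sub, Finsupp.sub_apply, repr_pr]
    split_ifs with h
    · simp
    · rw [P.mem_fl.1 hx r (by omega), sub_zero]

lemma pr_eq_zero {d e : ℕ} {x : A} (hx : x ∈ P.fl e) (h : e ≤ d) : P.pr d x = 0 :=
  P.ext_repr fun r => by
    rw [repr_pr]
    split_ifs with h'
    · rw [P.mem_fl.1 hx r (by omega)]; simp
    · simp

lemma pr_u_mul (d : ℕ) (x : A) : P.pr (d + 1) (u * x) = u * P.pr d x := by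
  have : P.pr (d + 1) ∘ₗ LinearMap.mulLeft k u = LinearMap.mulLeft k u ∘ₗ P.pr d := by
    refine P.basis.ext fun p => ?_
    simp only [LinearMap.comp_apply, LinearMap.mulLeft_apply, u_mul_basis, pr_basis]
    by_cases h : p.1 + p.2 = d
    · rw [if_pos (by omega), if_pos h, u_mul_basis]
    · rw [if_neg (by omega), if_neg h, mul_zero]
  exact LinearMap.congr_fun this x

lemma pr_v_mul (d : ℕ) (x : A) : P.pr (d + 1) (v * x) = v * P.pr d x := by
  have : P.pr (d + 1) ∘ₗ LinearMap.mulLeft k v = LinearMap.mulLeft k v ∘ₗ P.pr d := by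
    refine P.basis.ext fun p => ?_
    simp only [LinearMap.comp_apply, LinearMap.mulLeft_apply, v_mul_basis, pr_basis, map_add,
      map_smul]
    by_cases h : p.1 + p.2 = d
    · rw [if_pos (by omega), if_pos h, if_pos (by omega), v_mul_basis]
    · rw [if_neg (by omega), if_neg h, if_neg (by omega)]; simp
  exact LinearMap.congr_fun this x

lemma pr_zero_v_mul (x : A) : P.pr 0 (v * x) = 0 := by
  have : P.pr 0 ∘ₗ LinearMap.mulLeft k v = 0 := by
    refine P.basis.ext fun p => ?_
    simp [v_mul_basis, pr_basis]
  exact LinearMap.congr_fun this x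

/-- Division by `u` on the left, killing the powers of `v`. -/
noncomputable def divU : A →ₗ[k] A :=
  P.basis.constr k fun p => if p.1 = 0 then 0 else P.basis (p.1 - 1, p.2)

lemma u_mul_divU {x : A} (h : ∀ j, P.basis.repr x (0, j) = 0) : u * P.divU x = x := by
  classical
  have hx : x ∈ P.sp {r | r.1 ≠ 0} := P.mem_sp.2 fun r hr => by
    have : r.1 = 0 := by simpa using hr
    have := h r.2
    rwa [show ((0 : ℕ), r.2) = r by ext <;> simp [*]] at this
  have := P.map_mem_of_mem_sp (N := (⊥ : Submodule k A))
    (LinearMap.mulLeft k u ∘ₗ P.divU - LinearMap.id) (fun r hr => by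
      have hr : r.1 ≠ 0 := hr
      simp only [divU, LinearMap.sub_apply, LinearMap.comp_apply, Module.Basis.constr_basis,
        if_neg hr, LinearMap.mulLeft_apply, u_mul_basis, LinearMap.id_apply, Submodule.mem_bot]
      rw [sub_eq_zero, Nat.sub_add_cancel (by omega)]) hx
  simpa [sub_eq_zero] using this

lemma repr_u_mul_zero (x : A) (j : ℕ) : P.basis.repr (u * x) (0, j) = 0 := by
  have : P.basis.coord (0, j) ∘ₗ LinearMap.mulLeft k u = 0 := by
    refine P.basis.ext fun p => ?_
    simp [u_mul_basis]
  exact LinearMap.congr_fun this x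

lemma repr_v_mul_zero (x : A) (j : ℕ) :
    P.basis.repr (v * x) (0, j + 1) = P.basis.repr x (0, j) := by
  classical
  have : P.basis.coord (0, j + 1) ∘ₗ LinearMap.mulLeft k v = P.basis.coord (0, j) := by
    refine P.basis.ext fun p => ?_
    simp only [LinearMap.comp_apply, LinearMap.mulLeft_apply, v_mul_basis, map_add, map_smul,
      Module.Basis.coord_apply, Module.Basis.repr_self, Finsupp.single_apply, Prod.ext_iff,
      smul_eq_mul]
    by_cases h0 : p.1 = 0
    · simp [h0]
    · simp [h0]
  exact LinearMap.congr_fun this x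

include P in
lemma u_mul_cancel {x y : A} (h : u * x = u * y) : x = y := by
  have := P.noZeroDivisors
  have h' : u * (x - y) = 0 := by rw [mul_sub, h, sub_self]
  rcases mul_eq_zero.1 h' with h0 | h0
  · exact absurd h0 P.u_ne_zero
  · exact sub_eq_zero.1 h0

/-- If `u x + v y = 0` then `y` is a left multiple of `u`. -/
lemma eq_divU {x y : A} (h : u * x + v * y = 0) :
    u * P.divU y = y ∧ x = -(q • (v * P.divU y) + c • (u * P.divU y)) := by
  have hy : u * P.divU y = y := by
    refine P.u_mul_divU fun j => ?_
    have := congrArg (fun z => P.basis.repr z (0, j + 1)) h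
    simpa [repr_u_mul_zero, repr_v_mul_zero] using this
  refine ⟨hy, ?_⟩
  rw [← hy, ← mul_assoc v, P.rel] at h
  have h2 : u * (x + (q • (v * P.divU y) + c • (u * P.divU y))) = u * 0 := by
    rw [mul_zero, ← h]
    simp only [mul_add, add_mul, smul_mul_assoc, mul_smul_comm, mul_assoc]
  exact eq_neg_of_add_eq_zero_left (P.u_mul_cancel h2)

/-- Every element is a constant plus an element of `uA + vA`. -/
lemma exists_decomp {d : ℕ} {x : A} (hx : x ∈ P.fl (d + 1)) :
    ∃ a : k, ∃ y ∈ P.fl d, ∃ z ∈ P.fl d, x = algebraMap k A a + u * y + v * z := by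
  have : P.fl (d + 1) ≤ (Submodule.span k {1}) ⊔ ((P.fl d).map (LinearMap.mulLeft k u) ⊔
      (P.fl d).map (LinearMap.mulLeft k v)) := P.sp_le fun r hr => by
    simp only [Set.mem_ofPred_eq] at hr
    obtain ⟨i, j⟩ := r
    rcases i with _ | i
    · rcases j with _ | j
      · exact Submodule.mem_sup_left (by
          rw [show ((0 : ℕ), (0 : ℕ)) = 0 from rfl, basis_zero]
          exact Submodule.mem_span_singleton_self _)
      · refine Submodule.mem_sup_right (Submodule.mem_sup_right ⟨P.basis (0, j),
          P.basis_mem_fl (by simp at *; omega), ?_⟩)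
        simp [v_mul_basis, shiftCoeff]
    · refine Submodule.mem_sup_right (Submodule.mem_sup_left ⟨P.basis (i, j),
          P.basis_mem_fl (by simp at *; omega), ?_⟩)
      simp [u_mul_basis]
  obtain ⟨x1, h1, x2, h2, rfl⟩ := Submodule.mem_sup.1 (this hx)
  obtain ⟨_, ⟨y, hy, rfl⟩, _, ⟨z, hz, rfl⟩, rfl⟩ := Submodule.mem_sup.1 h2
  obtain ⟨a, rfl⟩ := Submodule.mem_span_singleton.1 h1
  exact ⟨a, y, hy, z, hz, by rw [Algebra.algebraMap_eq_smul_one]; simp [add_assoc]⟩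

include P in
/-- A subspace stable under `u` and `v` is stable under `A`. -/
lemma smul_mem_of_stable {X : Type*} [AddCommGroup X] [Module k X] [Module A X]
    [IsScalarTower k A X] (N : Submodule k X) (hu : ∀ x ∈ N, u • x ∈ N) (hv : ∀ x ∈ N, v • x ∈ N)
    (a : A) {x : X} (hx : x ∈ N) : a • x ∈ N := by
  have : ∀ d, ∀ a ∈ P.fl d, a • x ∈ N := by
    intro d
    induction d with
    | zero =>
      intro a ha
      rw [P.mem_fl_zero.1 ha, zero_smul]; exact zero_mem _
    | succ d ih =>
      intro a ha
      obtain ⟨b, y, hy, z, hz, rfl⟩ := P.exists_decomp ha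
      rw [add_smul, add_smul, mul_smul, mul_smul, algebraMap_smul]
      exact add_mem (add_mem (N.smul_mem _ hx) (hu _ (ih y hy))) (hv _ (ih z hz))
  obtain ⟨d, hd⟩ := P.exists_mem_fl a
  exact this d a hd

include P in
/-- A linear map commuting with `u` and `v` is `A`-linear. -/
lemma map_smul_of_commute {X Y : Type*} [AddCommGroup X] [Module k X] [Module A X]
    [IsScalarTower k A X] [AddCommGroup Y] [Module k Y] [Module A Y]
    [IsScalarTower k A Y] (f : X →ₗ[k] Y) (hu : ∀ x, f (u • x) = u • f x)
    (hv : ∀ x, f (v • x) = v • f x) (a : A) (x : X) : f (a • x) = a • f x := by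
  have : ∀ d, ∀ a ∈ P.fl d, ∀ x, f (a • x) = a • f x := by
    intro d
    induction d with
    | zero =>
      intro a ha
      rw [P.mem_fl_zero.1 ha]; simp
    | succ d ih =>
      intro a ha x
      obtain ⟨b, y, hy, z, hz, rfl⟩ := P.exists_decomp ha
      simp only [add_smul, mul_smul, algebraMap_smul, map_add, map_smul, hu, hv, ih y hy, ih z hz]
  obtain ⟨d, hd⟩ := P.exists_mem_fl a
  exact this d a hd x

/-- The dimension of the space of elements of degree less than `d`. -/
def hd (d : ℕ) : ℕ := ∑ i ∈ Finset.range d, (i + 1)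

lemma hd_succ (d : ℕ) : hd (d + 1) = hd d + (d + 1) := Finset.sum_range_succ _ _

lemma two_mul_hd (d : ℕ) : 2 * hd d = d * (d + 1) := by
  induction d with
  | zero => simp [hd]
  | succ d ih => rw [hd_succ, mul_add, ih]; ring

lemma fl_eq_span (d : ℕ) : P.fl d = Submodule.span k (Set.range fun r :
    (Finset.range d).biUnion (fun i => Finset.HasAntidiagonal.antidiagonal i) => P.basis r.1) := by
  rw [fl, sp]
  congr 1
  ext x
  simp only [Set.mem_image, Set.mem_ofPred_eq, Set.mem_range, Subtype.exists, Finset.mem_biUnion,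
    Finset.mem_range, Finset.HasAntidiagonal.mem_antidiagonal]
  constructor
  · rintro ⟨r, hr, rfl⟩; exact ⟨r, ⟨_, hr, rfl⟩, rfl⟩
  · rintro ⟨r, ⟨i, hi, rfl⟩, rfl⟩; exact ⟨r, hi, rfl⟩

instance finite_fl (d : ℕ) : Module.Finite k (P.fl d) := by
  rw [fl_eq_span]
  exact Module.Finite.span_of_finite k (Set.finite_range _)

lemma finrank_fl (d : ℕ) : Module.finrank k (P.fl d) = hd d := by
  have hli := P.basis.linearIndependent.comp (Subtype.val : (Finset.range d).biUnion
    (fun i => Finset.HasAntidiagonal.antidiagonal i) → ℕ × ℕ) Subtype.val_injective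
  rw [fl_eq_span]
  refine (finrank_span_eq_card hli).trans ?_
  rw [Fintype.card_coe, Finset.card_biUnion]
  · simp [hd]
  · intro i _ j _ hij
    refine Finset.disjoint_left.2 ?_
    intro r hr hr'
    exact hij ((Finset.HasAntidiagonal.mem_antidiagonal.1 hr).symm.trans
      (Finset.HasAntidiagonal.mem_antidiagonal.1 hr'))

end PlaneData

namespace PlaneData

variable {k A : Type*} [Field k] [Ring A] [Algebra k A] {q c : k} {u v : A}
  (P : PlaneData k q c u v)

lemma ld_v_pow_mul_u_pow (p : ℕ × ℕ) : P.Ld (v ^ p.2 * u ^ p.1) p (q ^ (p.2 * p.1)) := by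
  have := (P.ld_basis (p.1, 0)).v_pow_mul p.2
  simpa [basis_apply] using this

include P in
lemma linearIndependent_v_u : LinearIndependent k (fun p : ℕ × ℕ => v ^ p.2 * u ^ p.1) := by
  rw [linearIndependent_iff]
  intro l hl
  by_contra hne
  obtain ⟨p, hp, hmax⟩ := l.support.exists_max_image (fun p => toLex (p.1 + p.2, p.2))
    (Finsupp.support_nonempty_iff.2 hne)
  have h0 : P.basis.repr (Finsupp.linearCombination k (fun p : ℕ × ℕ => v ^ p.2 * u ^ p.1) l) p =
      l p * q ^ (p.2 * p.1) := by
    rw [Finsupp.linearCombination_apply, Finsupp.sum, map_sum, Finsupp.finsetSum_apply,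
      Finset.sum_eq_single p]
    · rw [map_smul, Finsupp.smul_apply, (P.ld_v_pow_mul_u_pow p).repr, smul_eq_mul]
    · intro r hr hrp
      rw [map_smul, Finsupp.smul_apply, (P.ld_v_pow_mul_u_pow r).repr_eq_zero, smul_zero]
      have hle := hmax r hr
      rw [Prod.Lex.toLex_le_toLex] at hle
      simp only at hle
      rcases lt_trichotomy r p with h | h | h
      · exact h
      · exact absurd h hrp
      · simp only [lt] at h; omega
    · intro h; exact absurd hp h
  rw [hl, map_zero, Finsupp.coe_zero, Pi.zero_apply] at h0
  exact _root_.mul_ne_zero (Finsupp.mem_support_iff.1 hp) (pow_ne_zero _ P.q_ne) h0.symm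

include P in
lemma span_v_u : Submodule.span k (Set.range (fun p : ℕ × ℕ => v ^ p.2 * u ^ p.1)) = ⊤ := by
  set N := Submodule.span k (Set.range (fun p : ℕ × ℕ => v ^ p.2 * u ^ p.1)) with hN
  have : ∀ p, P.basis p ∈ N := by
    intro p
    induction p using lt_wf.induction with
    | _ p ih =>
    have h1 : v ^ p.2 * u ^ p.1 ∈ N := Submodule.subset_span ⟨p, rfl⟩
    have h2 : P.below p ≤ N := P.sp_le ih
    have h3 := N.smul_mem (q ^ (p.2 * p.1))⁻¹ (N.sub_mem h1 (h2 (P.ld_v_pow_mul_u_pow p)))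
    rwa [sub_sub_cancel, smul_smul, inv_mul_cancel₀ (pow_ne_zero _ P.q_ne), one_smul] at h3
  rw [eq_top_iff, ← P.basis.span_eq, Submodule.span_le]
  rintro _ ⟨p, rfl⟩
  exact this p

include P in
/-- The opposite algebra has the same shape. -/
lemma op : PlaneData k (A := Aᵐᵒᵖ) q⁻¹ (-(q⁻¹ * c)) (MulOpposite.op u) (MulOpposite.op v) where
  q_ne := inv_ne_zero P.q_ne
  rel := by
    rw [← MulOpposite.op_mul, ← MulOpposite.op_mul, ← MulOpposite.op_mul, P.rel]
    simp only [MulOpposite.op_add, MulOpposite.op_smul, smul_add, smul_smul, neg_smul]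
    rw [inv_mul_cancel₀ P.q_ne, one_smul]
    abel
  li := by
    have := P.linearIndependent_v_u.map' (MulOpposite.opLinearEquiv k : A ≃ₗ[k] Aᵐᵒᵖ).toLinearMap
      (LinearEquiv.ker _)
    exact this
  span := by
    have h := congrArg (Submodule.map (MulOpposite.opLinearEquiv k : A ≃ₗ[k] Aᵐᵒᵖ).toLinearMap)
      P.span_v_u
    rw [Submodule.map_span, Submodule.map_top, LinearEquiv.range, ← Set.range_comp] at h
    rw [← h]
    exact le_of_eq rfl

lemma map_op_fl (d : ℕ) :
    (P.fl d).map (MulOpposite.opLinearEquiv k : A ≃ₗ[k] Aᵐᵒᵖ).toLinearMap = P.op.fl d := by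
  refine Submodule.eq_of_le_of_finrank_eq ?_ ?_
  · rintro _ ⟨x, hx, rfl⟩
    refine P.map_mem_of_mem_sp (MulOpposite.opLinearEquiv k : A ≃ₗ[k] Aᵐᵒᵖ).toLinearMap ?_ hx
    intro r hr
    have h1 : P.basis r = u ^ r.1 * v ^ r.2 := P.basis_apply r
    have hu : MulOpposite.op u ^ r.1 * (1 : Aᵐᵒᵖ) ∈ P.op.fl (r.1 + 1) := by
      have := P.op.basis_mul_mem_fl (r.1, 0) P.op.one_mem_fl
      simpa [basis_apply] using this
    have hv : MulOpposite.op v ^ r.2 * MulOpposite.op u ^ r.1 ∈ P.op.fl (r.2 + (r.1 + 1)) := by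
      have := P.op.basis_mul_mem_fl (0, r.2) hu
      simpa [basis_apply] using this
    simp only [LinearEquiv.coe_coe, MulOpposite.coe_opLinearEquiv, h1, MulOpposite.op_mul,
      MulOpposite.op_pow]
    refine P.op.fl_mono ?_ hv
    have : r.1 + r.2 < d := hr
    omega
  · rw [LinearEquiv.finrank_map_eq, finrank_fl, finrank_fl]

lemma op_mem_fl {d : ℕ} {x : A} : MulOpposite.op x ∈ P.op.fl d ↔ x ∈ P.fl d := by
  rw [← map_op_fl]
  constructor
  · rintro ⟨y, hy, h⟩
    rwa [← MulOpposite.op_injective h]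
  · intro h; exact ⟨x, h, rfl⟩

include P in
/-- If `x u + y v = 0` then `x` and `y` come from a common element. -/
lemma exists_right_syzygy {x y : A} (h : x * u + y * v = 0) :
    ∃ z, x = z * v - c • (z * u) ∧ y = -(q • (z * u)) := by
  have h' : MulOpposite.op u * MulOpposite.op x + MulOpposite.op v * MulOpposite.op y = 0 := by
    rw [← MulOpposite.op_mul, ← MulOpposite.op_mul, ← MulOpposite.op_add, h, MulOpposite.op_zero]
  obtain ⟨h1, h2⟩ := P.op.eq_divU h'
  generalize P.op.divU (MulOpposite.op y) = w at h1 h2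
  have h1 := congrArg MulOpposite.unop h1
  have h2 := congrArg MulOpposite.unop h2
  simp only [MulOpposite.unop_mul, MulOpposite.unop_op, MulOpposite.unop_neg,
    MulOpposite.unop_add, MulOpposite.unop_smul] at h1 h2
  refine ⟨-(q⁻¹ • w.unop), ?_, ?_⟩
  · rw [h2]; simp only [neg_mul, smul_mul_assoc, smul_neg, smul_smul, mul_comm c]; module
  · rw [← h1]; simp [smul_smul, P.q_ne]

lemma mem_fl_of_mul_u {d : ℕ} {x : A} (h : x * u ∈ P.fl (d + 1)) : x ∈ P.fl d := by
  rw [← op_mem_fl] at *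
  exact P.op.mem_fl_of_u_mul h

lemma exists_right_decomp {d : ℕ} {x : A} (hx : x ∈ P.fl (d + 1)) :
    ∃ a : k, ∃ y ∈ P.fl d, ∃ z ∈ P.fl d, x = algebraMap k A a + y * u + z * v := by
  obtain ⟨a, y, hy, z, hz, h⟩ := P.op.exists_decomp (P.op_mem_fl.2 hx)
  refine ⟨a, y.unop, P.op_mem_fl.1 hy, z.unop, P.op_mem_fl.1 hz, ?_⟩
  simpa using congrArg MulOpposite.unop h

lemma pr_v_pow_mul_u_pow (d i j : ℕ) :
    P.pr d (v ^ j * u ^ i) = if i + j = d then v ^ j * u ^ i else 0 := by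
  induction j generalizing d with
  | zero =>
    have := P.pr_basis d (i, 0)
    simpa [basis_apply] using this
  | succ j ih =>
    rw [pow_succ', mul_assoc]
    cases d with
    | zero => rw [pr_zero_v_mul, if_neg (by omega)]
    | succ d =>
      rw [pr_v_mul, ih]
      split_ifs with h1 h2 h2
      · rfl
      · omega
      · omega
      · simp

lemma pr_op (d : ℕ) (x : A) : P.op.pr d (MulOpposite.op x) = MulOpposite.op (P.pr d x) := by
  have : P.op.pr d ∘ₗ (MulOpposite.opLinearEquiv k : A ≃ₗ[k] Aᵐᵒᵖ).toLinearMap =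
      (MulOpposite.opLinearEquiv k : A ≃ₗ[k] Aᵐᵒᵖ).toLinearMap ∘ₗ P.pr d := by
    refine P.basis.ext fun p => ?_
    have h := P.op.pr_v_pow_mul_u_pow d p.1 p.2
    rw [LinearMap.comp_apply, LinearMap.comp_apply, pr_basis]
    simp only [basis_apply, LinearEquiv.coe_coe,
      MulOpposite.coe_opLinearEquiv, MulOpposite.op_mul, MulOpposite.op_pow, h]
    split_ifs <;> simp
  exact LinearMap.congr_fun this x

lemma pr_mul_u (d : ℕ) (x : A) : P.pr (d + 1) (x * u) = P.pr d x * u := by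
  have := P.op.pr_u_mul d (MulOpposite.op x)
  rw [P.pr_op, ← MulOpposite.op_mul, ← MulOpposite.op_mul, P.pr_op] at this
  exact MulOpposite.op_injective this

lemma pr_mul_v (d : ℕ) (x : A) : P.pr (d + 1) (x * v) = P.pr d x * v := by
  have := P.op.pr_v_mul d (MulOpposite.op x)
  rw [P.pr_op, ← MulOpposite.op_mul, ← MulOpposite.op_mul, P.pr_op] at this
  exact MulOpposite.op_injective this

end PlaneData

namespace PlaneData

variable {k A : Type*} [Field k] [Ring A] [Algebra k A] {q c : k} {u v : A}
  (P : PlaneData k q c u v)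

include P in
lemma rel_smul {X : Type*} [AddCommGroup X] [Module k X] [Module A X] [IsScalarTower k A X]
    (x : X) : v • u • x = q • u • v • x + c • u • u • x := by
  rw [← mul_smul, P.rel, add_smul, smul_assoc, smul_assoc, mul_smul, mul_smul]

lemma exists_bound_of_finite {M : Type*} [AddCommGroup M] [Module k M] [Module.Finite k M]
    (α : M →ₗ[k] A) : ∃ d, ∀ x, α x ∈ P.fl d := by
  let b := Module.finBasis k M
  obtain ⟨d, hd⟩ := P.exists_forall_mem_fl (fun i => α (b i))
  refine ⟨d, fun x => ?_⟩
  rw [← b.sum_repr x, map_sum]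
  refine Submodule.sum_mem _ fun i _ => ?_
  rw [map_smul]
  exact (P.fl d).smul_mem _ (hd i)

section FiniteDimensional

variable {M : Type*} [AddCommGroup M] [Module k M] [Module A M] [IsScalarTower k A M]

/-- Bounded one-cocycles, up to constants, are coboundaries. -/
lemma exists_coboundary (d : ℕ) (α β : M →ₗ[k] A) (hα : ∀ x, α x ∈ P.fl d)
    (hβ : ∀ x, β x ∈ P.fl d)
    (h : ∀ x, β (u • x) + v * α x - q • α (v • x) - q • (u * β x) - c • α (u • x) - c • (u * α x)
      ∈ P.fl 1) :
    ∃ γ : M →ₗ[k] A, (∀ x, α x = u * γ x - γ (u • x)) ∧ (∀ x, β x = v * γ x - γ (v • x)) := by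
  induction d generalizing α β with
  | zero =>
    refine ⟨0, fun x => ?_, fun x => ?_⟩
    · rw [P.mem_fl_zero.1 (hα x)]; simp
    · rw [P.mem_fl_zero.1 (hβ x)]; simp
  | succ d ih =>
    let γ' : M →ₗ[k] A := P.divU ∘ₗ P.pr d ∘ₗ α
    have htop : ∀ x, u * γ' x = P.pr d (α x) ∧ v * γ' x = P.pr d (β x) := by
      intro x
      have h0 := P.pr_eq_zero (h x) (Nat.le_add_left 1 d)
      simp only [map_sub, map_add, map_smul, P.pr_eq_zero (hα _) le_rfl,
        P.pr_eq_zero (hβ _) le_rfl, pr_u_mul, pr_v_mul] at h0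
      have h1 : u * (-(q • P.pr d (β x) + c • P.pr d (α x))) + v * P.pr d (α x) = 0 := by
        rw [← h0, mul_neg, mul_add, mul_smul_comm, mul_smul_comm]
        module
      obtain ⟨h2, h3⟩ := P.eq_divU h1
      refine ⟨h2, ?_⟩
      change v * P.divU (P.pr d (α x)) = _
      rw [h2, neg_inj] at h3
      have h4 : q • P.pr d (β x) = q • (v * P.divU (P.pr d (α x))) := add_right_cancel h3
      exact ((smul_right_injective A P.q_ne) h4).symm
    have hγ' : ∀ x, γ' x ∈ P.fl d := fun x =>
      P.mem_fl_of_u_mul (by rw [(htop x).1]; exact P.pr_mem_fl _ _)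
    let Lu := (Algebra.lsmul k k M u)
    let Lv := (Algebra.lsmul k k M v)
    obtain ⟨γ, h1, h2⟩ := ih (α - LinearMap.mulLeft k u ∘ₗ γ' + γ' ∘ₗ Lu)
      (β - LinearMap.mulLeft k v ∘ₗ γ' + γ' ∘ₗ Lv) (fun x => by
        simp only [LinearMap.add_apply, LinearMap.sub_apply, LinearMap.comp_apply,
          LinearMap.mulLeft_apply, (htop x).1]
        exact add_mem (P.sub_pr_mem_fl (hα x)) (hγ' _)) (fun x => by
        simp only [LinearMap.add_apply, LinearMap.sub_apply, LinearMap.comp_apply,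
          LinearMap.mulLeft_apply, (htop x).2]
        exact add_mem (P.sub_pr_mem_fl (hβ x)) (hγ' _)) (fun x => by
        convert h x using 1
        have hr : v * (u * γ' x) = q • (u * (v * γ' x)) + c • (u * (u * γ' x)) := by
          rw [← mul_assoc, P.rel, add_mul, smul_mul_assoc, smul_mul_assoc, mul_assoc, mul_assoc]
        have hr' : γ' (v • u • x) = q • γ' (u • v • x) + c • γ' (u • u • x) := by
          rw [P.rel_smul x, map_add, γ'.map_smul, γ'.map_smul]
        simp only [LinearMap.add_apply, LinearMap.sub_apply, LinearMap.comp_apply,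
          LinearMap.mulLeft_apply, Lu, Lv, Algebra.lsmul_coe, mul_add, mul_sub, hr, hr']
        module)
    refine ⟨γ + γ', fun x => ?_, fun x => ?_⟩
    · have := h1 x
      simp only [LinearMap.add_apply, LinearMap.sub_apply, LinearMap.comp_apply,
        LinearMap.mulLeft_apply, Lu, Algebra.lsmul_coe] at this ⊢
      rw [mul_add, ← sub_eq_zero] at *
      rw [← sub_eq_zero.2 this]; abel
    · have := h2 x
      simp only [LinearMap.add_apply, LinearMap.sub_apply, LinearMap.comp_apply,
        LinearMap.mulLeft_apply, Lv, Algebra.lsmul_coe] at this ⊢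
      rw [mul_add, ← sub_eq_zero] at *
      rw [← sub_eq_zero.2 this]; abel

include P in
/-- First extension groups of finite-dimensional modules vanish. -/
theorem exists_extension_of_finite [Module.Finite k M] {X : Type*} [AddCommGroup X] [Module k X]
    [Module A X] [IsScalarTower k A X] (π : X →ₗ[A] M) (hπ : Function.Surjective π)
    (f : LinearMap.ker π →ₗ[A] A) : ∃ F : X →ₗ[A] A, ∀ x : LinearMap.ker π, F x = f x := by
  obtain ⟨s, hs⟩ := (π.restrictScalars k).exists_rightInverse_of_surjective
    (LinearMap.range_eq_top.2 hπ)
  have hs : ∀ x, π (s x) = x := fun x => LinearMap.congr_fun hs x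
  let N := LinearMap.ker π
  let p : X →ₗ[k] N := LinearMap.codRestrict (N.restrictScalars k)
    (LinearMap.id - s ∘ₗ π.restrictScalars k) (fun x => by simp [N, hs])
  have hp : ∀ x, (p x : X) = x - s (π x) := fun x => rfl
  let f' : N →ₗ[k] A := f.restrictScalars k
  have hf' : ∀ (a : A) x, f' (a • x) = a * f' x := fun a x => f.map_smul a x
  let α : M →ₗ[k] A := f' ∘ₗ p ∘ₗ (Algebra.lsmul k k X u) ∘ₗ s
  let β : M →ₗ[k] A := f' ∘ₗ p ∘ₗ (Algebra.lsmul k k X v) ∘ₗ s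
  have hα : ∀ x, α x = f' (p (u • s x)) := fun x => rfl
  have hβ : ∀ x, β x = f' (p (v • s x)) := fun x => rfl
  obtain ⟨d₁, h₁⟩ := P.exists_bound_of_finite α
  obtain ⟨d₂, h₂⟩ := P.exists_bound_of_finite β
  obtain ⟨γ, hγu, hγv⟩ := P.exists_coboundary (max d₁ d₂) α β
    (fun x => P.fl_mono (le_max_left _ _) (h₁ x)) (fun x => P.fl_mono (le_max_right _ _) (h₂ x))
    (fun x => by
      convert (P.fl 1).zero_mem
      have hz : p (v • s (u • x)) + v • p (u • s x) - q • p (u • s (v • x)) - q • u • p (v • s x)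
          - c • p (u • s (u • x)) - c • u • p (u • s x) = 0 := by
        ext
        have e1 : s (v • u • x) = q • s (u • v • x) + c • s (u • u • x) := by
          rw [P.rel_smul x, map_add, s.map_smul, s.map_smul]
        simp only [Submodule.coe_sub, Submodule.coe_add, Submodule.coe_smul, hp, π.map_smul, hs,
          smul_sub, P.rel_smul (s x), Submodule.coe_smul_of_tower, e1, ZeroMemClass.coe_zero]
        abel
      have := congrArg f' hz
      simpa only [hα, hβ, map_add, map_sub, f'.map_smul, hf', map_zero] using this)
  let F : X →ₗ[k] A := f' ∘ₗ p + γ ∘ₗ π.restrictScalars k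
  have hF : ∀ x, F x = f' (p x) + γ (π x) := fun x => rfl
  have hcomm : ∀ (w : A), (∀ x, f' (p (w • s x)) = w * γ x - γ (w • x)) →
      ∀ x, F (w • x) = w • F x := by
    intro w hw x
    rw [hF, hF, π.map_smul, smul_eq_mul, mul_add, ← hf']
    have : p (w • x) = w • p x + p (w • s (π x)) := by
      ext; simp [hp, hs, smul_sub]
    rw [this, map_add, hw]; abel
  let F' : X →ₗ[A] A :=
    { toFun := F
      map_add' := F.map_add
      map_smul' := fun a x => P.map_smul_of_commute F (hcomm u fun x => hγu x)
        (hcomm v fun x => hγv x) a x }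
  refine ⟨F', fun x => ?_⟩
  change F x = f x
  have hx : π x = 0 := x.2
  have hpx : p x = x := by ext; simp [hp, hx]
  rw [hF, hx, map_zero, add_zero, hpx]
  rfl

end FiniteDimensional

end PlaneData

namespace PlaneData

variable {k A : Type*} [Field k] [Ring A] [Algebra k A] {q c : k} {u v : A}
  (P : PlaneData k q c u v)

section Koszul

variable {M : Type*} [AddCommGroup M] [Module k M] [Module A M] [IsScalarTower k A M]
  {n : ℕ} (b : Module.Basis (Fin n) k M)

/-- Right multiplication on the coordinates of a free module. -/
def rightMul (n : ℕ) (w : A) : (Fin n → A) →ₗ[A] (Fin n → A) :=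
  LinearMap.pi fun i => LinearMap.toSpanSingleton A A w ∘ₗ LinearMap.proj i

@[simp] lemma rightMul_apply (w : A) (x : Fin n → A) (i : Fin n) :
    rightMul n w x i = x i * w := by simp [rightMul]

/-- The action of `w` on the right-hand factor of `A ⊗ M`. -/
noncomputable def coordAct (w : A) : (Fin n → A) →ₗ[A] (Fin n → A) :=
  LinearMap.pi fun i => ∑ j, (b.repr (w • b j) i) • LinearMap.proj j

omit [IsScalarTower k A M] in
lemma coordAct_apply (w : A) (x : Fin n → A) (i : Fin n) :
    coordAct b w x i = ∑ j, (b.repr (w • b j) i) • x j := by simp [coordAct]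

lemma coordAct_smul (a : k) (w : A) (x : Fin n → A) :
    coordAct b (a • w) x = a • coordAct b w x := by
  ext i
  simp [coordAct_apply, Finset.smul_sum, smul_smul]

omit [IsScalarTower k A M] in
lemma coordAct_add (w w' : A) (x : Fin n → A) :
    coordAct b (w + w') x = coordAct b w x + coordAct b w' x := by
  ext i
  simp [coordAct_apply, add_smul, Finset.sum_add_distrib]

lemma coordAct_mul (w w' : A) (x : Fin n → A) :
    coordAct b (w * w') x = coordAct b w (coordAct b w' x) := by
  ext i
  simp only [coordAct_apply, Finset.smul_sum, smul_smul]
  rw [Finset.sum_comm]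
  refine Finset.sum_congr rfl fun j _ => ?_
  rw [← Finset.sum_smul]
  congr 1
  have h : (w * w') • b j = ∑ l, b.repr (w' • b j) l • (w • b l) := by
    rw [mul_smul]
    conv_lhs => rw [← b.sum_repr (w' • b j)]
    rw [Finset.smul_sum]
    exact Finset.sum_congr rfl fun l _ => smul_comm _ _ _
  rw [h, map_sum, Finsupp.finsetSum_apply]
  refine Finset.sum_congr rfl fun l _ => ?_
  rw [map_smul, Finsupp.smul_apply, smul_eq_mul, mul_comm]

omit [IsScalarTower k A M] in
lemma coordAct_mem_fl (w : A) {d : ℕ} {x : Fin n → A} (hx : ∀ i, x i ∈ P.fl d) (i : Fin n) :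
    coordAct b w x i ∈ P.fl d := by
  rw [coordAct_apply]
  exact Submodule.sum_mem _ fun j _ => (P.fl d).smul_mem _ (hx j)

/-- The first differential of the Koszul resolution. -/
noncomputable def kd₁ (u v : A) (b : Module.Basis (Fin n) k M) :
    ((Fin n → A) × (Fin n → A)) →ₗ[A] (Fin n → A) :=
  LinearMap.coprod (rightMul n u - coordAct b u) (rightMul n v - coordAct b v)

/-- The second differential of the Koszul resolution. -/
noncomputable def kd₂ (q c : k) (u v : A) (b : Module.Basis (Fin n) k M) :
    (Fin n → A) →ₗ[A] ((Fin n → A) × (Fin n → A)) :=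
  LinearMap.prod (rightMul n v - q • coordAct b v - c • (rightMul n u + coordAct b u))
    (coordAct b u - q • rightMul n u)

/-- The augmentation of the Koszul resolution. -/
noncomputable def kaug (A : Type*) [Ring A] [Module A M] (b : Fin n → M) :
    (Fin n → A) →ₗ[A] M :=
  ∑ i, (LinearMap.toSpanSingleton A M (b i)) ∘ₗ LinearMap.proj i

omit [IsScalarTower k A M] in
lemma kd₁_apply (y : (Fin n → A) × (Fin n → A)) : kd₁ u v b y =
    rightMul n u y.1 - coordAct b u y.1 + (rightMul n v y.2 - coordAct b v y.2) := by
  simp [kd₁]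

omit [IsScalarTower k A M] in
lemma kd₂_apply (x : Fin n → A) : kd₂ q c u v b x =
    (rightMul n v x - q • coordAct b v x - c • (rightMul n u x + coordAct b u x),
      coordAct b u x - q • rightMul n u x) := rfl

lemma kaug_apply (b : Fin n → M) (x : Fin n → A) : kaug A b x = ∑ i, x i • b i := by
  simp [kaug]

lemma kaug_rightMul (w : A) (x : Fin n → A) :
    kaug A b (rightMul n w x) = kaug A b (coordAct b w x) := by
  simp only [kaug_apply, rightMul_apply, coordAct_apply, Finset.sum_smul]
  rw [Finset.sum_comm]
  refine Finset.sum_congr rfl fun j _ => ?_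
  rw [mul_smul]
  conv_lhs => rw [← b.sum_repr (w • b j)]
  rw [Finset.smul_sum]
  refine Finset.sum_congr rfl fun i _ => ?_
  rw [smul_assoc, smul_comm]

omit [IsScalarTower k A M] in
lemma coordAct_rightMul (w w' : A) (x : Fin n → A) :
    coordAct b w (rightMul n w' x) = rightMul n w' (coordAct b w x) := by
  ext i
  simp [coordAct_apply, Finset.sum_mul]

include P in
lemma kd₁_kd₂ (x : Fin n → A) : kd₁ u v b (kd₂ q c u v b x) = 0 := by
  have h1 : coordAct b v (coordAct b u x) =
      q • coordAct b u (coordAct b v x) + c • coordAct b u (coordAct b u x) := by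
    simp only [← coordAct_mul, ← coordAct_smul, ← coordAct_add, P.rel]
  have h2 : rightMul n u (rightMul n v x) =
      q • rightMul n v (rightMul n u x) + c • rightMul n u (rightMul n u x) := by
    ext i
    simp only [rightMul_apply, Pi.add_apply, Pi.smul_apply, mul_assoc, P.rel, mul_add,
      mul_smul_comm]
  have hk : ∀ (f : (Fin n → A) →ₗ[A] (Fin n → A)) (a : k) (x : Fin n → A), f (a • x) = a • f x :=
    fun f a x => (f.restrictScalars k).map_smul a x
  rw [kd₁_apply, kd₂_apply]
  simp only [map_sub, map_add, hk, coordAct_rightMul, h1, h2]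
  module

include P in
lemma exists_kd₂_eq (d : ℕ) : ∀ y : (Fin n → A) × (Fin n → A),
    (∀ i, y.1 i ∈ P.fl d) → (∀ i, y.2 i ∈ P.fl d) → kd₁ u v b y = 0 →
    ∃ z, kd₂ q c u v b z = y := by
  induction d with
  | zero =>
    intro y h1 h2 _
    refine ⟨0, ?_⟩
    rw [map_zero]
    ext i
    · exact (P.mem_fl_zero.1 (h1 i)).symm
    · exact (P.mem_fl_zero.1 (h2 i)).symm
  | succ d ih =>
    intro y h1 h2 hy
    have htop : ∀ i, P.pr d (y.1 i) * u + P.pr d (y.2 i) * v = 0 := by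
      intro i
      have h := congrArg (P.pr (d + 1)) (congrFun hy i)
      rw [kd₁_apply] at h
      simp only [Pi.add_apply, Pi.sub_apply, rightMul_apply, map_add, map_sub, pr_mul_u, pr_mul_v,
        P.pr_eq_zero (P.coordAct_mem_fl b u h1 i) le_rfl,
        P.pr_eq_zero (P.coordAct_mem_fl b v h2 i) le_rfl, Pi.zero_apply, map_zero, sub_zero] at h
      exact h
    choose z hz1 hz2 using fun i => P.exists_right_syzygy (htop i)
    have hz : ∀ i, z i ∈ P.fl d := by
      intro i
      refine P.mem_fl_of_mul_u ?_
      have h := P.pr_mem_fl d (y.2 i)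
      rw [hz2, ← smul_neg] at h
      have h' := (P.fl (d + 1)).smul_mem q⁻¹ h
      rw [smul_smul, inv_mul_cancel₀ P.q_ne, one_smul] at h'
      simpa using h'
    obtain ⟨w, hw⟩ := ih (y - kd₂ q c u v b z) (fun i => by
        have h3 := P.sub_pr_mem_fl (h1 i)
        rw [hz1] at h3
        have h4 := P.coordAct_mem_fl b v hz i
        have h5 := P.coordAct_mem_fl b u hz i
        have := add_mem (add_mem h3 ((P.fl d).smul_mem q h4)) ((P.fl d).smul_mem c h5)
        rw [kd₂_apply]
        simp only [Prod.fst_sub, Pi.sub_apply, Pi.smul_apply, Pi.add_apply, rightMul_apply]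
        convert this using 1
        module) (fun i => by
        have h3 := P.sub_pr_mem_fl (h2 i)
        rw [hz2] at h3
        have h5 := P.coordAct_mem_fl b u hz i
        have := sub_mem h3 h5
        rw [kd₂_apply]
        simp only [Prod.snd_sub, Pi.sub_apply, Pi.smul_apply, rightMul_apply]
        convert this using 1
        module) (by rw [map_sub, hy, P.kd₁_kd₂, sub_zero])
    exact ⟨w + z, by rw [map_add, hw, sub_add_cancel]⟩

omit [IsScalarTower k A M] in
include P in
lemma kd₂_injective : Function.Injective (kd₂ q c u v b) := by
  rw [injective_iff_map_eq_zero]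
  intro x hx
  have hx2 : ∀ i, x i * u = q⁻¹ • coordAct b u x i := by
    intro i
    have := congrFun (congrArg Prod.snd hx) i
    rw [kd₂_apply] at this
    simp only [Pi.sub_apply, Pi.smul_apply, rightMul_apply, Prod.snd_zero, Pi.zero_apply] at this
    rw [sub_eq_zero.1 this, smul_smul, inv_mul_cancel₀ P.q_ne, one_smul]
  obtain ⟨d, hd⟩ := P.exists_forall_mem_fl x
  have : ∀ d, (∀ i, x i ∈ P.fl d) → x = 0 := by
    intro d
    induction d with
    | zero => intro h; ext i; exact P.mem_fl_zero.1 (h i)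
    | succ d ih =>
      intro h
      refine ih fun i => P.mem_fl_of_mul_u ?_
      rw [hx2]
      exact (P.fl _).smul_mem _ (P.coordAct_mem_fl b u h i)
  exact this d hd

omit [IsScalarTower k A M] in
include P in
lemma exists_sub_kd₁ (d : ℕ) : ∀ x : Fin n → A, (∀ i, x i ∈ P.fl d) →
    ∃ (a : Fin n → k) (y : (Fin n → A) × (Fin n → A)),
      x = (fun i => algebraMap k A (a i)) + kd₁ u v b y := by
  induction d with
  | zero =>
    intro x hx
    refine ⟨0, 0, ?_⟩
    ext i
    rw [P.mem_fl_zero.1 (hx i)]; simp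
  | succ d ih =>
    intro x hx
    choose a y hy z hz h using fun i => P.exists_right_decomp (hx i)
    obtain ⟨a', w, hw⟩ := ih (coordAct b u y + coordAct b v z) (fun i =>
      add_mem (P.coordAct_mem_fl b u hy i) (P.coordAct_mem_fl b v hz i))
    refine ⟨a + a', w + (y, z), ?_⟩
    rw [map_add, kd₁_apply b (y, z)]
    ext i
    have hwi := congrFun hw i
    simp only [Pi.add_apply, Pi.sub_apply, rightMul_apply, map_add] at hwi ⊢
    have : kd₁ u v b w i = coordAct b u y i + coordAct b v z i - algebraMap k A (a' i) := by
      rw [hwi]; abel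
    rw [this, h i]; abel

include P in
lemma kaug_exact : Function.Exact (kd₁ u v b) (kaug A b) := by
  intro x
  constructor
  · intro hx
    obtain ⟨d, hd⟩ := P.exists_forall_mem_fl x
    obtain ⟨a, y, rfl⟩ := P.exists_sub_kd₁ b d x hd
    have h1 : kaug A b (kd₁ u v b y) = 0 := by
      rw [kd₁_apply, map_add, map_sub, map_sub, kaug_rightMul, kaug_rightMul]; simp
    rw [map_add, h1, add_zero, kaug_apply] at hx
    simp only [algebraMap_smul] at hx
    have ha := Fintype.linearIndependent_iff.1 b.linearIndependent a hx
    refine ⟨y, ?_⟩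
    ext i
    simp [ha i]
  · rintro ⟨y, rfl⟩
    rw [kd₁_apply, map_add, map_sub, map_sub, kaug_rightMul, kaug_rightMul]; simp

include P in
lemma kd₂_exact : Function.Exact (kd₂ q c u v b) (kd₁ u v b) := by
  intro y
  constructor
  · intro hy
    obtain ⟨d₁, h₁⟩ := P.exists_forall_mem_fl y.1
    obtain ⟨d₂, h₂⟩ := P.exists_forall_mem_fl y.2
    exact P.exists_kd₂_eq b (max d₁ d₂) y (fun i => P.fl_mono (le_max_left _ _) (h₁ i))
      (fun i => P.fl_mono (le_max_right _ _) (h₂ i)) hy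
  · rintro ⟨z, rfl⟩
    exact P.kd₁_kd₂ b z

omit [IsScalarTower k A M] in
lemma coordAct_single (w : A) (j : Fin n) :
    coordAct b w (Pi.single j 1) = fun i => algebraMap k A (b.repr (w • b j) i) := by
  ext i
  simp only [coordAct_apply, Pi.single_apply, smul_ite, smul_zero]
  simp [Algebra.algebraMap_eq_smul_one]

include P in
lemma comp_kd₂_ne (j : Fin n) (ψ : (Fin n → A) × (Fin n → A) →ₗ[A] A) :
    ψ ∘ₗ kd₂ q c u v b ≠ LinearMap.proj j := by
  intro hψ
  let ψ₁ : (Fin n → A) →ₗ[A] A := ψ ∘ₗ LinearMap.inl A _ _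
  let ψ₂ : (Fin n → A) →ₗ[A] A := ψ ∘ₗ LinearMap.inr A _ _
  let α : M →ₗ[k] A := b.constr k fun i => ψ₁ (Pi.single i 1)
  let β : M →ₗ[k] A := b.constr k fun i => ψ₂ (Pi.single i 1)
  have hconst : ∀ (f : (Fin n → A) →ₗ[A] A) (x : M),
      f (fun i => algebraMap k A (b.repr x i)) = b.constr k (fun i => f (Pi.single i 1)) x := by
    intro f x
    rw [Module.Basis.constr_apply_fintype]
    conv_lhs => rw [pi_eq_sum_univ' (fun i => algebraMap k A (b.repr x i))]
    rw [map_sum]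
    refine Finset.sum_congr rfl fun i _ => ?_
    rw [map_smul, algebraMap_smul]
    congr 2
  have hr : ∀ w i, rightMul n w (Pi.single i 1 : Fin n → A) = w • Pi.single i 1 := by
    intro w i
    ext j'
    by_cases h : j' = i
    · subst h; simp
    · simp [h]
  have hk : ∀ (f : (Fin n → A) →ₗ[A] A) (a : k) (x : Fin n → A), f (a • x) = a • f x :=
    fun f a x => (f.restrictScalars k).map_smul a x
  have key : ∀ i, (Pi.single i 1 : Fin n → A) j =
      β (u • b i) + v * α (b i) - q • α (v • b i) - q • (u * β (b i)) - c • α (u • b i)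
        - c • (u * α (b i)) := by
    intro i
    have h := LinearMap.congr_fun hψ (Pi.single i 1)
    have h' : ∀ y, ψ y = ψ₁ y.1 + ψ₂ y.2 := by
      intro y
      change _ = ψ (y.1, 0) + ψ (0, y.2)
      rw [← map_add]; simp
    rw [LinearMap.comp_apply, h', kd₂_apply, LinearMap.proj_apply] at h
    simp only [map_sub, map_add, hk, coordAct_single, hconst, hr, map_smul, smul_eq_mul] at h
    rw [← h]
    have e1 : α (b i) = ψ₁ (Pi.single i 1) := by simp [α]
    have e2 : β (b i) = ψ₂ (Pi.single i 1) := by simp [β]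
    rw [e1, e2]
    module
  let D : M →ₗ[k] A := β ∘ₗ Algebra.lsmul k k M u + LinearMap.mulLeft k v ∘ₗ α
    - q • (α ∘ₗ Algebra.lsmul k k M v) - q • (LinearMap.mulLeft k u ∘ₗ β)
    - c • (α ∘ₗ Algebra.lsmul k k M u) - c • (LinearMap.mulLeft k u ∘ₗ α)
  have hD : ∀ x, D x = β (u • x) + v * α x - q • α (v • x) - q • (u * β x) - c • α (u • x)
      - c • (u * α x) := fun x => rfl
  have : Module.Finite k M := Module.Finite.of_basis b
  obtain ⟨d₁, h₁⟩ := P.exists_bound_of_finite α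
  obtain ⟨d₂, h₂⟩ := P.exists_bound_of_finite β
  obtain ⟨γ, hγu, hγv⟩ := P.exists_coboundary (max d₁ d₂) α β
    (fun x => P.fl_mono (le_max_left _ _) (h₁ x)) (fun x => P.fl_mono (le_max_right _ _) (h₂ x))
    (fun x => by
      rw [← hD, ← b.sum_repr x, map_sum]
      refine Submodule.sum_mem _ fun i _ => ?_
      rw [map_smul, hD, ← key]
      refine (P.fl 1).smul_mem _ ?_
      rw [Pi.single_apply]
      split_ifs
      · exact P.one_mem_fl
      · exact zero_mem _)
  have h0 := key j
  have hrel : v * (u * γ (b j)) = q • (u * (v * γ (b j))) + c • (u * (u * γ (b j))) := by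
    rw [← mul_assoc, P.rel, add_mul, smul_mul_assoc, smul_mul_assoc, mul_assoc, mul_assoc]
  have hrel' : γ (v • u • b j) = q • γ (u • v • b j) + c • γ (u • u • b j) := by
    rw [P.rel_smul (b j), map_add, γ.map_smul, γ.map_smul]
  rw [Pi.single_eq_same] at h0
  have := P.nontrivial
  refine one_ne_zero (α := A) (h0.trans ?_)
  simp only [hγu, hγv, mul_sub, hrel, hrel']
  module

end Koszul

include P in
/-- A nonzero finite-dimensional module has a length two free resolution which detects a nonzero
second extension group. -/
theorem exists_koszul (M : Type*) [AddCommGroup M] [Module k M] [Module A M]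
    [IsScalarTower k A M] [Module.Finite k M] [Nontrivial M] :
    ∃ (n : ℕ) (d₂ : (Fin n → A) →ₗ[A] (Fin n → A) × (Fin n → A))
      (d₁ : (Fin n → A) × (Fin n → A) →ₗ[A] (Fin n → A)) (ε : (Fin n → A) →ₗ[A] M)
      (ζ : (Fin n → A) →ₗ[A] A), Function.Surjective ε ∧ Function.Exact d₁ ε ∧
      Function.Exact d₂ d₁ ∧ Function.Injective d₂ ∧ ∀ ψ, ψ ∘ₗ d₂ ≠ ζ := by
  let b := Module.finBasis k M
  refine ⟨_, kd₂ q c u v b, kd₁ u v b, kaug A b, LinearMap.proj ⟨0, Module.finrank_pos⟩,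
    fun m => ⟨fun i => algebraMap k A (b.repr m i), ?_⟩, P.kaug_exact b, P.kd₂_exact b,
    P.kd₂_injective b, P.comp_kd₂_ne b _⟩
  rw [kaug_apply]
  simp only [algebraMap_smul]
  exact b.sum_repr m

end PlaneData

namespace PlaneData

variable {k A : Type*} [Field k] [Ring A] [Algebra k A] {q c : k} {u v : A}
  (P : PlaneData k q c u v)

/-- The elements of `v`-degree less than `d`; for `d = 1` these are the polynomials in `u`. -/
noncomputable def vf (d : ℕ) : Submodule k A := P.sp {r | r.2 < d}

lemma mem_vf {d : ℕ} {x : A} : x ∈ P.vf d ↔ ∀ r : ℕ × ℕ, d ≤ r.2 → P.basis.repr x r = 0 := by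
  simp [vf, mem_sp]

lemma vf_mono {d e : ℕ} (h : d ≤ e) : P.vf d ≤ P.vf e :=
  P.sp_mono fun _ hr => lt_of_lt_of_le hr h

lemma basis_mem_vf {p : ℕ × ℕ} {d : ℕ} (h : p.2 < d) : P.basis p ∈ P.vf d :=
  P.basis_mem_sp h

lemma mem_vf_zero {x : A} : x ∈ P.vf 0 ↔ x = 0 := by
  rw [mem_vf]
  refine ⟨fun h => P.ext_repr fun r => ?_, ?_⟩
  · rw [h r (Nat.zero_le _)]; simp
  · rintro rfl; simp

lemma fl_le_vf (d : ℕ) : P.fl d ≤ P.vf d :=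
  P.sp_mono fun r (hr : r.1 + r.2 < d) => show r.2 < d by omega

lemma exists_mem_vf (x : A) : ∃ d, x ∈ P.vf d :=
  (P.exists_mem_fl x).imp fun d h => P.fl_le_vf d h

lemma one_mem_vf : (1 : A) ∈ P.vf 1 := P.fl_le_vf 1 P.one_mem_fl

lemma u_mem_vf : u ∈ P.vf 1 := by
  simpa [basis_apply] using P.basis_mem_vf (p := (1, 0)) (d := 1) (by simp)

lemma v_pow_mem_vf (d : ℕ) : v ^ d ∈ P.vf (d + 1) := by
  simpa [basis_apply] using P.basis_mem_vf (p := (0, d)) (d := d + 1) (by simp)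

lemma u_mul_mem_vf {d : ℕ} {x : A} (hx : x ∈ P.vf d) : u * x ∈ P.vf d :=
  P.map_mem_of_mem_sp (LinearMap.mulLeft k u) (fun r hr => by
    rw [LinearMap.mulLeft_apply, u_mul_basis]
    exact P.basis_mem_vf hr) hx

lemma v_mul_mem_vf {d : ℕ} {x : A} (hx : x ∈ P.vf d) : v * x ∈ P.vf (d + 1) :=
  P.map_mem_of_mem_sp (LinearMap.mulLeft k v) (fun r hr => by
    simp only [Set.mem_ofPred_eq] at hr
    rw [LinearMap.mulLeft_apply, v_mul_basis]
    exact Submodule.add_mem _ (Submodule.smul_mem _ _ (P.basis_mem_vf (by simpa using hr)))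
        (Submodule.smul_mem _ _ (P.basis_mem_vf (by simp only; omega)))) hx

lemma basis_mul_mem_vf (p : ℕ × ℕ) {d : ℕ} {x : A} (hx : x ∈ P.vf d) :
    P.basis p * x ∈ P.vf (p.2 + d) := by
  have h1 : ∀ j, v ^ j * x ∈ P.vf (j + d) := by
    intro j
    induction j with
    | zero => simpa using hx
    | succ j ih =>
      rw [pow_succ', mul_assoc, add_right_comm]
      exact P.v_mul_mem_vf ih
  have h2 : ∀ i, ∀ y ∈ P.vf (p.2 + d), u ^ i * y ∈ P.vf (p.2 + d) := by
    intro i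
    induction i with
    | zero => intro y hy; simpa using hy
    | succ i ih =>
      intro y hy
      rw [pow_succ', mul_assoc]
      exact P.u_mul_mem_vf (ih y hy)
  rw [basis_apply, mul_assoc]
  exact h2 _ _ (h1 _)

lemma mul_mem_vf {d e : ℕ} {x y : A} (hx : x ∈ P.vf (e + 1)) (hy : y ∈ P.vf d) :
    x * y ∈ P.vf (e + d) :=
  P.map_mem_of_mem_sp (LinearMap.mulRight k y) (fun r (hr : r.2 < e + 1) =>
    P.vf_mono (by omega) (P.basis_mul_mem_vf r hy)) hx

lemma mul_mem_vf' {d e : ℕ} {x y : A} (hx : x ∈ P.vf e) (hy : y ∈ P.vf (d + 1)) :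
    x * y ∈ P.vf (e + d) := by
  cases e with
  | zero => rw [P.mem_vf_zero.1 hx, zero_mul]; exact zero_mem _
  | succ e => exact P.vf_mono (by omega) (P.mul_mem_vf hx hy)

lemma mul_mem_vf_of_mem_one {d : ℕ} {x y : A} (hx : x ∈ P.vf 1) (hy : y ∈ P.vf d) :
    x * y ∈ P.vf d := by
  simpa using P.mul_mem_vf (e := 0) hx hy

lemma mul_comm_of_mem {x y : A} (hx : x ∈ P.vf 1) (hy : y ∈ P.vf 1) : x * y = y * x := by
  have hu : ∀ z ∈ P.vf 1, z * u = u * z := by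
    intro z hz
    rw [← sub_eq_zero]
    refine P.map_mem_of_mem_sp (N := ⊥) (LinearMap.mulRight k u - LinearMap.mulLeft k u) ?_ hz
    rintro ⟨i, j⟩ (hr : j < 1)
    obtain rfl : j = 0 := by omega
    simp [basis_apply, ← pow_succ, ← pow_succ']
  rw [← sub_eq_zero]
  refine P.map_mem_of_mem_sp (N := ⊥) (LinearMap.mulRight k y - LinearMap.mulLeft k y) ?_ hx
  rintro ⟨i, j⟩ (hr : j < 1)
  obtain rfl : j = 0 := by omega
  have : Commute (u ^ i) y := (show Commute u y from (hu y hy).symm).pow_left i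
  simpa [basis_apply, sub_eq_zero] using this.eq

/-- The linear map scaling `uⁱ vʲ` by `qⁱ`. -/
noncomputable def sg : A →ₗ[k] A := P.basis.constr k fun r => q ^ r.1 • P.basis r

lemma sg_basis (r : ℕ × ℕ) : P.sg (P.basis r) = q ^ r.1 • P.basis r := by simp [sg]

lemma repr_sg (x : A) (r : ℕ × ℕ) : P.basis.repr (P.sg x) r = q ^ r.1 * P.basis.repr x r := by
  have : Finsupp.lapply r ∘ₗ P.basis.repr.toLinearMap ∘ₗ P.sg =
      q ^ r.1 • (Finsupp.lapply r ∘ₗ P.basis.repr.toLinearMap) := by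
    refine P.basis.ext fun p => ?_
    by_cases h : p = r
    · subst h; simp [sg_basis]
    · simp [sg_basis, h]
  exact LinearMap.congr_fun this x

lemma sg_mem {x : A} (hx : x ∈ P.vf 1) : P.sg x ∈ P.vf 1 :=
  P.mem_vf.2 fun r hr => by rw [repr_sg, P.mem_vf.1 hx r hr, mul_zero]

lemma sg_ne_zero {x : A} (hx : x ≠ 0) : P.sg x ≠ 0 := by
  intro h
  refine hx (P.ext_repr fun r => ?_)
  have := P.repr_sg x r
  rw [h] at this
  simpa [P.q_ne] using this.symm

lemma v_mul_sub_mem {p : A} (hp : p ∈ P.vf 1) : v * p - P.sg p * v ∈ P.vf 1 := by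
  refine P.map_mem_of_mem_sp (LinearMap.mulLeft k v - LinearMap.mulRight k v ∘ₗ P.sg) ?_ hp
  rintro ⟨i, j⟩ (hr : j < 1)
  obtain rfl : j = 0 := by omega
  have h : P.basis (i, 0) * v = P.basis (i, 1) := by simp [basis_apply]
  simp only [LinearMap.sub_apply, LinearMap.mulLeft_apply, LinearMap.comp_apply,
    LinearMap.mulRight_apply, sg_basis, v_mul_basis, smul_mul_assoc, h, add_sub_cancel_left,
    zero_add]
  exact Submodule.smul_mem _ _ (P.basis_mem_vf (by simp))

/-- `x` has `v`-degree at most `e` with leading coefficient `α`. -/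
def Lv (x : A) (e : ℕ) (α : A) : Prop := α ∈ P.vf 1 ∧ x - α * v ^ e ∈ P.vf e

lemma exists_lv_of_mem {e : ℕ} {x : A} (hx : x ∈ P.vf (e + 1)) : ∃ α, P.Lv x e α := by
  have h : P.vf (e + 1) ≤ (P.vf 1).map (LinearMap.mulRight k (v ^ e)) ⊔ P.vf e := by
    refine P.sp_le fun r hr => ?_
    have hr : r.2 < e + 1 := hr
    by_cases h : r.2 < e
    · exact Submodule.mem_sup_right (P.basis_mem_vf h)
    · refine Submodule.mem_sup_left ⟨P.basis (r.1, 0), P.basis_mem_vf (by simp), ?_⟩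
      obtain rfl : r.2 = e := by omega
      simp [basis_apply]
  obtain ⟨_, ⟨α, hα, rfl⟩, y, hy, h⟩ := Submodule.mem_sup.1 (h hx)
  refine ⟨α, hα, ?_⟩
  rw [← h]
  simpa using hy

lemma exists_lv {x : A} (hx : x ≠ 0) : ∃ e α, P.Lv x e α ∧ α ≠ 0 := by
  classical
  have hd := Nat.find_spec (P.exists_mem_vf x)
  have hmin := fun m => Nat.find_min (P.exists_mem_vf x) (m := m)
  generalize Nat.find (P.exists_mem_vf x) = d at hd hmin
  cases d with
  | zero => exact absurd (P.mem_vf_zero.1 hd) hx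
  | succ e =>
    obtain ⟨α, h⟩ := P.exists_lv_of_mem hd
    refine ⟨e, α, h, ?_⟩
    rintro rfl
    exact hmin e (Nat.lt_succ_self _) (by simpa using h.2)

variable {P} in
lemma Lv.mem {x : A} {e : ℕ} {α : A} (h : P.Lv x e α) : x ∈ P.vf (e + 1) := by
  have := add_mem (P.vf_mono (Nat.le_succ e) h.2) (P.mul_mem_vf_of_mem_one h.1 (P.v_pow_mem_vf e))
  simpa using this

variable {P} in
lemma Lv.v_mul {x : A} {e : ℕ} {α : A} (h : P.Lv x e α) : P.Lv (v * x) (e + 1) (P.sg α) := by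
  refine ⟨P.sg_mem h.1, ?_⟩
  have h1 := P.v_mul_mem_vf h.2
  have h2 := P.mul_mem_vf_of_mem_one (P.v_mul_sub_mem h.1) (P.v_pow_mem_vf e)
  convert add_mem h1 h2 using 1
  rw [pow_succ', mul_sub, sub_mul]
  simp only [mul_assoc]
  abel

variable {P} in
lemma Lv.v_pow_mul {x : A} {e : ℕ} {α : A} (h : P.Lv x e α) (j : ℕ) :
    P.Lv (v ^ j * x) (e + j) (P.sg^[j] α) := by
  induction j with
  | zero => simpa using h
  | succ j ih =>
    rw [pow_succ', mul_assoc, Function.iterate_succ_apply']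
    exact ih.v_mul

lemma iterate_sg_ne_zero {x : A} (hx : x ≠ 0) (j : ℕ) : P.sg^[j] x ≠ 0 := by
  induction j with
  | zero => exact hx
  | succ j ih => rw [Function.iterate_succ_apply']; exact P.sg_ne_zero ih

variable {P} in
lemma Lv.mul {x y : A} {e d : ℕ} {α β : A} (hx : P.Lv x e α) (hy : P.Lv y d β) :
    P.Lv (x * y) (e + d) (α * P.sg^[e] β) := by
  have h1 := P.mul_mem_vf' hx.2 hy.mem
  have h2 := hy.v_pow_mul e
  have h3 := P.mul_mem_vf_of_mem_one hx.1 h2.2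
  refine ⟨P.mul_mem_vf_of_mem_one hx.1 h2.1, ?_⟩
  rw [add_comm d e] at h3
  convert add_mem h1 h3 using 1
  rw [mul_sub, sub_mul]
  simp only [mul_assoc]
  abel

lemma repr_mul_v_pow (x : A) (m i j : ℕ) :
    P.basis.repr (x * v ^ m) (i, j + m) = P.basis.repr x (i, j) := by
  have : Finsupp.lapply (i, j + m) ∘ₗ P.basis.repr.toLinearMap ∘ₗ LinearMap.mulRight k (v ^ m) =
      Finsupp.lapply (i, j) ∘ₗ P.basis.repr.toLinearMap := by
    refine P.basis.ext fun p => ?_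
    have h : P.basis p * v ^ m = P.basis (p.1, p.2 + m) := by
      simp [basis_apply, mul_assoc, pow_add]
    simp [h, Finsupp.single_apply, Prod.ext_iff]
  exact LinearMap.congr_fun this x

variable {P} in
lemma Lv.not_mem {x : A} {e : ℕ} {α : A} (h : P.Lv x e α) (hα : α ≠ 0) : x ∉ P.vf e := by
  intro hx
  have h1 : α * v ^ e ∈ P.vf e := by simpa using sub_mem hx h.2
  refine hα (P.ext_repr fun r => ?_)
  rw [map_zero, Finsupp.zero_apply]
  by_cases hr : r.2 = 0
  · have := P.repr_mul_v_pow α e r.1 0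
    rw [P.mem_vf.1 h1 _ (by simp)] at this
    rw [this, ← hr]
  · exact P.mem_vf.1 h.1 r (by omega)

/-- Elements of positive `v`-degree do not divide nonzero polynomials in `u`. -/
lemma mul_not_mem_vf_one {b z : A} (hb : b ∉ P.vf 1) (hz : z ≠ 0) : b * z ∉ P.vf 1 := by
  have hb0 : b ≠ 0 := by rintro rfl; exact hb (zero_mem _)
  obtain ⟨e, α, h, hα⟩ := P.exists_lv hb0
  obtain ⟨d, β, h', hβ⟩ := P.exists_lv hz
  have he : e ≠ 0 := by
    rintro rfl
    exact hb h.mem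
  intro hbz
  exact (h.mul h').not_mem (P.mul_ne_zero hα (P.iterate_sg_ne_zero hβ e))
    (P.vf_mono (by omega) hbz)

/-- Division with remainder by an element `b`, up to a polynomial in `u`. -/
lemma exists_division {b β : A} {d : ℕ} (hb : P.Lv b d β) (hβ : β ≠ 0) (e : ℕ) :
    ∀ x ∈ P.vf e, ∃ p ∈ P.vf 1, p ≠ 0 ∧ ∃ s, p * x - s * b ∈ P.vf d := by
  have := P.nontrivial
  induction e with
  | zero =>
    intro x hx
    refine ⟨1, P.one_mem_vf, one_ne_zero, 0, ?_⟩
    simpa using P.vf_mono (Nat.zero_le d) hx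
  | succ e ih =>
    intro x hx
    by_cases hed : e < d
    · exact ⟨1, P.one_mem_vf, one_ne_zero, 0, by simpa using P.vf_mono hed hx⟩
    obtain ⟨α, hα⟩ := P.exists_lv_of_mem hx
    have h1 := hb.v_pow_mul (e - d)
    rw [show d + (e - d) = e by omega] at h1
    set γ := P.sg^[e - d] β
    have hx' : γ * x - α * (v ^ (e - d) * b) ∈ P.vf e := by
      have h2 := P.mul_mem_vf_of_mem_one h1.1 hα.2
      have h3 := P.mul_mem_vf_of_mem_one hα.1 h1.2
      convert sub_mem h2 h3 using 1
      rw [mul_sub, mul_sub, ← mul_assoc γ, ← mul_assoc α γ, P.mul_comm_of_mem h1.1 hα.1]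
      abel
    obtain ⟨p, hp, hp0, s, hs⟩ := ih _ hx'
    refine ⟨p * γ, P.mul_mem_vf_of_mem_one hp h1.1,
      P.mul_ne_zero hp0 (P.iterate_sg_ne_zero hβ _), p * α * v ^ (e - d) + s, ?_⟩
    convert hs using 1
    rw [mul_sub, add_mul]
    simp only [mul_assoc]
    abel

section Torsion

variable {M : Type*} [AddCommGroup M] [Module k M] [Module A M] [IsScalarTower k A M]

variable (M) in
/-- The submodule of elements killed by a nonzero polynomial in `u`. -/
noncomputable def uTorsion : Submodule A M := by
  have hnt := P.nontrivial
  have hadd : ∀ {x y : M}, (∃ p ∈ P.vf 1, p ≠ 0 ∧ p • x = 0) → (∃ p ∈ P.vf 1, p ≠ 0 ∧ p • y = 0) →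
      (∃ p ∈ P.vf 1, p ≠ 0 ∧ p • (x + y) = 0) := by
    rintro x y ⟨p, hp, hp0, hx⟩ ⟨p', hp', hp0', hy⟩
    refine ⟨p * p', P.mul_mem_vf_of_mem_one hp hp', P.mul_ne_zero hp0 hp0', ?_⟩
    rw [smul_add, mul_smul, mul_smul, hy, ← mul_smul p, P.mul_comm_of_mem hp hp', mul_smul, hx]
    simp
  have hk : ∀ (a : k) {x : M}, (∃ p ∈ P.vf 1, p ≠ 0 ∧ p • x = 0) →
      (∃ p ∈ P.vf 1, p ≠ 0 ∧ p • (a • x) = 0) := by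
    rintro a x ⟨p, hp, hp0, hx⟩
    refine ⟨p, hp, hp0, ?_⟩
    rw [← algebraMap_smul A a x, ← mul_smul, ← Algebra.commutes, mul_smul, hx, smul_zero]
  let N : Submodule k M :=
    { carrier := {x | ∃ p ∈ P.vf 1, p ≠ 0 ∧ p • x = 0}
      add_mem' := hadd
      zero_mem' := ⟨1, P.one_mem_vf, one_ne_zero, smul_zero _⟩
      smul_mem' := fun a x hx => hk a hx }
  exact
    { carrier := {x | ∃ p ∈ P.vf 1, p ≠ 0 ∧ p • x = 0}
      add_mem' := hadd
      zero_mem' := ⟨1, P.one_mem_vf, one_ne_zero, smul_zero _⟩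
      smul_mem' := fun a x hx => by
        refine P.smul_mem_of_stable N ?_ ?_ a hx
        · rintro x ⟨p, hp, hp0, hx⟩
          refine ⟨p, hp, hp0, ?_⟩
          rw [← mul_smul, P.mul_comm_of_mem hp P.u_mem_vf, mul_smul, hx, smul_zero]
        · rintro x ⟨p, hp, hp0, hx⟩
          have hs := P.sg_mem hp
          have ht := P.v_mul_sub_mem hp
          refine ⟨p * P.sg p, P.mul_mem_vf_of_mem_one hp hs, P.mul_ne_zero hp0 (P.sg_ne_zero hp0),
            ?_⟩
          have h1 : P.sg p * v = v * p - (v * p - P.sg p * v) := by abel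
          rw [← mul_smul, mul_assoc, h1, mul_sub, P.mul_comm_of_mem hp ht, sub_smul, ← mul_assoc]
          simp only [mul_smul, hx, smul_zero, sub_zero] }

lemma mem_uTorsion {x : M} : x ∈ P.uTorsion M ↔ ∃ p ∈ P.vf 1, p ≠ 0 ∧ p • x = 0 := Iff.rfl

/-- The left Ore condition for nonzero polynomials in `u`. -/
lemma exists_left_ore (x : A) {p : A} (hp : p ∈ P.vf 1) (hp0 : p ≠ 0) :
    ∃ p' ∈ P.vf 1, p' ≠ 0 ∧ ∃ y, p' * x = y * p := by
  let N : Submodule A A := Submodule.span A {p}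
  have h1 : N.mkQ 1 ∈ P.uTorsion (A ⧸ N) := by
    refine ⟨p, hp, hp0, ?_⟩
    rw [← map_smul, smul_eq_mul, mul_one]
    exact (Submodule.Quotient.mk_eq_zero _).2 (Submodule.mem_span_singleton_self p)
  obtain ⟨p', hp', hp0', h⟩ := (P.uTorsion (A ⧸ N)).smul_mem x h1
  refine ⟨p', hp', hp0', ?_⟩
  rw [← map_smul, ← map_smul, smul_eq_mul, smul_eq_mul, mul_one] at h
  obtain ⟨y, hy⟩ := Submodule.mem_span_singleton.1 ((Submodule.Quotient.mk_eq_zero _).1 h)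
  exact ⟨y, hy.symm⟩

end Torsion

lemma op_mem_vf_one {x : A} : MulOpposite.op x ∈ P.op.vf 1 ↔ x ∈ P.vf 1 := by
  constructor
  · intro h
    refine P.op.map_mem_of_mem_sp (N := P.vf 1)
      (MulOpposite.opLinearEquiv k : A ≃ₗ[k] Aᵐᵒᵖ).symm.toLinearMap ?_ h
    rintro ⟨i, j⟩ (hr : j < 1)
    obtain rfl : j = 0 := by omega
    simpa [basis_apply] using P.basis_mem_vf (p := (i, 0)) (d := 1) (by simp)
  · intro h
    refine P.map_mem_of_mem_sp (N := P.op.vf 1)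
      (MulOpposite.opLinearEquiv k : A ≃ₗ[k] Aᵐᵒᵖ).toLinearMap ?_ h
    rintro ⟨i, j⟩ (hr : j < 1)
    obtain rfl : j = 0 := by omega
    simpa [basis_apply] using P.op.basis_mem_vf (p := (i, 0)) (d := 1) (by simp)

end PlaneData

/-- Every element is killed by a nonzero ring element. -/
def IsTorsionModule (A M : Type*) [Ring A] [AddCommGroup M] [Module A M] : Prop :=
  ∀ m : M, ∃ a : A, a ≠ 0 ∧ a • m = 0

/-- Extend a linear map along a surjection. -/
lemma LinearMap.exists_factor_of_surjective {R X Y Z : Type*} [Ring R] [AddCommGroup X]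
    [AddCommGroup Y] [AddCommGroup Z] [Module R X] [Module R Y] [Module R Z] (π : X →ₗ[R] Y)
    (hπ : Function.Surjective π) (f : X →ₗ[R] Z) (h : ∀ x, π x = 0 → f x = 0) :
    ∃ g : Y →ₗ[R] Z, ∀ x, g (π x) = f x := by
  have hle : LinearMap.ker π ≤ LinearMap.ker f := fun x hx => h x hx
  refine ⟨(LinearMap.ker π).liftQ f hle ∘ₗ
    (π.quotKerEquivOfSurjective hπ).symm.toLinearMap, fun x => ?_⟩
  have : (π.quotKerEquivOfSurjective hπ).symm (π x) = (LinearMap.ker π).mkQ x := by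
    rw [LinearEquiv.symm_apply_eq]; rfl
  rw [LinearMap.comp_apply, LinearEquiv.coe_coe, this, Submodule.mkQ_apply, Submodule.liftQ_apply]

namespace PlaneData

variable {k A : Type*} [Field k] [Ring A] [Algebra k A] {q c : k} {u v : A}
  (P : PlaneData k q c u v)

include P in
lemma exists_left_common {x y : A} (hx : x ≠ 0) (hy : y ≠ 0) :
    ∃ a b : A, a ≠ 0 ∧ b ≠ 0 ∧ a * x = b * y := by
  have := P.isNoetherianRing
  have := P.nontrivial
  have := P.noZeroDivisors
  let f : (Fin 2 → A) →ₗ[A] (Fin 1 → A) :=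
    LinearMap.pi fun _ => Fintype.linearCombination A ![x, y]
  have hf : ¬ Function.Injective f := fun h => by
    have := le_of_fin_injective A f h
    omega
  rw [← LinearMap.ker_eq_bot, Submodule.eq_bot_iff] at hf
  push Not at hf
  obtain ⟨z, hz, hz0⟩ := hf
  have h : z 0 * x + z 1 * y = 0 := by
    simpa [f, Fintype.linearCombination_apply, Fin.sum_univ_two] using congrFun hz 0
  have h0 : z 0 ≠ 0 := by
    intro h0
    rw [h0, zero_mul, zero_add] at h
    refine hz0 (funext fun i => ?_)
    fin_cases i
    · exact h0
    · exact (mul_eq_zero.1 h).resolve_right hy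
  refine ⟨z 0, - z 1, h0, ?_, by rw [neg_mul]; exact eq_neg_of_add_eq_zero_left h⟩
  intro h1
  rw [neg_eq_zero.1 h1, zero_mul, add_zero] at h
  exact (_root_.mul_ne_zero h0 hx) h

include P in
lemma exists_right_common {x y : A} (hx : x ≠ 0) (hy : y ≠ 0) :
    ∃ a b : A, a ≠ 0 ∧ b ≠ 0 ∧ x * a = y * b := by
  obtain ⟨a, b, ha, hb, h⟩ := P.op.exists_left_common ((MulOpposite.op_ne_zero_iff x).2 hx)
    ((MulOpposite.op_ne_zero_iff y).2 hy)
  exact ⟨a.unop, b.unop, (MulOpposite.unop_ne_zero_iff a).2 ha,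
    (MulOpposite.unop_ne_zero_iff b).2 hb, by simpa using congrArg MulOpposite.unop h⟩

section Torsion

variable {M : Type*} [AddCommGroup M] [Module k M] [Module A M] [IsScalarTower k A M]

lemma exists_common_annihilator {ι : Type*} [Finite ι] (x : ι → M)
    (hx : ∀ i, x i ∈ P.uTorsion M) : ∃ p ∈ P.vf 1, p ≠ 0 ∧ ∀ i, p • x i = 0 := by
  classical
  have := P.nontrivial
  have := Fintype.ofFinite ι
  suffices h : ∀ s : Finset ι, ∃ p ∈ P.vf 1, p ≠ 0 ∧ ∀ i ∈ s, p • x i = 0 by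
    simpa using h Finset.univ
  intro s
  induction s using Finset.induction_on with
  | empty => exact ⟨1, P.one_mem_vf, one_ne_zero, by simp⟩
  | insert a s _ ih =>
    obtain ⟨p, hp, hp0, h⟩ := ih
    obtain ⟨p', hp', hp0', h'⟩ := P.mem_uTorsion.1 (hx a)
    refine ⟨p * p', P.mul_mem_vf_of_mem_one hp hp', P.mul_ne_zero hp0 hp0', fun i hi => ?_⟩
    rcases Finset.mem_insert.1 hi with rfl | hi
    · rw [mul_smul, h', smul_zero]
    · rw [P.mul_comm_of_mem hp hp', mul_smul, h i hi, smul_zero]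

lemma exists_left_ore_family {ι : Type*} [Finite ι] (x : ι → A) {p : A} (hp : p ∈ P.vf 1)
    (hp0 : p ≠ 0) : ∃ p' ∈ P.vf 1, p' ≠ 0 ∧ ∃ y : ι → A, ∀ i, p' * x i = y i * p := by
  obtain ⟨p', hp', hp0', h⟩ := P.exists_common_annihilator
    (fun i => (Submodule.span A {p}).mkQ (x i)) (fun i => by
      obtain ⟨p', hp', hp0', y, h⟩ := P.exists_left_ore (x i) hp hp0
      refine ⟨p', hp', hp0', ?_⟩
      rw [← map_smul]
      exact (Submodule.Quotient.mk_eq_zero _).2 (Submodule.mem_span_singleton.2 ⟨y, h.symm⟩))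
  suffices h' : ∀ i, ∃ y, p' * x i = y * p by
    choose y hy using h'
    exact ⟨p', hp', hp0', y, hy⟩
  intro i
  have := h i
  rw [← map_smul] at this
  obtain ⟨y, hy⟩ := Submodule.mem_span_singleton.1 ((Submodule.Quotient.mk_eq_zero _).1 this)
  exact ⟨y, hy.symm⟩

lemma exists_right_ore_family {ι : Type*} [Finite ι] (x : ι → A) {p : A} (hp : p ∈ P.vf 1)
    (hp0 : p ≠ 0) : ∃ p' ∈ P.vf 1, p' ≠ 0 ∧ ∃ y : ι → A, ∀ i, x i * p' = p * y i := by
  obtain ⟨p', hp', hp0', y, h⟩ := P.op.exists_left_ore_family (fun i => MulOpposite.op (x i))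
    (P.op_mem_vf_one.2 hp) ((MulOpposite.op_ne_zero_iff p).2 hp0)
  exact ⟨p'.unop, P.op_mem_vf_one.1 hp', (MulOpposite.unop_ne_zero_iff p').2 hp0',
    fun i => (y i).unop, fun i => by simpa using congrArg MulOpposite.unop (h i)⟩

/-- A left ideal without polynomials in `u` is, up to such polynomials, generated by one
element of positive `v`-degree. -/
lemma exists_generator_up_to (I : Submodule A A) (hI : I ≠ ⊥) (h : ∀ p ∈ P.vf 1, p ∈ I → p = 0) :
    ∃ b ∈ I, b ∉ P.vf 1 ∧ ∀ x ∈ I, ∃ p ∈ P.vf 1, p ≠ 0 ∧ ∃ s, p * x = s * b := by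
  classical
  obtain ⟨x, hx, hx0⟩ := (Submodule.ne_bot_iff I).1 hI
  have hex : ∃ d, ∃ b ∈ I, b ≠ 0 ∧ b ∈ P.vf d := by
    obtain ⟨d, hd⟩ := P.exists_mem_vf x
    exact ⟨d, x, hx, hx0, hd⟩
  have hmin := fun m => Nat.find_min hex (m := m)
  obtain ⟨b, hb, hb0, hbd⟩ := Nat.find_spec hex
  generalize Nat.find hex = d at hbd hmin
  cases d with
  | zero => exact absurd (P.mem_vf_zero.1 hbd) hb0
  | succ d =>
    obtain ⟨β, hβ⟩ := P.exists_lv_of_mem hbd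
    have hβ0 : β ≠ 0 := by
      rintro rfl
      exact hmin d (Nat.lt_succ_self d) ⟨b, hb, hb0, by simpa using hβ.2⟩
    refine ⟨b, hb, fun h' => hb0 (h b h' hb), fun x hx => ?_⟩
    obtain ⟨e, he⟩ := P.exists_mem_vf x
    obtain ⟨p, hp, hp0, s, hs⟩ := P.exists_division hβ hβ0 e x he
    refine ⟨p, hp, hp0, s, ?_⟩
    by_contra hne
    exact hmin d (Nat.lt_succ_self d) ⟨_, sub_mem (I.smul_mem p hx) (I.smul_mem s hb),
      sub_ne_zero.2 hne, hs⟩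

/-- A finitely generated torsion module which is not `u`-torsion maps nontrivially to a cyclic
module with one relation. -/
lemma exists_hom_of_not_uTorsion [Module.Finite A M] (ht : IsTorsionModule A M)
    (hM : P.uTorsion M ≠ ⊤) :
    ∃ (a : A) (φ : M →ₗ[A] A ⧸ Submodule.span A {a}), a ≠ 0 ∧ φ ≠ 0 := by
  classical
  have := P.isNoetherianRing
  have := P.noZeroDivisors
  have := P.nontrivial
  have hnoeth : IsNoetherian A M := inferInstance
  obtain ⟨N, hN, hmax⟩ := set_has_maximal_iff_noetherian.2 hnoeth
    {N : Submodule A M | P.uTorsion (M ⧸ N) ≠ ⊤} ⟨⊥, by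
      intro h
      refine hM (eq_top_iff.2 fun x _ => ?_)
      have h1 : (⊥ : Submodule A M).mkQ x ∈ P.uTorsion _ := by rw [h]; trivial
      obtain ⟨p, hp, hp0, h2⟩ := h1
      refine ⟨p, hp, hp0, ?_⟩
      rw [← map_smul] at h2
      exact (Submodule.mem_bot A).1 ((Submodule.Quotient.mk_eq_zero _).1 h2)⟩
  obtain ⟨e, he⟩ : ∃ e : M, N.mkQ e ∉ P.uTorsion (M ⧸ N) := by
    by_contra! h
    refine hN (eq_top_iff.2 fun x _ => ?_)
    obtain ⟨x, rfl⟩ := N.mkQ_surjective x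
    exact h x
  have heN : e ∉ N := by
    intro h
    refine he ?_
    rw [show N.mkQ e = 0 from (Submodule.Quotient.mk_eq_zero N).2 h]
    exact zero_mem _
  -- every element is up to a polynomial a multiple of `e`
  have hmul : ∀ x : M, (N ⊔ Submodule.span A {e}).mkQ x ∈ P.uTorsion _ := by
    have hlt : N < N ⊔ Submodule.span A {e} := by
      refine lt_of_le_of_ne le_sup_left fun h => heN ?_
      rw [h]
      exact Submodule.mem_sup_right (Submodule.mem_span_singleton_self e)
    intro x
    by_contra hx
    exact hmax _ (fun h => hx (by rw [h]; trivial)) hlt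
  obtain ⟨S, hS⟩ := (inferInstance : Module.Finite A M).fg_top
  let ι := ↥(insert e S)
  let m : ι → M := fun i => i
  let i₀ : ι := ⟨e, Finset.mem_insert_self _ _⟩
  let π : (ι → A) →ₗ[A] M := Fintype.linearCombination A m
  have hπ : Function.Surjective π := by
    rw [← LinearMap.range_eq_top, Fintype.range_linearCombination, eq_top_iff, ← hS]
    refine Submodule.span_mono ?_
    intro x hx
    exact ⟨⟨x, Finset.mem_insert_of_mem hx⟩, rfl⟩
  obtain ⟨p, hp, hp0, hpm⟩ := P.exists_common_annihilator _ (fun i => hmul (m i))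
  have hp' : ∀ i, ∃ a : A, (i = i₀ → a = p) ∧ p • m i - a • e ∈ N := by
    intro i
    by_cases hi : i = i₀
    · refine ⟨p, fun _ => rfl, ?_⟩
      subst hi
      simp [m, i₀]
    · have h := hpm i
      rw [← map_smul] at h
      obtain ⟨x, hx, y, hy, h⟩ := Submodule.mem_sup.1 ((Submodule.Quotient.mk_eq_zero _).1 h)
      obtain ⟨a, rfl⟩ := Submodule.mem_span_singleton.1 hy
      exact ⟨a, fun h => absurd h hi, by rw [← h]; simpa using hx⟩
  choose a ha₀ ha using hp'
  let I : Submodule A A := N.comap (LinearMap.toSpanSingleton A M e)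
  have hmemI : ∀ x, x ∈ I ↔ x • e ∈ N := fun x => Iff.rfl
  obtain ⟨b, hb, hb1, hdiv⟩ := P.exists_generator_up_to I
    (by
      obtain ⟨y, hy0, hy⟩ := ht e
      rw [Submodule.ne_bot_iff]
      exact ⟨y, by rw [hmemI, hy]; exact zero_mem _, hy0⟩)
    (fun r hr hrI => by
      by_contra hr0
      refine he ⟨r, hr, hr0, ?_⟩
      rw [← map_smul]
      exact (Submodule.Quotient.mk_eq_zero _).2 hrI)
  have hb0 : b ≠ 0 := by rintro rfl; exact hb1 (zero_mem _)
  obtain ⟨p₂, hp₂, hp₂0, a', ha'⟩ := P.exists_right_ore_family a hp hp0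
  have ha'₀ : a' i₀ = p₂ := by
    have := ha' i₀
    rw [ha₀ i₀ rfl] at this
    exact (mul_left_cancel₀ hp0 this).symm
  set a₀ := b * p₂ with ha₀def
  have ha₀0 : a₀ ≠ 0 := P.mul_ne_zero hb0 hp₂0
  let I₀ : Submodule A A := (P.uTorsion (A ⧸ Submodule.span A {a₀})).comap (Submodule.mkQ _)
  have hmemI₀ : ∀ x, x ∈ I₀ ↔ ∃ r ∈ P.vf 1, r ≠ 0 ∧ ∃ s, r * x = s * a₀ := by
    intro x
    have : ∀ r : A, r • (Submodule.span A {a₀}).mkQ x = 0 ↔ ∃ s, r * x = s * a₀ := by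
      intro r
      rw [← map_smul, Submodule.mkQ_apply, Submodule.Quotient.mk_eq_zero,
        Submodule.mem_span_singleton]
      exact exists_congr fun s => eq_comm
    simp only [I₀, Submodule.mem_comap, mem_uTorsion, this]
  have hker : ∀ x, π x ∈ N → Fintype.linearCombination A a' x ∈ I₀ := by
    intro x hx
    obtain ⟨r, hr, hr0, y, hy⟩ := P.exists_left_ore_family x hp hp0
    have hyI : ∑ i, y i * a i ∈ I := by
      rw [hmemI, Finset.sum_smul]
      have h1 : r • π x - ∑ i, y i • (p • m i - a i • e) ∈ N :=
        sub_mem (N.smul_mem _ hx) (sum_mem fun i _ => N.smul_mem _ (ha i))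
      convert h1 using 1
      rw [Fintype.linearCombination_apply, Finset.smul_sum, ← Finset.sum_sub_distrib]
      refine Finset.sum_congr rfl fun i _ => ?_
      rw [← mul_smul, hy, smul_sub, mul_smul, mul_smul]
      abel
    obtain ⟨r', hr', hr0', s, hs⟩ := hdiv _ hyI
    refine (hmemI₀ _).2 ⟨r' * r, P.mul_mem_vf_of_mem_one hr' hr, P.mul_ne_zero hr0' hr0, s, ?_⟩
    rw [ha₀def, ← mul_assoc, ← hs, mul_assoc, mul_assoc]
    congr 1
    rw [Fintype.linearCombination_apply, Finset.mul_sum, Finset.sum_mul]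
    refine Finset.sum_congr rfl fun i _ => ?_
    rw [smul_eq_mul, ← mul_assoc, hy, mul_assoc, mul_assoc, ha']
  obtain ⟨S₀, hS₀⟩ := (isNoetherian_def.1 (inferInstance : IsNoetherian A A)) I₀
  obtain ⟨r, hr, hr0, hrS⟩ := P.exists_common_annihilator
    (fun x : ↥S₀ => (Submodule.span A {a₀}).mkQ x.1) (fun x => by
      have : (x : A) ∈ I₀ := by rw [← hS₀]; exact Submodule.subset_span x.2
      exact this)
  have hrS' : ∀ x : ↥S₀, ∃ s, r * x.1 = s * a₀ := by
    intro x
    have := hrS x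
    rw [← map_smul] at this
    obtain ⟨s, hs⟩ := Submodule.mem_span_singleton.1 ((Submodule.Quotient.mk_eq_zero _).1 this)
    exact ⟨s, hs.symm⟩
  choose s hs using hrS'
  obtain ⟨w, hw, hw0, s', hs'⟩ := P.exists_right_ore_family s hr hr0
  obtain ⟨c₂, a₁, hc₂, ha₁, hca⟩ := P.exists_right_common ha₀0 hw0
  have hI₀ : ∀ x ∈ I₀, x * c₂ ∈ Submodule.span A {a₁} := by
    suffices h : I₀ ≤ (Submodule.span A {a₁}).comap (LinearMap.toSpanSingleton A A c₂) from h
    rw [← hS₀, Submodule.span_le]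
    intro x hx
    refine Submodule.mem_span_singleton.2 ⟨s' ⟨x, hx⟩, mul_left_cancel₀ hr0 ?_⟩
    change r * (s' ⟨x, hx⟩ * a₁) = r * (x * c₂)
    rw [← mul_assoc, ← hs', mul_assoc, ← hca, ← mul_assoc, ← mul_assoc r, hs ⟨x, hx⟩]
  obtain ⟨φ, hφ⟩ := π.exists_factor_of_surjective hπ
    ((Submodule.span A {a₁}).mkQ ∘ₗ LinearMap.toSpanSingleton A A c₂ ∘ₗ
      Fintype.linearCombination A a')
    (fun x hx => (Submodule.Quotient.mk_eq_zero _).2 (hI₀ _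
      (hker x (by rw [hx]; exact zero_mem _))))
  refine ⟨a₁, φ, ha₁, fun h0 => ?_⟩
  have h := hφ (Pi.single i₀ 1)
  rw [h0, LinearMap.zero_apply, LinearMap.comp_apply, LinearMap.comp_apply,
    Fintype.linearCombination_apply_single, one_smul, ha'₀] at h
  obtain ⟨z, hz⟩ := Submodule.mem_span_singleton.1 ((Submodule.Quotient.mk_eq_zero _).1 h.symm)
  change z * a₁ = p₂ * c₂ at hz
  have hbz : b * z = w := by
    refine mul_right_cancel₀ ha₁ ?_
    rw [mul_assoc, hz, ← mul_assoc, ← hca]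
  have hz0 : z ≠ 0 := by
    rintro rfl
    rw [mul_zero] at hbz
    exact hw0 hbz.symm
  exact P.mul_not_mem_vf_one hb1 hz0 (hbz ▸ hw)

end Torsion

end PlaneData

open Polynomial in
/-- Powers of an algebraic element preserve finite-dimensionality. -/
lemma Submodule.FG.exists_pow_smul_mem {k A M : Type*} [Field k] [Ring A] [Algebra k A]
    [AddCommGroup M] [Module k M] [Module A M] [IsScalarTower k A M] (t : A) {W : Submodule k M}
    (hW : W.FG) {r : k[X]} (hr : r ≠ 0) (h : ∀ w ∈ W, aeval t r • w = 0) :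
    ∃ W' : Submodule k M, W'.FG ∧ ∀ w ∈ W, ∀ j, t ^ j • w ∈ W' := by
  refine ⟨⨆ i : Fin r.natDegree, W.map (Algebra.lsmul k k M (t ^ (i : ℕ))),
    Submodule.fg_iSup _ fun i => hW.map _, fun w hw j => ?_⟩
  have h1 : t ^ j • w = aeval t (X ^ j % r) • w := by
    conv_lhs => rw [← aeval_X (R := k) t, ← map_pow, ← EuclideanDomain.mod_add_div (X ^ j) r,
      mul_comm r, map_add, map_mul, add_smul, mul_smul, h w hw, smul_zero, add_zero]
  by_cases h0 : X ^ j % r = 0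
  · rw [h1, h0, map_zero, zero_smul]; exact zero_mem _
  have hlt : (X ^ j % r).natDegree < r.natDegree :=
    natDegree_lt_natDegree h0 (EuclideanDomain.mod_lt _ hr)
  rw [h1, aeval_eq_sum_range' hlt, Finset.sum_smul]
  refine Submodule.sum_mem _ fun i hi => ?_
  rw [smul_assoc]
  refine Submodule.smul_mem _ _ (Submodule.mem_iSup_of_mem ⟨i, Finset.mem_range.1 hi⟩ ⟨w, hw, rfl⟩)

namespace PlaneData

open Polynomial

variable {k A : Type*} [Field k] [Ring A] [Algebra k A] {q c : k} {u v : A}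
  (P : PlaneData k q c u v)

lemma exists_aeval_of_mem_vf_one {p : A} (hp : p ∈ P.vf 1) : ∃ r : k[X], aeval u r = p := by
  have : P.vf 1 ≤ LinearMap.range (aeval (R := k) u).toLinearMap := by
    refine P.sp_le ?_
    rintro ⟨i, j⟩ (hr : j < 1)
    obtain rfl : j = 0 := by omega
    exact ⟨X ^ i, by simp [basis_apply]⟩
  exact this hp

section

variable {M : Type*} [AddCommGroup M] [Module k M] [Module A M] [IsScalarTower k A M]

lemma exists_aeval_of_mem_uTorsion {m : M} (hm : m ∈ P.uTorsion M) :
    ∃ r : k[X], r ≠ 0 ∧ aeval u r • m = 0 := by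
  obtain ⟨p, hp, hp0, h⟩ := hm
  obtain ⟨r, rfl⟩ := P.exists_aeval_of_mem_vf_one hp
  exact ⟨r, fun h => hp0 (by rw [h, map_zero]), h⟩

lemma exists_aeval_forall (t : A) (h : ∀ m : M, ∃ r : k[X], r ≠ 0 ∧ aeval t r • m = 0)
    {W : Submodule k M} (hW : W.FG) : ∃ r : k[X], r ≠ 0 ∧ ∀ w ∈ W, aeval t r • w = 0 := by
  choose r hr0 hr using h
  obtain ⟨S, rfl⟩ := hW
  refine ⟨∏ m ∈ S, r m, Finset.prod_ne_zero_iff.2 fun m _ => hr0 m, fun w hw => ?_⟩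
  suffices hle : Submodule.span k (S : Set M) ≤
      LinearMap.ker (Algebra.lsmul k k M (aeval t (∏ m ∈ S, r m))) from hle hw
  rw [Submodule.span_le]
  intro m hm
  change aeval t (∏ m ∈ S, r m) • m = 0
  obtain ⟨z, hz⟩ := Finset.dvd_prod_of_mem r hm
  rw [hz, mul_comm, map_mul, mul_smul, hr, smul_zero]

include P in
/-- A finitely generated module on which `u` and `v` are locally algebraic is
finite-dimensional. -/
lemma finite_of_algebraic [Module.Finite A M]
    (hu : ∀ m : M, ∃ r : k[X], r ≠ 0 ∧ aeval u r • m = 0)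
    (hv : ∀ m : M, ∃ r : k[X], r ≠ 0 ∧ aeval v r • m = 0) : Module.Finite k M := by
  obtain ⟨S, hS⟩ := (inferInstance : Module.Finite A M).fg_top
  have hW : (Submodule.span k (S : Set M)).FG := ⟨S, rfl⟩
  obtain ⟨r, hr0, hr⟩ := exists_aeval_forall v hv hW
  obtain ⟨W', hW', h'⟩ := hW.exists_pow_smul_mem v hr0 hr
  obtain ⟨r', hr0', hr'⟩ := exists_aeval_forall u hu hW'
  obtain ⟨W, hW, h⟩ := hW'.exists_pow_smul_mem u hr0' hr'
  refine ⟨?_⟩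
  convert hW
  symm
  rw [eq_top_iff]
  intro x _
  have hx : x ∈ Submodule.span A (S : Set M) := by rw [hS]; trivial
  obtain ⟨f, -, rfl⟩ := Submodule.mem_span_finset.1 hx
  refine Submodule.sum_mem _ fun m hm => ?_
  have : P.sp Set.univ ≤ W.comap ((LinearMap.toSpanSingleton A M m).restrictScalars k) := by
    refine P.sp_le fun p _ => ?_
    change P.basis p • m ∈ W
    rw [basis_apply, mul_smul]
    exact h _ (h' m (Submodule.subset_span hm) _) _
  exact this (P.mem_sp.2 fun r hr => absurd (Set.mem_univ r) hr)

include P in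
/-- A finitely generated infinite-dimensional module has a quotient all of whose proper quotients
are finite-dimensional. -/
lemma exists_critical_quotient [Module.Finite A M] (hM : ¬ Module.Finite k M) :
    ∃ N : Submodule A M, ¬ Module.Finite k (M ⧸ N) ∧
      ∀ L : Submodule A (M ⧸ N), L ≠ ⊥ → Module.Finite k ((M ⧸ N) ⧸ L) := by
  have := P.isNoetherianRing
  have hnoeth : IsNoetherian A M := inferInstance
  obtain ⟨N, hN, hmax⟩ := set_has_maximal_iff_noetherian.2 hnoeth
    {N : Submodule A M | ¬ Module.Finite k (M ⧸ N)} ⟨⊥, fun h => hM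
      (Module.Finite.equiv
        ((Submodule.quotEquivOfEqBot (⊥ : Submodule A M) rfl).restrictScalars k))⟩
  refine ⟨N, hN, fun L hL => ?_⟩
  have hlt : N < L.comap N.mkQ := by
    refine lt_of_le_of_ne (fun x hx => ?_) fun h => hL ?_
    · change N.mkQ x ∈ L
      rw [show N.mkQ x = 0 from (Submodule.Quotient.mk_eq_zero N).2 hx]
      exact zero_mem _
    · rw [eq_bot_iff]
      intro y hy
      obtain ⟨x, rfl⟩ := N.mkQ_surjective y
      have : x ∈ N := by rw [h]; exact hy
      exact (Submodule.Quotient.mk_eq_zero N).2 this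
  have hfin : Module.Finite k (M ⧸ L.comap N.mkQ) := not_not.1 fun h => hmax _ h hlt
  obtain ⟨g, hg⟩ := (L.comap N.mkQ).mkQ.exists_factor_of_surjective (Submodule.mkQ_surjective _)
    (L.mkQ ∘ₗ N.mkQ) (fun x hx => (Submodule.Quotient.mk_eq_zero L).2
      ((Submodule.Quotient.mk_eq_zero (L.comap N.mkQ)).1 hx : x ∈ L.comap N.mkQ))
  refine Module.Finite.of_surjective (g.restrictScalars k) fun y => ?_
  obtain ⟨y, rfl⟩ := L.mkQ_surjective y
  obtain ⟨x, rfl⟩ := N.mkQ_surjective y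
  exact ⟨_, hg x⟩

/-- The plane obtained by exchanging the variables of a quantum plane. -/
lemma swap (P : PlaneData k q 0 u v) : PlaneData k q⁻¹ 0 v u where
  q_ne := inv_ne_zero P.q_ne
  rel := by rw [P.rel]; simp [smul_smul, P.q_ne]
  li := (P.linearIndependent_v_u.comp Prod.swap Prod.swap_injective :)
  span := by
    rw [← P.span_v_u]
    refine Submodule.span_mono ?_
    rintro _ ⟨p, rfl⟩
    exact ⟨p.swap, rfl⟩

/-- Over a quantum plane, an infinite-dimensional finitely generated torsion module has a nonzero
map to a cyclic module with one relation. -/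
lemma exists_hom_quantum (P : PlaneData k q 0 u v) [Module.Finite A M] (ht : IsTorsionModule A M)
    (hM : ¬ Module.Finite k M) :
    ∃ (a : A) (φ : M →ₗ[A] A ⧸ Submodule.span A {a}), a ≠ 0 ∧ φ ≠ 0 := by
  by_cases h1 : P.uTorsion M = ⊤
  · by_cases h2 : P.swap.uTorsion M = ⊤
    · refine absurd (P.finite_of_algebraic (fun m => P.exists_aeval_of_mem_uTorsion ?_)
        (fun m => P.swap.exists_aeval_of_mem_uTorsion ?_)) hM
      · rw [h1]; trivial
      · rw [h2]; trivial
    · exact P.swap.exists_hom_of_not_uTorsion ht h2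
  · exact P.exists_hom_of_not_uTorsion ht h1

include P in
lemma exists_mul_sub_add_aeval (μ : k) (a : A) :
    ∃ (b : A) (p : k[X]), a = b * (u - algebraMap k A μ) + aeval v p := by
  let N : Submodule k A := LinearMap.range (LinearMap.mulRight k (u - algebraMap k A μ)) ⊔
    LinearMap.range (aeval (R := k) v).toLinearMap
  have hN : (⊤ : Submodule k A) ≤ N := by
    rw [← P.span_v_u, Submodule.span_le]
    rintro _ ⟨⟨i, j⟩, rfl⟩
    change v ^ j * u ^ i ∈ N
    induction i with
    | zero => exact Submodule.mem_sup_right ⟨X ^ j, by simp⟩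
    | succ i ih =>
      have : v ^ j * u ^ (i + 1) =
            v ^ j * u ^ i * (u - algebraMap k A μ) + μ • (v ^ j * u ^ i) := by
        rw [mul_sub, pow_succ, ← mul_assoc, ← Algebra.commutes, ← Algebra.smul_def]
        abel
      rw [this]
      exact add_mem (Submodule.mem_sup_left ⟨_, rfl⟩) (N.smul_mem _ ih)
  obtain ⟨_, ⟨b, rfl⟩, _, ⟨p, rfl⟩, h⟩ := Submodule.mem_sup.1 (hN (Submodule.mem_top (x := a)))
  exact ⟨b, p, h.symm⟩

/-- An eigenvector generating a module free over polynomials in `v` generates a module isomorphic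
to the one with a single relation. -/
lemma mem_span_of_smul_eq_zero (P : PlaneData k q c u v) {μ : k} {e : M} (he : u • e = μ • e)
    (hfree : ∀ p : k[X], aeval v p • e = 0 → p = 0) {a : A} (ha : a • e = 0) :
    a ∈ Submodule.span A {u - algebraMap k A μ} := by
  obtain ⟨b, p, rfl⟩ := P.exists_mul_sub_add_aeval μ a
  rw [add_smul, mul_smul, sub_smul, he, algebraMap_smul, sub_self, smul_zero, zero_add] at ha
  rw [hfree p ha, map_zero, add_zero]
  exact Submodule.mem_span_singleton.2 ⟨b, rfl⟩

lemma aeval_charpoly_smul [Module.Finite k M] (t : A) (m : M) :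
    aeval t (LinearMap.charpoly (Algebra.lsmul k k M t)) • m = 0 := by
  have h := LinearMap.aeval_self_charpoly (Algebra.lsmul k k M t)
  rw [aeval_algHom_apply] at h
  exact LinearMap.congr_fun h m

section Jordan

lemma jordan_sub_pow_mul (P : PlaneData k 1 c u v) (μ : k) (n : ℕ) :
    (u - algebraMap k A μ) ^ (n + 1) * v = v * (u - algebraMap k A μ) ^ (n + 1)
      - ((n + 1 : ℕ) * c) • (u * u * (u - algebraMap k A μ) ^ n) := by
  set w := u - algebraMap k A μ with hw
  have h1 : w * v = v * w - c • (u * u) := by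
    rw [hw, sub_mul, mul_sub, P.rel, ← Algebra.commutes μ v, one_smul]
    abel
  have h2 : w * (u * u) = u * u * w := by
    have : Commute w u := by
      rw [hw]; exact (Commute.refl u).sub_left (Algebra.commutes μ u)
    exact (this.mul_right this).eq
  induction n with
  | zero => simpa using h1
  | succ n ih =>
    rw [pow_succ' w (n + 1), mul_assoc, ih, mul_sub, ← mul_assoc, h1, sub_mul, mul_smul_comm,
      ← mul_assoc, h2, smul_mul_assoc]
    simp only [pow_succ', mul_assoc]
    push_cast
    module

lemma jordan_sub_pow_smul (P : PlaneData k 1 c u v) [CharZero k] (hc : c ≠ 0) {μ : k}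
    (hμ : μ ≠ 0) {e : M}
    (he : u • e = μ • e) (j : ℕ) :
    ∃ a : k, a ≠ 0 ∧ (u - algebraMap k A μ) ^ j • v ^ j • e = a • e ∧
      (u - algebraMap k A μ) ^ (j + 1) • v ^ j • e = 0 := by
  have hw : (u - algebraMap k A μ) • e = 0 := by
    rw [sub_smul, he, algebraMap_smul, sub_self]
  have hswap : ∀ (a : k) (x : A) (m : M), x • a • m = a • x • m := fun a x m =>
    (Algebra.lsmul k k M x).map_smul a m
  induction j with
  | zero => exact ⟨1, one_ne_zero, by simp, by simpa using hw⟩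
  | succ j ih =>
    obtain ⟨a, ha, h1, h2⟩ := ih
    have h3 : ∀ n, (u - algebraMap k A μ) ^ (n + 1) • v ^ (j + 1) • e =
        v • (u - algebraMap k A μ) ^ (n + 1) • v ^ j • e -
          ((n + 1 : ℕ) * c) • u • u • (u - algebraMap k A μ) ^ n • v ^ j • e := by
      intro n
      rw [pow_succ' v, mul_smul, ← mul_smul _ v, P.jordan_sub_pow_mul, sub_smul, smul_assoc]
      simp only [mul_smul]
    refine ⟨-(((j + 1 : ℕ) * c) * (a * (μ * μ))), ?_, ?_, ?_⟩
    · have : ((j + 1 : ℕ) : k) ≠ 0 := Nat.cast_ne_zero.2 (Nat.succ_ne_zero j)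
      exact neg_ne_zero.2 (_root_.mul_ne_zero (_root_.mul_ne_zero this hc)
        (_root_.mul_ne_zero ha (_root_.mul_ne_zero hμ hμ)))
    · rw [h3, h2, h1]
      simp only [hswap, he, smul_zero, smul_smul]
      module
    · rw [h3, h2, pow_succ', mul_smul, h2]
      simp

lemma jordan_free (P : PlaneData k 1 c u v) [CharZero k] (hc : c ≠ 0) {μ : k}
    (hμ : μ ≠ 0) {e : M} (he0 : e ≠ 0)
    (he : u • e = μ • e) {p : k[X]} (hp : aeval v p • e = 0) : p = 0 := by
  by_contra hp0
  obtain ⟨a, ha, h1, -⟩ := P.jordan_sub_pow_smul hc hμ he p.natDegree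
  have h2 : ∀ j < p.natDegree, (u - algebraMap k A μ) ^ p.natDegree • v ^ j • e = 0 := by
    intro j hj
    obtain ⟨-, -, -, h⟩ := P.jordan_sub_pow_smul hc hμ he j
    obtain ⟨i, hi⟩ := Nat.exists_eq_add_of_lt hj
    rw [hi, show j + i + 1 = i + (j + 1) by ring, pow_add, mul_smul, h, smul_zero]
  have h3 : (u - algebraMap k A μ) ^ p.natDegree • aeval v p • e = (p.leadingCoeff * a) • e := by
    rw [aeval_eq_sum_range, Finset.sum_range_succ, add_smul, Finset.sum_smul, smul_add,
      Finset.smul_sum, Finset.sum_eq_zero, zero_add, smul_assoc, mul_smul, ← h1]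
    · exact (Algebra.lsmul k k M _).map_smul _ _
    · intro j hj
      rw [smul_assoc]
      refine ((Algebra.lsmul k k M _).map_smul _ _).trans ?_
      change p.coeff j • ((u - algebraMap k A μ) ^ p.natDegree • v ^ j • e) = 0
      rw [h2 j (Finset.mem_range.1 hj), smul_zero]
  rw [hp, smul_zero] at h3
  rcases smul_eq_zero.1 h3.symm with h | h
  · exact _root_.mul_ne_zero (leadingCoeff_ne_zero.2 hp0) ha h
  · exact he0 h

lemma jordan_not_finite (P : PlaneData k 1 c u v) [CharZero k] (hc : c ≠ 0) {μ : k}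
    (hμ : μ ≠ 0) {e : M} (he0 : e ≠ 0)
    (he : u • e = μ • e) : ¬ Module.Finite k M := by
  intro h
  have := P.jordan_free hc hμ he0 he (aeval_charpoly_smul v e)
  exact (LinearMap.charpoly_monic _).ne_zero this

end Jordan

end

end PlaneData

open Polynomial in
/-- A vector annihilated by a nonzero polynomial in an element produces an eigenvector. -/
lemma IsAlgClosed.exists_eigenvector_smul {k A M : Type*} [Field k] [IsAlgClosed k] [Ring A]
    [Algebra k A] [AddCommGroup M] [Module k M] [Module A M] [IsScalarTower k A M] (t : A)
    {r : k[X]} (hr : r ≠ 0) {m : M} (hm : m ≠ 0) (h : aeval t r • m = 0) :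
    ∃ (μ : k) (e : M), e ≠ 0 ∧ t • e = μ • e := by
  induction hd : r.natDegree generalizing r with
  | zero =>
    rw [eq_C_of_natDegree_eq_zero hd, aeval_C, algebraMap_smul] at h
    refine absurd ((smul_eq_zero.1 h).resolve_right hm) fun h0 => hr ?_
    rw [eq_C_of_natDegree_eq_zero hd, h0, C_0]
  | succ d ih =>
    obtain ⟨μ, hμ⟩ := IsAlgClosed.exists_root r
      (fun h0 => by rw [natDegree_eq_of_degree_eq_some h0] at hd; simp at hd)
    obtain ⟨s, rfl⟩ := dvd_iff_isRoot.2 hμ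
    have hs : s ≠ 0 := right_ne_zero_of_mul hr
    by_cases h0 : aeval t s • m = 0
    · refine ih hs h0 ?_
      rw [natDegree_mul (X_sub_C_ne_zero μ) hs, natDegree_X_sub_C] at hd
      omega
    · refine ⟨μ, _, h0, ?_⟩
      rwa [map_mul, mul_smul, map_sub, aeval_X, aeval_C, sub_smul, algebraMap_smul,
        sub_eq_zero] at h

namespace PlaneData

open Polynomial

variable {k A : Type*} [Field k] [Ring A] [Algebra k A] {q c : k} {u v : A}
  (P : PlaneData k q c u v) {X : Type*} [AddCommGroup X] [Module k X] [Module A X]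
  [IsScalarTower k A X]

/-- The submodule carried by a subspace stable under both generators. -/
def ofStable (P : PlaneData k q c u v) (N : Submodule k X) (hu : ∀ x ∈ N, u • x ∈ N)
    (hv : ∀ x ∈ N, v • x ∈ N) : Submodule A X where
  carrier := N
  add_mem' := N.add_mem
  zero_mem' := N.zero_mem
  smul_mem' a _ hx := P.smul_mem_of_stable N hu hv a hx

include P in
lemma exists_map_of_free {μ : k} {e : X} (he : u • e = μ • e)
    (hfree : ∀ p : k[X], aeval v p • e = 0 → p = 0) :
    ∃ ρ : LinearMap.range (LinearMap.toSpanSingleton A X e) →ₗ[A]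
      A ⧸ Submodule.span A {u - algebraMap k A μ},
      ∀ a, ρ ((LinearMap.toSpanSingleton A X e).rangeRestrict a) = Submodule.Quotient.mk a := by
  obtain ⟨ρ, hρ⟩ := (LinearMap.toSpanSingleton A X e).rangeRestrict.exists_factor_of_surjective
    (LinearMap.surjective_rangeRestrict _) (Submodule.span A {u - algebraMap k A μ}).mkQ
    (fun a ha => (Submodule.Quotient.mk_eq_zero _).2
      (P.mem_span_of_smul_eq_zero he hfree (congrArg Subtype.val ha)))
  exact ⟨ρ, hρ⟩

include P in
lemma exists_hom_of_smul_eq_zero [Module.Finite A X] (hX : ¬ Module.Finite k X)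
    (hcrit : ∀ L : Submodule A X, L ≠ ⊥ → Module.Finite k (X ⧸ L)) (hu : ∀ x : X, u • x = 0) :
    ∃ (a : A) (φ : X →ₗ[A] A ⧸ Submodule.span A {a}), a ≠ 0 ∧ φ ≠ 0 := by
  obtain ⟨e, he⟩ : ∃ e : X, ∀ p : k[X], aeval v p • e = 0 → p = 0 := by
    by_contra! h
    refine hX (P.finite_of_algebraic (fun m => ⟨Polynomial.X, X_ne_zero, by simp [hu]⟩)
      fun m => ?_)
    obtain ⟨p, hp, hp0⟩ := h m
    exact ⟨p, hp0, hp⟩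
  have hue : u • e = (0 : k) • e := by rw [hu, zero_smul]
  obtain ⟨ρ, hρ⟩ := P.exists_map_of_free hue he
  let L := LinearMap.range (LinearMap.toSpanSingleton A X e)
  have heL : e ∈ L := ⟨1, one_smul _ _⟩
  have hL0 : L ≠ ⊥ := fun h => by
    rw [h, Submodule.mem_bot] at heL
    exact one_ne_zero (he 1 (by rw [heL, smul_zero]))
  have := hcrit L hL0
  let p := LinearMap.charpoly (Algebra.lsmul k k (X ⧸ L) v)
  have hp0 : p ≠ 0 := (LinearMap.charpoly_monic _).ne_zero
  have hpL : ∀ x : X, aeval v p • x ∈ L := fun x =>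
    (Submodule.Quotient.mk_eq_zero L).1 (aeval_charpoly_smul v (Submodule.Quotient.mk (p := L) x))
  have hcv : ∀ x : X, aeval v p • v • x = v • aeval v p • x := fun x => by
    have : aeval v (p * Polynomial.X) = aeval v (Polynomial.X * p) := by rw [mul_comm]
    rw [map_mul, map_mul, aeval_X] at this
    rw [← mul_smul, this, mul_smul]
  let g : X →ₗ[A] X :=
    { toFun x := aeval v p • x
      map_add' := smul_add _
      map_smul' a x := P.map_smul_of_commute (Algebra.lsmul k k X (aeval v p))
        (fun x => by simp [hu]) hcv a x }
  refine ⟨_, ρ ∘ₗ g.codRestrict L hpL, fun h => P.u_ne_zero (by simpa using h), fun h => ?_⟩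
  have h1 : ρ (g.codRestrict L hpL e) = Submodule.Quotient.mk (aeval v p) := hρ (aeval v p)
  rw [← LinearMap.comp_apply, h, LinearMap.zero_apply, eq_comm,
    Submodule.Quotient.mk_eq_zero] at h1
  obtain ⟨b, hb⟩ := Submodule.mem_span_singleton.1 h1
  refine hp0 (he p ?_)
  rw [← hb, smul_eq_mul, mul_smul, map_zero, sub_zero, hu, smul_zero]

lemma exists_hom_jordan_of_torsion [IsAlgClosed k] [CharZero k] (P : PlaneData k 1 c u v)
    (hc : c ≠ 0) [Module.Finite A X] (hX : ¬ Module.Finite k X)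
    (hcrit : ∀ L : Submodule A X, L ≠ ⊥ → Module.Finite k (X ⧸ L))
    (ht : ∀ x : X, ∃ r : k[X], r ≠ 0 ∧ aeval u r • x = 0) :
    ∃ (a : A) (φ : X →ₗ[A] A ⧸ Submodule.span A {a}), a ≠ 0 ∧ φ ≠ 0 := by
  let U : X →ₗ[k] X := Algebra.lsmul k k X u
  have hvu : ∀ x : X, v • u • x = u • (v • x + c • u • x) := fun x => by
    rw [P.rel_smul, one_smul, smul_add]
    exact congrArg _ (U.map_smul c (u • x)).symm
  have huv : ∀ x : X, u • v • x = v • u • x - c • u • u • x := fun x => by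
    rw [P.rel_smul, one_smul, add_sub_cancel_right]
  let R : Submodule A X := P.ofStable (LinearMap.range U)
    (by rintro _ ⟨x, rfl⟩; exact ⟨u • x, rfl⟩)
    (by rintro _ ⟨x, rfl⟩; exact ⟨_, (hvu x).symm⟩)
  by_cases hR : R = ⊥
  · refine P.exists_hom_of_smul_eq_zero hX hcrit fun x => ?_
    have : u • x ∈ R := ⟨x, rfl⟩
    rwa [hR, Submodule.mem_bot] at this
  have hRfin := hcrit R hR
  let K : Submodule A X := P.ofStable (LinearMap.ker U)
    (fun x (hx : u • x = 0) => show u • u • x = 0 by rw [hx, smul_zero])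
    (fun x (hx : u • x = 0) => show u • v • x = 0 by rw [huv, hx]; simp)
  have hinj : ∀ x : X, u • x = 0 → x = 0 := by
    suffices hK : K = ⊥ by
      intro x hx
      have : x ∈ K := hx
      rwa [hK, Submodule.mem_bot] at this
    by_contra hK
    have hKfin := hcrit K hK
    refine hX ?_
    obtain ⟨g, hg⟩ := (K.mkQ.restrictScalars k).exists_factor_of_surjective K.mkQ_surjective U
      (fun x hx => (Submodule.Quotient.mk_eq_zero K).1 hx)
    have h1 : Module.Finite k (LinearMap.range U) := by
      have : LinearMap.range U = LinearMap.range g := by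
        apply le_antisymm
        · rintro _ ⟨x, rfl⟩
          exact ⟨_, hg x⟩
        · rintro _ ⟨x, rfl⟩
          obtain ⟨x, rfl⟩ := K.mkQ_surjective x
          exact ⟨x, (hg x).symm⟩
      rw [this]
      infer_instance
    obtain ⟨g', hg'⟩ := (R.mkQ.restrictScalars k).exists_factor_of_surjective R.mkQ_surjective
      (LinearMap.range U).mkQ (fun x hx => (Submodule.Quotient.mk_eq_zero _).2
        ((Submodule.Quotient.mk_eq_zero R).1 hx))
    have h2 : Module.Finite k (X ⧸ LinearMap.range U) :=
      Module.Finite.of_surjective g' fun y => by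
        obtain ⟨x, rfl⟩ := Submodule.mkQ_surjective _ y
        exact ⟨_, hg' x⟩
    exact Module.Finite.of_submodule_quotient (LinearMap.range U)
  obtain ⟨x₀, hx₀⟩ : ∃ x : X, x ≠ 0 := by
    by_contra! h
    exact hR (by rw [eq_bot_iff]; intro x _; exact h x)
  obtain ⟨r, hr, hrx⟩ := ht x₀
  obtain ⟨μ, e, he0, he⟩ := IsAlgClosed.exists_eigenvector_smul u hr hx₀ hrx
  have hμ : μ ≠ 0 := by
    rintro rfl
    exact he0 (hinj e (by rw [he, zero_smul]))
  let L := LinearMap.range (LinearMap.toSpanSingleton A X e)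
  have heL : e ∈ L := ⟨1, one_smul _ _⟩
  have huL : ∀ x ∈ L, ∃ y ∈ L, u • y = x := by
    let N : Submodule A X := P.ofStable ((L.restrictScalars k).map U)
      (by rintro _ ⟨x, hx, rfl⟩; exact ⟨u • x, L.smul_mem u hx, rfl⟩)
      (by rintro _ ⟨x, hx, rfl⟩
          exact ⟨v • x + c • u • x, (L.restrictScalars k).add_mem (L.smul_mem v hx)
            ((L.restrictScalars k).smul_mem c (L.smul_mem u hx)), (hvu x).symm⟩)
    have heN : e ∈ N := by
      refine ⟨μ⁻¹ • e, (L.restrictScalars k).smul_mem _ heL, ?_⟩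
      rw [map_smul]
      change μ⁻¹ • u • e = e
      rw [he, smul_smul, inv_mul_cancel₀ hμ, one_smul]
    rintro _ ⟨a, rfl⟩
    exact N.smul_mem a heN
  have hLtop : L = ⊤ := by
    by_contra hne
    have hfin := hcrit L fun h => he0 (by rwa [h, Submodule.mem_bot] at heL)
    have : Nontrivial (X ⧸ L) := Submodule.Quotient.nontrivial_iff.2 hne
    obtain ⟨y₀, hy₀⟩ := exists_ne (0 : X ⧸ L)
    obtain ⟨ν, f, hf0, hf⟩ := IsAlgClosed.exists_eigenvector_smul u
      (LinearMap.charpoly_monic _).ne_zero hy₀ (aeval_charpoly_smul (k := k) u y₀)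
    suffices hν : ν ≠ 0 from
      P.jordan_not_finite (M := X ⧸ L) hc hν hf0 hf hfin
    rintro rfl
    obtain ⟨x, rfl⟩ := L.mkQ_surjective f
    rw [zero_smul] at hf
    obtain ⟨y, hy, hyx⟩ := huL (u • x) ((Submodule.Quotient.mk_eq_zero L).1 hf)
    have : x - y = 0 := hinj _ (by rw [smul_sub, hyx, sub_self])
    refine hf0 ((Submodule.Quotient.mk_eq_zero L).2 ?_)
    rwa [sub_eq_zero.1 this]
  obtain ⟨ρ, hρ⟩ := P.exists_map_of_free he fun p hp => P.jordan_free hc hμ he0 he hp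
  refine ⟨_, ρ ∘ₗ (LinearMap.id : X →ₗ[A] X).codRestrict L (fun x => by rw [hLtop]; trivial),
    fun h0 => ?_, fun h => ?_⟩
  · have h1 := P.rel
    rw [one_smul, show v * u = u * v by rw [sub_eq_zero.1 h0, Algebra.commutes],
      left_eq_add] at h1
    exact P.mul_ne_zero P.u_ne_zero P.u_ne_zero ((smul_eq_zero.1 h1).resolve_left hc)
  · have h1 : ρ ((LinearMap.toSpanSingleton A X e).rangeRestrict 1) = 0 := by
      have h2 := LinearMap.congr_fun h e
      rw [LinearMap.comp_apply, LinearMap.zero_apply] at h2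
      convert h2 using 2
      exact Subtype.ext (one_smul _ _)
    rw [hρ, Submodule.Quotient.mk_eq_zero] at h1
    obtain ⟨b, hb⟩ := Submodule.mem_span_singleton.1 h1
    refine he0 ?_
    rw [← one_smul A e, ← hb, smul_eq_mul, mul_smul, sub_smul, he, algebraMap_smul, sub_self,
      smul_zero]

/-- Over a Jordan plane, an infinite-dimensional finitely generated torsion module has a nonzero
map to a cyclic module with one relation. -/
lemma exists_hom_jordan [IsAlgClosed k] [CharZero k] (P : PlaneData k 1 c u v)
    (hc : c ≠ 0) [Module.Finite A X] (ht : IsTorsionModule A X) (hX : ¬ Module.Finite k X) :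
    ∃ (a : A) (φ : X →ₗ[A] A ⧸ Submodule.span A {a}), a ≠ 0 ∧ φ ≠ 0 := by
  by_cases h1 : P.uTorsion X = ⊤
  · obtain ⟨N, hN, hcrit⟩ := P.exists_critical_quotient hX
    obtain ⟨a, φ, ha, hφ⟩ := P.exists_hom_jordan_of_torsion hc hN hcrit fun y => by
      obtain ⟨x, rfl⟩ := N.mkQ_surjective y
      obtain ⟨r, hr, h⟩ := P.exists_aeval_of_mem_uTorsion (m := x) (by rw [h1]; trivial)
      exact ⟨r, hr, by rw [← map_smul, h, map_zero]⟩
    refine ⟨a, φ ∘ₗ N.mkQ, ha, fun h => hφ ?_⟩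
    refine LinearMap.ext fun y => ?_
    obtain ⟨x, rfl⟩ := N.mkQ_surjective y
    exact LinearMap.congr_fun h x
  · exact P.exists_hom_of_not_uTorsion ht h1

end PlaneData

/-- A map over a projective module lifts along an exact sequence. -/
lemma Function.Exact.exists_lift {R P X Y Z : Type*} [Ring R] [AddCommGroup P] [AddCommGroup X]
    [AddCommGroup Y] [AddCommGroup Z] [Module R P] [Module R X] [Module R Y] [Module R Z]
    [Module.Projective R P] {d : X →ₗ[R] Y} {e : Y →ₗ[R] Z} (h : Function.Exact d e)
    (f : P →ₗ[R] Y) (hf : ∀ x, e (f x) = 0) : ∃ g : P →ₗ[R] X, ∀ x, d (g x) = f x := by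
  obtain ⟨g, hg⟩ := Module.projective_lifting_property d.rangeRestrict
    (f.codRestrict (LinearMap.range d) fun x => (h _).1 (hf x)) d.surjective_rangeRestrict
  exact ⟨g, fun x => congrArg Subtype.val (LinearMap.congr_fun hg x)⟩

namespace PlaneData

variable {k A : Type*} [Field k] [Ring A] [Algebra k A] {q c : k} {u v : A}
  (P : PlaneData k q c u v)

include P in
lemma exists_right_denominator {ι : Type*} [Finite ι] (a b : ι → A) (ha : ∀ i, a i ≠ 0) :
    ∃ (d : A) (x : ι → A), d ≠ 0 ∧ ∀ i, b i * d = a i * x i := by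
  classical
  have := P.nontrivial
  have := P.noZeroDivisors
  have := Fintype.ofFinite ι
  suffices h : ∀ s : Finset ι, ∃ d : A, d ≠ 0 ∧ ∀ i ∈ s, ∃ x, b i * d = a i * x by
    obtain ⟨d, hd, h⟩ := h Finset.univ
    choose x hx using fun i => h i (Finset.mem_univ i)
    exact ⟨d, x, hd, hx⟩
  intro s
  induction s using Finset.induction_on with
  | empty => exact ⟨1, one_ne_zero, by simp⟩
  | insert i s _ ih =>
    obtain ⟨d, hd, h⟩ := ih
    by_cases h0 : b i * d = 0
    · refine ⟨d, hd, fun j hj => ?_⟩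
      rcases Finset.mem_insert.1 hj with rfl | hj
      · exact ⟨0, by rw [h0, mul_zero]⟩
      · exact h j hj
    · obtain ⟨e, x, he, -, hx⟩ := P.exists_right_common h0 (ha i)
      refine ⟨d * e, _root_.mul_ne_zero hd he, fun j hj => ?_⟩
      rcases Finset.mem_insert.1 hj with rfl | hj
      · exact ⟨x, by rw [← mul_assoc, hx]⟩
      · obtain ⟨y, hy⟩ := h j hj
        exact ⟨y * e, by rw [← mul_assoc, hy, mul_assoc]⟩

include P in
lemma exists_left_denominator {ι : Type*} [Finite ι] (a b : ι → A) (ha : ∀ i, a i ≠ 0) :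
    ∃ (d : A) (x : ι → A), d ≠ 0 ∧ ∀ i, d * b i = x i * a i := by
  obtain ⟨d, x, hd, h⟩ := P.op.exists_right_denominator (fun i => MulOpposite.op (a i))
    (fun i => MulOpposite.op (b i)) fun i => (MulOpposite.op_ne_zero_iff _).2 (ha i)
  exact ⟨d.unop, fun i => (x i).unop, (MulOpposite.unop_ne_zero_iff _).2 hd,
    fun i => by simpa using congrArg MulOpposite.unop (h i)⟩

variable {M : Type*} [AddCommGroup M] [Module A M]

include P in
/-- A finitely generated module without nonzero functionals is torsion. -/
theorem isTorsionModule_of_forall_eq_zero [Module.Finite A M] (h : ∀ φ : M →ₗ[A] A, φ = 0) :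
    IsTorsionModule A M := by
  have := P.isNoetherianRing
  have := P.nontrivial
  have := P.noZeroDivisors
  intro m
  by_contra! hm
  obtain ⟨L, hL, hmax⟩ := set_has_maximal_iff_noetherian.2 (inferInstance : IsNoetherian A M)
    {L : Submodule A M | ∀ a : A, a • m ∈ L → a = 0} ⟨⊥, fun a ha => by
      by_contra h0; exact hm a h0 ((Submodule.mem_bot A).1 ha)⟩
  have key : ∀ x : M, ∃ a b : A, a ≠ 0 ∧ a • x - b • m ∈ L := by
    intro x
    by_cases hx : x ∈ L
    · exact ⟨1, 0, one_ne_zero, by simpa using hx⟩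
    have hlt : L < L ⊔ Submodule.span A {x} := lt_of_le_of_ne le_sup_left fun h => hx (by
      rw [h]; exact Submodule.mem_sup_right (Submodule.mem_span_singleton_self x))
    obtain ⟨b, hb, hb0⟩ : ∃ b : A, b • m ∈ L ⊔ Submodule.span A {x} ∧ b ≠ 0 := by
      by_contra! hh
      exact hmax _ hh hlt
    obtain ⟨l, hl, y, hy, hly⟩ := Submodule.mem_sup.1 hb
    obtain ⟨a, rfl⟩ := Submodule.mem_span_singleton.1 hy
    refine ⟨a, b, fun h0 => hb0 (hL b ?_), ?_⟩
    · rw [← hly, h0, zero_smul, add_zero]; exact hl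
    · rw [← hly]; simpa using hl
  obtain ⟨n, π, hπ⟩ := Module.Finite.exists_fin' A M
  choose a b ha hab using fun i => key (π (Pi.single i 1))
  obtain ⟨d, x, hd, hx⟩ := P.exists_right_denominator a b ha
  have hlin : ∀ (y : Fin n → A) (e : A), π y - e • m ∈ L →
      Fintype.linearCombination A x y = e * d := by
    intro y e hy
    obtain ⟨s, t, hs, hst⟩ := P.exists_left_denominator a y ha
    have h1 : s • π y - (∑ i, t i * b i) • m ∈ L := by
      have : s • π y - (∑ i, t i * b i) • m = ∑ i, t i • (a i • π (Pi.single i 1) - b i • m) := by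
        have hy : y = ∑ i, y i • Pi.single i (1 : A) := pi_eq_sum_univ' y
        conv_lhs => rw [hy]
        simp only [map_sum, map_smul, Finset.smul_sum, smul_sub, Finset.sum_sub_distrib,
          Finset.sum_smul, ← mul_smul, hst]
      rw [this]
      exact L.sum_mem fun i _ => L.smul_mem _ (hab i)
    have h2 : s * e - ∑ i, t i * b i = 0 := hL _ (by
      have := L.sub_mem h1 (L.smul_mem s hy)
      rwa [smul_sub, sub_sub_sub_cancel_left, ← mul_smul, ← sub_smul] at this)
    refine mul_left_cancel₀ hs ?_
    rw [← mul_assoc, sub_eq_zero.1 h2, Fintype.linearCombination_apply, Finset.mul_sum,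
      Finset.sum_mul]
    refine Finset.sum_congr rfl fun i _ => ?_
    rw [smul_eq_mul, ← mul_assoc, hst, mul_assoc, mul_assoc, hx]
  obtain ⟨φ, hφ⟩ := π.exists_factor_of_surjective hπ (Fintype.linearCombination A x)
    fun y hy => by rw [hlin y 0 (by simp [hy]), zero_mul]
  obtain ⟨y, rfl⟩ := hπ m
  have h1 := hφ y
  rw [h φ, hlin y 1 (by simp), one_mul] at h1
  exact hd h1.symm

include P in
lemma eq_zero_of_isTorsionModule (ht : IsTorsionModule A M) (φ : M →ₗ[A] A) : φ = 0 := by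
  have := P.noZeroDivisors
  ext m
  obtain ⟨a, ha, h⟩ := ht m
  have h1 := φ.map_smul a m
  rw [h, map_zero, smul_eq_mul] at h1
  exact (mul_eq_zero.1 h1.symm).resolve_left ha

include P in
/-- A nonzero map from a torsion module to a cyclic module with one relation gives a non-split
extension. -/
lemma exists_not_extension [Module.Finite A M] (ht : IsTorsionModule A M) {a : A} (ha : a ≠ 0)
    {φ : M →ₗ[A] A ⧸ Submodule.span A {a}} (hφ : φ ≠ 0) :
    ∃ (n : ℕ) (π : (Fin n → A) →ₗ[A] M) (f : LinearMap.ker π →ₗ[A] A),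
      Function.Surjective π ∧ ∀ F : (Fin n → A) →ₗ[A] A, ∃ x : LinearMap.ker π, F x ≠ f x := by
  have := P.noZeroDivisors
  obtain ⟨n, π, hπ⟩ := Module.Finite.exists_fin' A M
  obtain ⟨Φ, hΦ⟩ := Module.projective_lifting_property (Submodule.span A {a}).mkQ (φ ∘ₗ π)
    (Submodule.mkQ_surjective _)
  replace hΦ : ∀ x, Submodule.Quotient.mk (Φ x) = φ (π x) := LinearMap.congr_fun hΦ
  have h1 : ∀ x : LinearMap.ker π, ∃ b : A, b * a = Φ x := fun x =>
    Submodule.mem_span_singleton.1 ((Submodule.Quotient.mk_eq_zero _).1 (by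
      rw [hΦ, LinearMap.mem_ker.1 x.2, map_zero]))
  choose f hf using h1
  refine ⟨n, π, { toFun := f, map_add' := fun x y => ?_, map_smul' := fun b x => ?_ }, hπ,
    fun F => ?_⟩
  · refine mul_right_cancel₀ ha ?_
    rw [add_mul, hf, hf, hf, Submodule.coe_add, map_add]
  · refine mul_right_cancel₀ ha ?_
    rw [RingHom.id_apply, smul_eq_mul, mul_assoc, hf, hf, Submodule.coe_smul, Φ.map_smul,
      smul_eq_mul]
  · by_contra! h
    refine hφ (LinearMap.ext fun m => ?_)
    obtain ⟨x, rfl⟩ := hπ m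
    rw [← hΦ, LinearMap.zero_apply, Submodule.Quotient.mk_eq_zero]
    obtain ⟨b, hb, hbx⟩ := ht (π x)
    have h2 : F (b • x) * a = Φ (b • x) := by
      have hk : b • x ∈ LinearMap.ker π := by rw [LinearMap.mem_ker, map_smul, hbx]
      rw [← hf ⟨_, hk⟩]
      exact congrArg (· * a) (h ⟨_, hk⟩)
    rw [F.map_smul, Φ.map_smul, smul_eq_mul, smul_eq_mul, mul_assoc] at h2
    exact Submodule.mem_span_singleton.2 ⟨F x, mul_left_cancel₀ hb h2⟩

end PlaneData

namespace PlaneData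

variable {k A : Type*} [Field k] [Ring A] [Algebra k A] {q c : k} {u v : A}
  (P : PlaneData k q c u v) {M : Type*} [AddCommGroup M] [Module A M]
  {X₀ X₁ X₂ X₃ : Type*} [AddCommGroup X₀] [AddCommGroup X₁] [AddCommGroup X₂] [AddCommGroup X₃]
  [Module A X₀] [Module A X₁] [Module A X₂] [Module A X₃]
  {d₃ : X₃ →ₗ[A] X₂} {d₂ : X₂ →ₗ[A] X₁} {d₁ : X₁ →ₗ[A] X₀} {ε : X₀ →ₗ[A] M}

include P in
lemma exists_not_factor_one [Module.Finite A M] [Module.Projective A X₀]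
    (hε : Function.Surjective ε) (h₁ : Function.Exact d₁ ε) (h₂ : Function.Exact d₂ d₁)
    (ht : IsTorsionModule A M) {a : A} (ha : a ≠ 0) {φ : M →ₗ[A] A ⧸ Submodule.span A {a}}
    (hφ : φ ≠ 0) : ∃ ψ : X₁ →ₗ[A] A, ψ ∘ₗ d₂ = 0 ∧ ∀ θ : X₀ →ₗ[A] A, θ ∘ₗ d₁ ≠ ψ := by
  obtain ⟨n, π, f, hπ, hf⟩ := P.exists_not_extension ht ha hφ
  obtain ⟨h, hh⟩ := Module.projective_lifting_property π ε hπ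
  obtain ⟨g, hg⟩ := Module.projective_lifting_property ε π hε
  replace hh : ∀ x, π (h x) = ε x := LinearMap.congr_fun hh
  replace hg : ∀ x, ε (g x) = π x := LinearMap.congr_fun hg
  let h' : X₁ →ₗ[A] LinearMap.ker π := (h ∘ₗ d₁).codRestrict _ fun x => by
    rw [LinearMap.mem_ker, LinearMap.comp_apply, hh, h₁.apply_apply_eq_zero]
  refine ⟨f ∘ₗ h', ?_, fun θ hθ => ?_⟩
  · ext x
    have : h' (d₂ x) = 0 := Subtype.ext (by
      change h (d₁ (d₂ x)) = 0
      rw [h₂.apply_apply_eq_zero, map_zero])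
    rw [LinearMap.comp_apply, LinearMap.comp_apply, this, map_zero, LinearMap.zero_apply]
  · let e : (Fin n → A) →ₗ[A] LinearMap.ker π :=
      (LinearMap.id - h ∘ₗ g).codRestrict _ fun x => by
        rw [LinearMap.mem_ker, LinearMap.sub_apply, map_sub, LinearMap.comp_apply, hh, hg,
          LinearMap.id_apply, sub_self]
    obtain ⟨x, hx⟩ := hf (f ∘ₗ e + θ ∘ₗ g)
    refine hx ?_
    obtain ⟨y, hy⟩ := (h₁ (g x)).1 (by rw [hg]; exact x.2)
    have h3 : e x + h' y = x := Subtype.ext (by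
      change (x : Fin n → A) - h (g x) + h (d₁ y) = x
      rw [hy, sub_add_cancel])
    have h4 : θ (g x) = f (h' y) := by rw [← hy]; exact LinearMap.congr_fun hθ y
    rw [LinearMap.add_apply, LinearMap.comp_apply, LinearMap.comp_apply, h4, ← map_add, h3]

include P in
lemma exists_factor_one [Module k M] [IsScalarTower k A M] [Module.Finite k M]
    (hε : Function.Surjective ε) (h₁ : Function.Exact d₁ ε) (h₂ : Function.Exact d₂ d₁)
    (ψ : X₁ →ₗ[A] A) (hψ : ψ ∘ₗ d₂ = 0) : ∃ θ : X₀ →ₗ[A] A, θ ∘ₗ d₁ = ψ := by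
  let _ := Module.compHom X₀ (algebraMap k A)
  have : IsScalarTower k A X₀ := ⟨fun r a x => by
    rw [Algebra.smul_def, mul_smul]; rfl⟩
  let d : X₁ →ₗ[A] LinearMap.ker ε := d₁.codRestrict _ h₁.apply_apply_eq_zero
  obtain ⟨f, hf⟩ := d.exists_factor_of_surjective
    (fun x => by
      obtain ⟨y, hy⟩ := (h₁ x).1 x.2
      exact ⟨y, Subtype.ext hy⟩) ψ
    (fun x hx => by
      obtain ⟨y, rfl⟩ := (h₂ x).1 (congrArg Subtype.val hx)
      exact LinearMap.congr_fun hψ y)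
  obtain ⟨F, hF⟩ := P.exists_extension_of_finite ε hε f
  exact ⟨F, LinearMap.ext fun x => (hF (d x)).trans (hf x)⟩

include P in
lemma exists_not_factor_two [Module k M] [IsScalarTower k A M] [Module.Finite k M] [Nontrivial M]
    [Module.Projective A X₀] [Module.Projective A X₁] [Module.Projective A X₂]
    (hε : Function.Surjective ε) (h₁ : Function.Exact d₁ ε) (h₂ : Function.Exact d₂ d₁)
    (h₃ : Function.Exact d₃ d₂) :
    ∃ ψ : X₂ →ₗ[A] A, ψ ∘ₗ d₃ = 0 ∧ ∀ θ : X₁ →ₗ[A] A, θ ∘ₗ d₂ ≠ ψ := by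
  obtain ⟨n, e₂, e₁, η, ζ, hη, k₁, k₂, hinj, hζ⟩ := P.exists_koszul M
  obtain ⟨f₀, hf₀⟩ := Module.projective_lifting_property η ε hη
  replace hf₀ : ∀ x, η (f₀ x) = ε x := LinearMap.congr_fun hf₀
  obtain ⟨f₁, hf₁⟩ := k₁.exists_lift (f₀ ∘ₗ d₁) fun x => by
    rw [LinearMap.comp_apply, hf₀, h₁.apply_apply_eq_zero]
  obtain ⟨f₂, hf₂⟩ := k₂.exists_lift (f₁ ∘ₗ d₂) fun x => by
    rw [LinearMap.comp_apply, hf₁, LinearMap.comp_apply, h₂.apply_apply_eq_zero, map_zero]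
  obtain ⟨g₀, hg₀⟩ := Module.projective_lifting_property ε η hε
  replace hg₀ : ∀ x, ε (g₀ x) = η x := LinearMap.congr_fun hg₀
  obtain ⟨g₁, hg₁⟩ := h₁.exists_lift (g₀ ∘ₗ e₁) fun x => by
    rw [LinearMap.comp_apply, hg₀, k₁.apply_apply_eq_zero]
  obtain ⟨g₂, hg₂⟩ := h₂.exists_lift (g₁ ∘ₗ e₂) fun x => by
    rw [LinearMap.comp_apply, hg₁, LinearMap.comp_apply, k₂.apply_apply_eq_zero, map_zero]
  obtain ⟨s₀, hs₀⟩ := k₁.exists_lift (LinearMap.id - f₀ ∘ₗ g₀) fun x => by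
    simp [hf₀, hg₀]
  obtain ⟨s₁, hs₁⟩ := k₂.exists_lift (LinearMap.id - f₁ ∘ₗ g₁ - s₀ ∘ₗ e₁) fun x => by
    simp [hs₀, hf₁, hg₁]
  simp only [LinearMap.comp_apply, LinearMap.sub_apply, LinearMap.id_apply] at *
  refine ⟨ζ ∘ₗ f₂, ?_, fun θ hθ => hζ (ζ ∘ₗ s₁ + θ ∘ₗ g₁) ?_⟩
  · ext x
    have : f₂ (d₃ x) = 0 := hinj (by rw [hf₂, h₃.apply_apply_eq_zero, map_zero, map_zero])
    rw [LinearMap.comp_apply, LinearMap.comp_apply, this, map_zero, LinearMap.zero_apply]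
  · refine LinearMap.ext fun x => ?_
    have h4 : x - f₂ (g₂ x) = s₁ (e₂ x) := hinj (by
      rw [map_sub, hf₂, hg₂, hs₁, k₂.apply_apply_eq_zero, map_zero, sub_zero])
    have h5 : θ (g₁ (e₂ x)) = ζ (f₂ (g₂ x)) := by
      rw [← hg₂]; exact LinearMap.congr_fun hθ (g₂ x)
    rw [LinearMap.comp_apply, LinearMap.add_apply, LinearMap.comp_apply, LinearMap.comp_apply, h5,
      ← h4, map_sub, sub_add_cancel]

end PlaneData

namespace PlaneData

variable {k A : Type*} [Field k] [Ring A] [Algebra k A] {q c : k}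

lemma shiftCoeff_succ' (q c : k) (i : ℕ) : shiftCoeff q c (i + 1) = q * shiftCoeff q c i + c := by
  induction i with
  | zero => simp [shiftCoeff]
  | succ i ih => simp only [shiftCoeff] at ih ⊢; linear_combination ih

/-- The action of the first variable on the space with basis the ordered monomials. -/
noncomputable def shiftU (k : Type*) [Field k] : Module.End k (ℕ × ℕ →₀ k) :=
  Finsupp.lmapDomain k k fun p => (p.1 + 1, p.2)

/-- The action of the second variable on the space with basis the ordered monomials. -/
noncomputable def shiftV (q c : k) : Module.End k (ℕ × ℕ →₀ k) :=
  Finsupp.linearCombination k fun p => Finsupp.single (p.1, p.2 + 1) (q ^ p.1) +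
    Finsupp.single (p.1 + 1, p.2) (shiftCoeff q c p.1)

lemma shiftU_single (i j : ℕ) (a : k) :
    shiftU k (Finsupp.single (i, j) a) = Finsupp.single (i + 1, j) a := by
  simp [shiftU, Finsupp.lmapDomain_apply, Finsupp.mapDomain_single]

lemma shiftV_single (i j : ℕ) (a : k) :
    shiftV q c (Finsupp.single (i, j) a) = Finsupp.single (i, j + 1) (a * q ^ i) +
      Finsupp.single (i + 1, j) (a * shiftCoeff q c i) := by
  simp [shiftV, Finsupp.linearCombination_single]

lemma shift_rel (q c : k) :
    shiftV q c * shiftU k = q • (shiftU k * shiftV q c) + c • (shiftU k * shiftU k) := by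
  refine Finsupp.lhom_ext fun ⟨i, j⟩ a => ?_
  simp only [Module.End.mul_apply, LinearMap.add_apply, LinearMap.smul_apply, shiftU_single,
    shiftV_single, map_add, smul_add, Finsupp.smul_single, smul_eq_mul, shiftCoeff_succ', add_assoc,
    ← Finsupp.single_add]
  congr 2 <;> ring

lemma shift_pow_single (i j : ℕ) :
    (shiftU k ^ i * shiftV q c ^ j) (Finsupp.single (0, 0) 1) = Finsupp.single (i, j) 1 := by
  have hV : (shiftV q c ^ j) (Finsupp.single (0, 0) 1) = Finsupp.single (0, j) 1 := by
    induction j with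
    | zero => simp
    | succ j ih => rw [pow_succ', Module.End.mul_apply, ih, shiftV_single]; simp [shiftCoeff]
  rw [Module.End.mul_apply, hV]
  induction i with
  | zero => simp
  | succ i ih => rw [pow_succ', Module.End.mul_apply, ih, shiftU_single]

theorem of_presentation (hq : q ≠ 0) (π : FreeAlgebra k (Fin 2) →ₐ[k] A)
    (hπ : Function.Surjective π) {u v : A} (hu : π (FreeAlgebra.ι k 0) = u)
    (hv : π (FreeAlgebra.ι k 1) = v) (rel : v * u = q • (u * v) + c • (u * u))
    (ρ : A →ₐ[k] Module.End k (ℕ × ℕ →₀ k)) (hρu : ρ u = shiftU k) (hρv : ρ v = shiftV q c) :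
    PlaneData k q c u v where
  q_ne := hq
  rel := rel
  li := by
    refine LinearIndependent.of_comp (LinearMap.applyₗ (Finsupp.single (0, 0) (1 : k)) ∘ₗ
      ρ.toLinearMap) ?_
    convert (Finsupp.basisSingleOne (R := k) (ι := ℕ × ℕ)).linearIndependent using 1
    funext p
    simp [hρu, hρv, shift_pow_single, -Module.End.mul_apply]
  span := by
    intro x _
    set N := Submodule.span k (Set.range fun p : ℕ × ℕ => u ^ p.1 * v ^ p.2) with hN
    have hmem : ∀ i j : ℕ, u ^ i * v ^ j ∈ N := fun i j => Submodule.subset_span ⟨(i, j), rfl⟩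
    have huN : N ≤ N.comap (LinearMap.mulLeft k u) := by
      rw [hN, Submodule.span_le, ← hN]
      rintro _ ⟨p, rfl⟩
      change u * (u ^ p.1 * v ^ p.2) ∈ N
      rw [← mul_assoc, ← pow_succ']
      exact hmem _ _
    have hvN : N ≤ N.comap (LinearMap.mulLeft k v) := by
      rw [hN, Submodule.span_le, ← hN]
      rintro _ ⟨p, rfl⟩
      change v * (u ^ p.1 * v ^ p.2) ∈ N
      rw [← mul_assoc, mul_pow_of_rel rel, add_mul, smul_mul_assoc, smul_mul_assoc, mul_assoc,
        ← pow_succ']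
      exact N.add_mem (N.smul_mem _ (hmem _ _)) (N.smul_mem _ (hmem _ _))
    obtain ⟨y, rfl⟩ := hπ x
    suffices h : ∀ n ∈ N, π y * n ∈ N by simpa using h 1 (by simpa using hmem 0 0)
    induction y using FreeAlgebra.induction with
    | grade0 r =>
      intro n hn
      rw [AlgHom.commutes, ← Algebra.smul_def]
      exact N.smul_mem _ hn
    | grade1 i =>
      intro n hn
      fin_cases i
      · change π (FreeAlgebra.ι k 0) * n ∈ N
        rw [hu]; exact huN hn
      · change π (FreeAlgebra.ι k 1) * n ∈ N
        rw [hv]; exact hvN hn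
    | mul a b ha hb =>
      intro n hn
      rw [map_mul, mul_assoc]
      exact ha trivial _ (hb trivial _ hn)
    | add a b ha hb =>
      intro n hn
      rw [map_add, add_mul]
      exact N.add_mem (ha trivial _ hn) (hb trivial _ hn)

theorem quantumPlane (hq : q ≠ 0) : PlaneData k q 0 (qU k q) (qV k q) := by
  let f : {f : FreeAlgebra k (Fin 2) →ₐ[k] Module.End k (ℕ × ℕ →₀ k) //
      ∀ ⦃x y⦄, QuantumRel k q x y → f x = f y} :=
    ⟨FreeAlgebra.lift k ![shiftU k, shiftV q 0], by
      rintro _ _ ⟨⟩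
      simpa using shift_rel q 0⟩
  refine of_presentation hq (RingQuot.mkAlgHom k (QuantumRel k q))
    (RingQuot.mkAlgHom_surjective k _) rfl rfl ?_ (RingQuot.liftAlgHom k f) ?_ ?_
  · have := RingQuot.mkAlgHom_rel k (QuantumRel.rel (K := k) (q := q))
    simpa [qU, qV] using this
  · exact (RingQuot.liftAlgHom_mkAlgHom_apply k _ _ _).trans (by simp)
  · exact (RingQuot.liftAlgHom_mkAlgHom_apply k _ _ _).trans (by simp)

theorem jordanPlane : PlaneData k 1 1 (jU k) (jV k) := by
  let f : {f : FreeAlgebra k (Fin 2) →ₐ[k] Module.End k (ℕ × ℕ →₀ k) //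
      ∀ ⦃x y⦄, JordanRel k x y → f x = f y} :=
    ⟨FreeAlgebra.lift k ![shiftU k, shiftV 1 1], by
      rintro _ _ ⟨⟩
      simpa using shift_rel (1 : k) 1⟩
  refine of_presentation one_ne_zero (RingQuot.mkAlgHom k (JordanRel k))
    (RingQuot.mkAlgHom_surjective k _) rfl rfl ?_ (RingQuot.liftAlgHom k f) ?_ ?_
  · have := RingQuot.mkAlgHom_rel k (JordanRel.rel (K := k))
    simpa [jU, jV] using this
  · exact (RingQuot.liftAlgHom_mkAlgHom_apply k _ _ _).trans (by simp)
  · exact (RingQuot.liftAlgHom_mkAlgHom_apply k _ _ _).trans (by simp)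

end PlaneData

/-- A skew group ring `T = A # G`, viewed as a left module over its coefficient ring, together with
two elements of `A` whose span is stable under the action. -/
structure SkewData (k : Type*) {A : Type*} (G T : Type*) [Field k] [Ring A] [Algebra k A] [Group G]
    [Fintype G] [Ring T] [Algebra k T] [Module A T] (u v : A) where
  ι : A →ₐ[k] T
  j : G → T
  act : G → A →ₐ[k] A
  smul_eq : ∀ (a : A) (t : T), a • t = ι a * t
  j_one : j 1 = 1
  j_mul : ∀ g h, j g * j h = j (g * h)
  comm : ∀ g a, j g * ι a = ι (act g a) * j g
  existsUnique : ∀ t, ∃! c : G → A, t = ∑ g, ι (c g) * j g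
  act_u : ∀ g, act g u ∈ Submodule.span k {u, v}
  act_v : ∀ g, act g v ∈ Submodule.span k {u, v}

namespace SkewData

variable {k A G T : Type*} [Field k] [Ring A] [Algebra k A] [Group G] [Fintype G] [Ring T]
  [Algebra k T] [Module A T] {u v : A} (S : SkewData k G T u v)

/-- The coefficients of an element of the skew group ring. -/
noncomputable def equiv : (G → A) ≃ₗ[A] T :=
  LinearEquiv.ofBijective (Fintype.linearCombination A S.j) <| by
    refine (Function.bijective_iff_existsUnique _).2 fun t => ?_
    simpa only [Fintype.linearCombination_apply, S.smul_eq, eq_comm] using S.existsUnique t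

lemma equiv_apply (c : G → A) : S.equiv c = ∑ g, S.ι (c g) * S.j g := by
  simp only [equiv, LinearEquiv.ofBijective_apply, Fintype.linearCombination_apply, S.smul_eq]

lemma sum_equiv_symm (t : T) : ∑ g, S.ι (S.equiv.symm t g) * S.j g = t := by
  rw [← equiv_apply, LinearEquiv.apply_symm_apply]

lemma equiv_symm_single [DecidableEq G] (a : A) (g : G) :
    S.equiv.symm (S.ι a * S.j g) = Pi.single g a := by
  rw [LinearEquiv.symm_apply_eq, equiv_apply, Finset.sum_eq_single g]
  · rw [Pi.single_eq_same]
  · intro h _ hne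
    rw [Pi.single_eq_of_ne hne, map_zero, zero_mul]
  · simp

lemma j_mul_inv (g : G) : S.j g * S.j g⁻¹ = 1 := by rw [S.j_mul, mul_inv_cancel, S.j_one]

lemma ι_injective : Function.Injective S.ι := by
  classical
  intro a b hab
  have h := S.equiv_symm_single a 1
  rw [hab, S.equiv_symm_single] at h
  exact (Pi.single_injective (M := fun _ => A) 1 h).symm

lemma ι_act (g : G) (a : A) : S.ι (S.act g a) = S.j g * S.ι a * S.j g⁻¹ := by
  rw [S.comm, mul_assoc, S.j_mul_inv, mul_one]

lemma act_mul (g h : G) (a : A) : S.act (g * h) a = S.act g (S.act h a) := by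
  apply S.ι_injective
  rw [S.ι_act, S.ι_act, S.ι_act, mul_inv_rev, ← S.j_mul, ← S.j_mul]
  simp only [mul_assoc]

lemma act_one (a : A) : S.act 1 a = a := by
  apply S.ι_injective
  rw [S.ι_act, inv_one, S.j_one, one_mul, mul_one]

lemma act_inv_act (g : G) (a : A) : S.act g⁻¹ (S.act g a) = a := by
  rw [← S.act_mul, inv_mul_cancel, S.act_one]

lemma act_act_inv (g : G) (a : A) : S.act g (S.act g⁻¹ a) = a := by
  rw [← S.act_mul, mul_inv_cancel, S.act_one]

lemma equiv_symm_j_mul (h : G) (t : T) (g : G) :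
    S.equiv.symm (S.j h * t) g = S.act h (S.equiv.symm t (h⁻¹ * g)) := by
  suffices hs : S.equiv.symm (S.j h * t) = fun g => S.act h (S.equiv.symm t (h⁻¹ * g)) by rw [hs]
  rw [LinearEquiv.symm_apply_eq, equiv_apply]
  conv_lhs => rw [← S.sum_equiv_symm t, Finset.mul_sum]
  refine Fintype.sum_equiv (Equiv.mulLeft h) _ _ fun g => ?_
  rw [← mul_assoc, S.comm, Equiv.coe_mulLeft, inv_mul_cancel_left, mul_assoc, S.j_mul]

include S in
lemma isScalarTower : IsScalarTower A T T :=
  ⟨fun a t s => by rw [smul_eq_mul, S.smul_eq, smul_eq_mul, S.smul_eq, mul_assoc]⟩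

include S in
lemma finite : Module.Finite A T := Module.Finite.equiv S.equiv

include S in
lemma free : Module.Free A T := Module.Free.of_equiv S.equiv

include S in
lemma isNoetherianRing [IsNoetherianRing A] : IsNoetherianRing T := by
  have := S.isScalarTower
  have := S.finite
  exact isNoetherian_of_tower A (inferInstance : IsNoetherian A T)

lemma map_smul_of_generators {X Y : Type*} [AddCommGroup X] [Module T X] [AddCommGroup Y]
    [Module T Y] (f : X →+ Y) (hι : ∀ a x, f (S.ι a • x) = S.ι a • f x)
    (hj : ∀ g x, f (S.j g • x) = S.j g • f x) (t : T) (x : X) : f (t • x) = t • f x := by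
  rw [← S.sum_equiv_symm t, Finset.sum_smul, map_sum, Finset.sum_smul]
  refine Finset.sum_congr rfl fun g _ => ?_
  rw [mul_smul, mul_smul, hι, hj]

section Modules

variable {X Y Z : Type*} [AddCommGroup X] [Module T X] [Module A X] [IsScalarTower A T X]
  [AddCommGroup Y] [Module T Y] [Module A Y] [IsScalarTower A T Y]
  [AddCommGroup Z] [Module T Z] [Module A Z] [IsScalarTower A T Z]

lemma ι_smul (a : A) (x : X) : S.ι a • x = a • x := by
  rw [← mul_one (S.ι a), ← S.smul_eq, smul_assoc, one_smul]

include S in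
lemma finite_restrict [Module.Finite T X] : Module.Finite A X := by
  have := S.finite
  exact Module.Finite.trans T X

include S in
lemma projective_restrict [Module.Projective T X] : Module.Projective A X := by
  obtain ⟨s, hs⟩ := Module.projective_def'.1 (inferInstance : Module.Projective T X)
  have := S.free
  have := S.isScalarTower
  exact Module.Projective.of_split (s.restrictScalars A)
    ((Finsupp.linearCombination T id).restrictScalars A)
    (LinearMap.ext fun x => LinearMap.congr_fun hs x)

/-- The functional over the coefficient ring underlying a functional. -/
noncomputable def resHom (f : X →ₗ[T] T) : X →ₗ[A] A where
  toFun x := S.equiv.symm (f x) 1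
  map_add' x y := by rw [map_add, map_add, Pi.add_apply]
  map_smul' a x := by
    rw [← S.ι_smul, f.map_smul, smul_eq_mul, ← S.smul_eq, S.equiv.symm.map_smul, Pi.smul_apply,
      RingHom.id_apply]

lemma resHom_apply (f : X →ₗ[T] T) (x : X) : S.resHom f x = S.equiv.symm (f x) 1 := rfl

/-- The functional induced by a functional over the coefficient ring. -/
noncomputable def indHom (φ : X →ₗ[A] A) : X →ₗ[T] T :=
  have := S.isScalarTower
  let f : X →+ T :=
    { toFun x := ∑ g, S.j g * S.ι (φ (S.j g⁻¹ • x))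
      map_zero' := by simp
      map_add' x y := by
        simp only [smul_add, map_add, mul_add, Finset.sum_add_distrib] }
  { f with
    map_smul' := S.map_smul_of_generators f
      (fun a x => by
        change ∑ g, S.j g * S.ι (φ (S.j g⁻¹ • S.ι a • x)) =
          S.ι a * ∑ g, S.j g * S.ι (φ (S.j g⁻¹ • x))
        rw [Finset.mul_sum]
        refine Finset.sum_congr rfl fun g _ => ?_
        rw [← mul_smul, S.comm g⁻¹ a, mul_smul, S.ι_smul, φ.map_smul, smul_eq_mul, map_mul,
          ← mul_assoc, S.comm, S.act_act_inv, mul_assoc])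
      (fun h x => by
        change ∑ g, S.j g * S.ι (φ (S.j g⁻¹ • S.j h • x)) =
          S.j h * ∑ g, S.j g * S.ι (φ (S.j g⁻¹ • x))
        rw [Finset.mul_sum]
        refine Fintype.sum_equiv (Equiv.mulLeft h⁻¹) _ _ fun g => ?_
        rw [← mul_smul, S.j_mul, Equiv.coe_mulLeft, ← mul_assoc, S.j_mul, mul_inv_cancel_left,
          mul_inv_rev, inv_inv]) }

lemma indHom_apply (φ : X →ₗ[A] A) (x : X) :
    S.indHom φ x = ∑ g, S.j g * S.ι (φ (S.j g⁻¹ • x)) := rfl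

lemma indHom_resHom (f : X →ₗ[T] T) : S.indHom (S.resHom f) = f := by
  refine LinearMap.ext fun x => ?_
  rw [indHom_apply]
  conv_rhs => rw [← S.sum_equiv_symm (f x)]
  refine Finset.sum_congr rfl fun g _ => ?_
  rw [resHom_apply, f.map_smul, smul_eq_mul, S.equiv_symm_j_mul, inv_inv, mul_one, S.comm,
    S.act_act_inv]

lemma resHom_indHom (φ : X →ₗ[A] A) : S.resHom (S.indHom φ) = φ := by
  classical
  refine LinearMap.ext fun x => ?_
  rw [resHom_apply, indHom_apply, map_sum, Finset.sum_apply, Finset.sum_eq_single 1]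
  · rw [S.comm, S.equiv_symm_single, Pi.single_eq_same, S.act_one, inv_one, S.j_one, one_smul]
  · intro g _ hg
    rw [S.comm, S.equiv_symm_single, Pi.single_eq_of_ne hg.symm]
  · simp

lemma resHom_comp (f : Y →ₗ[T] T) (d : X →ₗ[T] Y) :
    S.resHom (f ∘ₗ d) = S.resHom f ∘ₗ d.restrictScalars A := rfl

lemma indHom_comp (φ : Y →ₗ[A] A) (d : X →ₗ[T] Y) :
    S.indHom (φ ∘ₗ d.restrictScalars A) = S.indHom φ ∘ₗ d := by
  refine LinearMap.ext fun x => ?_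
  simp only [indHom_apply, LinearMap.comp_apply, LinearMap.restrictScalars_apply, d.map_smul]

lemma indHom_zero : S.indHom (0 : X →ₗ[A] A) = 0 :=
  LinearMap.ext fun x => by simp [indHom_apply]

lemma resHom_zero : S.resHom (0 : X →ₗ[T] T) = 0 :=
  LinearMap.ext fun x => by simp [resHom_apply]

include S in
lemma exists_not_factor {d : X →ₗ[T] Y} {e : Y →ₗ[T] Z}
    (h : ∃ ψ : Y →ₗ[A] A, ψ ∘ₗ d.restrictScalars A = 0 ∧
      ∀ θ : Z →ₗ[A] A, θ ∘ₗ e.restrictScalars A ≠ ψ) :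
    ∃ ψ : Y →ₗ[T] T, ψ ∘ₗ d = 0 ∧ ∀ θ : Z →ₗ[T] T, θ ∘ₗ e ≠ ψ := by
  obtain ⟨ψ, h0, h⟩ := h
  refine ⟨S.indHom ψ, by rw [← indHom_comp, h0, indHom_zero], fun θ hθ => h (S.resHom θ) ?_⟩
  rw [← resHom_comp, hθ, resHom_indHom]

include S in
lemma exists_factor {d : X →ₗ[T] Y} {e : Y →ₗ[T] Z}
    (h : ∀ ψ : Y →ₗ[A] A, ψ ∘ₗ d.restrictScalars A = 0 →
      ∃ θ : Z →ₗ[A] A, θ ∘ₗ e.restrictScalars A = ψ)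
    (ψ : Y →ₗ[T] T) (hψ : ψ ∘ₗ d = 0) : ∃ θ : Z →ₗ[T] T, θ ∘ₗ e = ψ := by
  obtain ⟨θ, hθ⟩ := h (S.resHom ψ) (by rw [← resHom_comp, hψ, resHom_zero])
  exact ⟨S.indHom θ, by rw [← indHom_comp, hθ, indHom_resHom]⟩

end Modules

end SkewData

section

open CategoryTheory

/-- A projective resolution of a module whose functionals detect the `Ext` groups into the ring. -/
lemma exists_resolution_nontrivial_ext_iff (R : Type u) [Ring R] (M : Type u) [AddCommGroup M]
    [Module R M] :
    ∃ (X : ℕ → ModuleCat.{u} R) (d : ∀ n, X (n + 1) →ₗ[R] X n) (ε : X 0 →ₗ[R] M),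
      (∀ n, Module.Projective R (X n)) ∧ Function.Surjective ε ∧ Function.Exact (d 0) ε ∧
      (∀ n, Function.Exact (d (n + 1)) (d n)) ∧
      (Nontrivial (((Ext ℤ (ModuleCat R) 0).obj (Opposite.op (ModuleCat.of R M))).obj
        (ModuleCat.of R R)) ↔ ∃ ψ : X 0 →ₗ[R] R, ψ ∘ₗ d 0 = 0 ∧ ψ ≠ 0) ∧
      ∀ n, (Nontrivial (((Ext ℤ (ModuleCat R) (n + 1)).obj
        (Opposite.op (ModuleCat.of R M))).obj (ModuleCat.of R R)) ↔
        ∃ ψ : X (n + 1) →ₗ[R] R, ψ ∘ₗ d (n + 1) = 0 ∧ ∀ θ : X n →ₗ[R] R, θ ∘ₗ d n ≠ ψ) := by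
  let P := projectiveResolution (ModuleCat.of R M)
  have key : ∀ i j l, (ComplexShape.up ℕ).prev j = i → (ComplexShape.up ℕ).next j = l →
      (Nontrivial (((Ext ℤ (ModuleCat R) j).obj (Opposite.op (ModuleCat.of R M))).obj
        (ModuleCat.of R R)) ↔ ∃ ψ : P.complex.X j ⟶ ModuleCat.of R R,
          P.complex.d l j ≫ ψ = 0 ∧ ∀ θ : P.complex.X i ⟶ ModuleCat.of R R,
            P.complex.d j i ≫ θ ≠ ψ) := by
    intro i j l hi hl
    rw [← not_iff_not, not_nontrivial_iff_subsingleton, ← ModuleCat.isZero_iff_subsingleton,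
      (P.isoExt j (ModuleCat.of R R)).isZero_iff,
      ← HomologicalComplex.exactAt_iff_isZero_homology,
      HomologicalComplex.exactAt_iff' _ i j l hi hl,
      ShortComplex.moduleCat_exact_iff]
    push Not
    rfl
  refine ⟨P.complex.X, fun n => (P.complex.d (n + 1) n).hom, (P.π.f 0).hom, fun n => ?_, ?_, ?_,
    fun n => ?_, ?_, fun n => ?_⟩
  · exact (IsProjective.iff_projective _).2 (P.projective n)
  · exact (ModuleCat.epi_iff_surjective _).1 inferInstance
  · exact (ShortComplex.ShortExact.moduleCat_exact_iff_function_exact _).1 P.exact₀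
  · exact (ShortComplex.ShortExact.moduleCat_exact_iff_function_exact _).1 (P.exact_succ n)
  · rw [key 0 0 1 (by simp) (by simp)]
    constructor
    · rintro ⟨ψ, h0, h⟩
      exact ⟨ψ.hom, congrArg ModuleCat.Hom.hom h0, fun hψ => h 0 (by ext1; simp [hψ])⟩
    · rintro ⟨ψ, h0, h⟩
      refine ⟨ModuleCat.ofHom ψ, by ext1; exact h0, fun θ hθ => h ?_⟩
      rw [P.complex.shape 0 0 (by simp), Limits.zero_comp] at hθ
      exact (congrArg ModuleCat.Hom.hom hθ).symm
  · rw [key n (n + 1) (n + 2) (by simp) (by simp)]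
    constructor
    · rintro ⟨ψ, h0, h⟩
      exact ⟨ψ.hom, congrArg ModuleCat.Hom.hom h0, fun θ hθ => h (ModuleCat.ofHom θ) (by
        ext1; exact hθ)⟩
    · rintro ⟨ψ, h0, h⟩
      exact ⟨ModuleCat.ofHom ψ, by ext1; exact h0, fun θ hθ => h θ.hom
        (congrArg ModuleCat.Hom.hom hθ)⟩

end

open CategoryTheory in
lemma moduleGrade_eq (R : Type u) [Ring R] (M : Type u) [AddCommGroup M] [Module R M] (j : ℕ)
    (hj : Nontrivial (((Ext ℤ (ModuleCat R) j).obj (Opposite.op (ModuleCat.of R M))).obj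
      (ModuleCat.of R R)))
    (h : ∀ i < j, ¬ Nontrivial (((Ext ℤ (ModuleCat R) i).obj (Opposite.op
      (ModuleCat.of R M))).obj (ModuleCat.of R R))) : moduleGrade R M = j := by
  refine le_antisymm (sInf_le ⟨j, rfl, hj⟩) (le_sInf ?_)
  rintro _ ⟨i, rfl, hi⟩
  by_contra hij
  exact h i (by exact_mod_cast not_le.1 hij) hi

namespace SkewData

variable {k A G : Type*} {T : Type u} [Field k] [Ring A] [Algebra k A] [Group G] [Fintype G]
  [Ring T] [Algebra k T] [Module A T] {u v : A} (S : SkewData k G T u v) {q c : k}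
  (P : PlaneData k q c u v) (M : Type u) [AddCommGroup M] [Module T M] [Module A M]
  [IsScalarTower A T M]

include S in
lemma moduleGrade_eq_zero {φ : M →ₗ[A] A} (hφ : φ ≠ 0) : moduleGrade T M = 0 := by
  obtain ⟨X, d, ε, -, hε, h₁, -, hz, -⟩ := exists_resolution_nontrivial_ext_iff T M
  refine moduleGrade_eq T M 0 (hz.2 ⟨S.indHom φ ∘ₗ ε, ?_, fun h => hφ ?_⟩) (by simp)
  · rw [LinearMap.comp_assoc, h₁.linearMap_comp_eq_zero, LinearMap.comp_zero]
  · have : S.indHom φ = 0 := by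
      refine LinearMap.ext fun m => ?_
      obtain ⟨x, rfl⟩ := hε m
      exact LinearMap.congr_fun h x
    rw [← S.resHom_indHom φ, this, S.resHom_zero]

include S P in
lemma moduleGrade_of_isTorsionModule [Module.Finite A M] (ht : IsTorsionModule A M) :
    (∀ {a : A} {φ : M →ₗ[A] A ⧸ Submodule.span A {a}}, a ≠ 0 → φ ≠ 0 → moduleGrade T M = 1) ∧
    ∀ [Module k M] [IsScalarTower k A M] [Module.Finite k M] [Nontrivial M],
      moduleGrade T M = 2 := by
  obtain ⟨X, d, ε, hX, hε, h₁, h₂, hz, hs⟩ := exists_resolution_nontrivial_ext_iff T M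
  let _ := fun n => Module.compHom (X n) S.ι.toRingHom
  have hX' : ∀ n, IsScalarTower A T (X n) := fun n => ⟨fun a t x => by
    rw [S.smul_eq, mul_smul]; rfl⟩
  have := fun n => S.projective_restrict (X := X n)
  have hz' : ¬ Nontrivial (((Ext ℤ (ModuleCat T) 0).obj (Opposite.op (ModuleCat.of T M))).obj
      (ModuleCat.of T T)) := by
    rw [hz]
    rintro ⟨ψ, h0, h⟩
    obtain ⟨f, hf⟩ := ε.exists_factor_of_surjective hε ψ fun x hx => by
      obtain ⟨y, rfl⟩ := (h₁ x).1 hx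
      exact LinearMap.congr_fun h0 y
    refine h (LinearMap.ext fun x => ?_)
    have hres : S.resHom f = 0 := P.eq_zero_of_isTorsionModule ht _
    rw [← hf x, ← S.indHom_resHom f, hres, S.indHom_zero, LinearMap.zero_apply,
      LinearMap.zero_apply]
  refine ⟨fun {a φ} ha hφ => ?_, ?_⟩
  · refine moduleGrade_eq T M 1 ((hs 0).2 (S.exists_not_factor ?_)) fun i hi => ?_
    · exact P.exists_not_factor_one (ε := ε.restrictScalars A) hε h₁ (h₂ 0) ht ha hφ
    · obtain rfl : i = 0 := by omega
      exact hz'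
  · intro _ _ _ _
    refine moduleGrade_eq T M 2 ((hs 1).2 (S.exists_not_factor ?_)) fun i hi => ?_
    · exact P.exists_not_factor_two (ε := ε.restrictScalars A)
        (d₁ := (d 0).restrictScalars A) hε h₁ (h₂ 0) (h₂ 1)
    · obtain rfl | rfl : i = 0 ∨ i = 1 := by omega
      · exact hz'
      · rw [hs 0]
        rintro ⟨ψ, h0, h⟩
        obtain ⟨θ, hθ⟩ := S.exists_factor
          (P.exists_factor_one (ε := ε.restrictScalars A) hε h₁ (h₂ 0)) ψ h0
        exact h θ hθ

end SkewData

open Filter in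
/-- A family of sequences of polynomial growth, one of which attains the largest degree. -/
lemma iSup_limsup_logb_eq {ι : Type*} (f : ι → ℕ → ℕ) (d : ℕ)
    (hub : ∀ i, ∃ C : ℕ, ∀ n, 1 ≤ n → f i n ≤ C * n ^ d)
    (hlb : ∃ i, ∃ C : ℕ, ∀ n, 1 ≤ n → n ^ d ≤ C * f i n) :
    ⨆ i, limsup (fun n : ℕ => Real.logb n (f i n)) atTop = d := by
  have hlim : ∀ a : ℝ, Tendsto (fun n : ℕ => a / Real.log n + d) atTop (nhds d) := by
    intro a
    have := (Real.tendsto_log_atTop.comp tendsto_natCast_atTop_atTop).const_div_atTop a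
    simpa using this.add_const (d : ℝ)
  have hlog : ∀ n : ℕ, 2 ≤ n → 0 < Real.log n := fun n hn =>
    Real.log_pos (by exact_mod_cast hn)
  have hub' : ∀ i, ∃ a : ℝ, ∀ᶠ n : ℕ in atTop, Real.logb n (f i n) ≤ a / Real.log n + d := by
    intro i
    obtain ⟨C, hC⟩ := hub i
    refine ⟨Real.log (C + 1), (eventually_ge_atTop 2).mono fun n hn => ?_⟩
    have h0 := hlog n hn
    have hn0 : (0 : ℝ) < n := by exact_mod_cast (by omega : 0 < n)
    rw [Real.logb, div_add' _ _ _ h0.ne', div_le_div_iff_of_pos_right h0, ← Real.log_pow,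
      ← Real.log_mul (by positivity) (by positivity)]
    rcases Nat.eq_zero_or_pos (f i n) with hf | hf
    · rw [hf, Nat.cast_zero, Real.log_zero]
      refine Real.log_nonneg ?_
      exact_mod_cast Nat.mul_pos (Nat.succ_pos C) (pow_pos (by omega) d)
    · refine Real.log_le_log (by exact_mod_cast hf) ?_
      have := (hC n (by omega)).trans (Nat.mul_le_mul_right (n ^ d) C.le_succ)
      exact_mod_cast this
  have hnonneg : ∀ i, ∀ᶠ n : ℕ in atTop, 0 ≤ Real.logb n (f i n) := fun i =>
    (eventually_ge_atTop 2).mono fun n hn =>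
      div_nonneg (Real.log_natCast_nonneg _) (hlog n hn).le
  have hle : ∀ i, limsup (fun n : ℕ => Real.logb n (f i n)) atTop ≤ d := fun i => by
    obtain ⟨a, ha⟩ := hub' i
    exact (limsup_le_limsup ha (isCoboundedUnder_le_of_eventually_le _ (hnonneg i))
      (hlim a).isBoundedUnder_le).trans (hlim a).limsup_eq.le
  obtain ⟨i, C, hC⟩ := hlb
  have hge : (d : ℝ) ≤ limsup (fun n : ℕ => Real.logb n (f i n)) atTop := by
    obtain ⟨a, ha⟩ := hub' i
    have hev : ∀ᶠ n : ℕ in atTop, -Real.log C / Real.log n + d ≤ Real.logb n (f i n) := by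
      refine (eventually_ge_atTop 2).mono fun n hn => ?_
      have h0 := hlog n hn
      have hn0 : 0 < n ^ d := pow_pos (by omega) d
      have hpos : 0 < C * f i n := hn0.trans_le (hC n (by omega))
      rw [Real.logb, div_add' _ _ _ h0.ne', div_le_div_iff_of_pos_right h0, ← Real.log_pow,
        neg_add_le_iff_le_add, ← Real.log_mul
          (by exact_mod_cast (Nat.pos_of_mul_pos_right hpos).ne')
          (by exact_mod_cast (Nat.pos_of_mul_pos_left hpos).ne')]
      exact Real.log_le_log (by exact_mod_cast hn0) (by exact_mod_cast hC n (by omega))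
    exact (hlim _).limsup_eq.ge.trans (limsup_le_limsup hev (hlim _).isCoboundedUnder_le
      ((hlim a).isBoundedUnder_le.mono_le ha))
  exact le_antisymm (@ciSup_le _ _ _ ⟨i⟩ _ _ hle)
    (hge.trans (le_ciSup (f := fun i => limsup (fun n : ℕ => Real.logb n (f i n)) atTop)
      ⟨(d : ℝ), by rintro _ ⟨i, rfl⟩; exact hle i⟩ i))

lemma Submodule.FG.smul_submodule {k A M : Type*} [CommSemiring k] [Semiring A] [Algebra k A]
    [AddCommMonoid M] [Module k M] [Module A M] [IsScalarTower k A M] {V : Submodule k A}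
    {F : Submodule k M} (hV : V.FG) (hF : F.FG) : (V • F).FG := by
  have : V • F = Submodule.map₂ (Algebra.lsmul k k M : A →ₐ[k] Module.End k M).toLinearMap V F :=
    le_antisymm (Submodule.smul_le.2 fun a ha x hx => Submodule.apply_mem_map₂ _ ha hx)
      (Submodule.map₂_le.2 fun a ha x hx => Submodule.smul_mem_smul ha hx)
  rw [this]
  exact hV.map₂ _ hF

namespace PlaneData

variable {k A : Type*} [Field k] [Ring A] [Algebra k A] {q c : k} {u v : A}
  (P : PlaneData k q c u v) {M : Type*} [AddCommGroup M] [Module k M] [Module A M]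
  [IsScalarTower k A M]

/-- The translates of `m` by the elements of degree less than `d`. -/
noncomputable def flSMul (m : M) (d : ℕ) : Submodule k M :=
  (P.fl d).map ((LinearMap.toSpanSingleton A M m).restrictScalars k)

lemma smul_mem_flSMul (m : M) {d : ℕ} {a : A} (ha : a ∈ P.fl d) : a • m ∈ P.flSMul m d :=
  ⟨a, ha, rfl⟩

instance finite_flSMul (m : M) (d : ℕ) : Module.Finite k (P.flSMul m d) :=
  inferInstanceAs (Module.Finite k ((P.fl d).map _))

lemma finrank_flSMul_le (m : M) (d : ℕ) : Module.finrank k (P.flSMul m d) ≤ hd d :=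
  (Submodule.finrank_map_le _ _).trans (P.finrank_fl d).le

lemma finrank_flSMul_of_injective {m : M} (hm : ∀ a : A, a • m = 0 → a = 0) (d : ℕ) :
    Module.finrank k (P.flSMul m d) = hd d := by
  rw [← P.finrank_fl d, flSMul]
  exact (LinearEquiv.finrank_eq (Submodule.equivMapOfInjective _
    ((injective_iff_map_eq_zero _).2 hm) _)).symm

lemma hd_le_add (n e : ℕ) : hd n ≤ hd (n - e) + e * n := by
  have h1 := two_mul_hd n
  rcases le_total n e with h | h
  · nlinarith
  · obtain ⟨d, rfl⟩ := Nat.exists_eq_add_of_le h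
    have h2 := two_mul_hd d
    rw [Nat.add_sub_cancel_left]
    rcases Nat.eq_zero_or_pos e with rfl | he
    · simp
    · nlinarith

lemma finrank_flSMul_le_of_smul_eq_zero {m : M} {b : A} (hb : b ≠ 0) (hbm : b • m = 0) :
    ∃ C : ℕ, ∀ n, Module.finrank k (P.flSMul m n) ≤ C * n := by
  have := P.noZeroDivisors
  obtain ⟨e, he⟩ := P.exists_mem_fl b
  refine ⟨e, fun n => ?_⟩
  have hmem : ∀ a ∈ P.fl (n - e), a * b ∈ P.fl n := by
    intro a ha
    rcases le_total n e with h | h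
    · rw [Nat.sub_eq_zero_of_le h, P.mem_fl_zero] at ha
      rw [ha, zero_mul]
      exact zero_mem _
    · have := P.mul_mem_fl (P.fl_mono (Nat.le_succ _) ha) he
      rwa [Nat.sub_add_cancel h] at this
  let f := ((LinearMap.toSpanSingleton A M m).restrictScalars k).domRestrict (P.fl n)
  let g : P.fl (n - e) →ₗ[k] LinearMap.ker f :=
    (((LinearMap.mulRight k b).restrict hmem).codRestrict (LinearMap.ker f) fun a => by
      change ((a : A) * b) • m = 0
      rw [mul_smul, hbm, smul_zero])
  have hg : Function.Injective g := by
    intro x y hxy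
    have : (x : A) * b = y * b := congrArg (fun z : LinearMap.ker f => (z.1 : A)) hxy
    exact Subtype.ext (mul_right_cancel₀ hb this)
  have h1 := LinearMap.finrank_le_finrank_of_injective hg
  have h2 := f.finrank_range_add_finrank_ker
  rw [P.finrank_fl] at h1 h2
  rw [LinearMap.range_domRestrict] at h2
  have h3 := hd_le_add n e
  change Module.finrank k (P.flSMul m n) + _ = _ at h2
  omega

lemma fl_succ_le_pow (n : ℕ) : P.fl (n + 1) ≤ Submodule.span k {1, u, v} ^ n := by
  have h1 : (1 : Submodule k A) ≤ Submodule.span k {1, u, v} :=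
    Submodule.one_le.2 (Submodule.subset_span (by simp))
  refine P.sp_le fun r hr => ?_
  rw [basis_apply]
  refine pow_le_pow_right₀ h1 (Nat.lt_succ_iff.1 hr) ?_
  rw [pow_add]
  exact Submodule.mul_mem_mul (Submodule.pow_mem_pow _ (Submodule.subset_span (by simp)) _)
    (Submodule.pow_mem_pow _ (Submodule.subset_span (by simp)) _)

include P in
/-- In an infinite-dimensional finitely generated module, the translates of a generating space
grow at least linearly. -/
lemma exists_le_finrank [Module.Finite A M] (hM : ¬ Module.Finite k M) :
    ∃ F : Submodule k M, F.FG ∧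
      ∀ n, n ≤ Module.finrank k (Submodule.span k {(1 : A), u, v} ^ n • F : Submodule k M) := by
  obtain ⟨s, hs⟩ := Module.Finite.fg_top (R := A) (M := M)
  let V : Submodule k A := Submodule.span k {1, u, v}
  let F : Submodule k M := Submodule.span k s
  have hV : (1 : Submodule k A) ≤ V := Submodule.one_le.2 (Submodule.subset_span (by simp))
  have hfin : ∀ n, (V ^ n • F).FG := fun n =>
    ((Submodule.fg_span (by simp)).pow n).smul_submodule ⟨s, rfl⟩
  have hsF : ∀ n, F ≤ V ^ n • F := fun n => by
    conv_lhs => rw [← Submodule.one_smul (A := A) F]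
    exact Submodule.smul_mono_left (one_le_pow₀ hV)
  have hlt : ∀ n, V ^ n • F < V ^ (n + 1) • F := by
    intro n
    refine lt_of_le_of_ne (Submodule.smul_mono_left (pow_le_pow_right₀ hV n.le_succ)) fun heq => ?_
    have hstab : ∀ a ∈ V, ∀ x ∈ V ^ n • F, a • x ∈ V ^ n • F := by
      intro a ha x hx
      rw [heq, pow_succ', ← smul_eq_mul, Submodule.smul_assoc]
      exact Submodule.smul_mem_smul ha hx
    have htop : V ^ n • F = ⊤ := by
      let N : Submodule A M :=
        { V ^ n • F with
          smul_mem' a x hx := P.smul_mem_of_stable (V ^ n • F)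
            (fun x hx => hstab u (Submodule.subset_span (by simp)) x hx)
            (fun x hx => hstab v (Submodule.subset_span (by simp)) x hx) a hx }
      have hN : N = ⊤ := by
        rw [eq_top_iff, ← hs, Submodule.span_le]
        exact fun x hx => hsF n (Submodule.subset_span hx)
      exact SetLike.ext fun x => by
        have : x ∈ N := by rw [hN]; trivial
        exact ⟨fun _ => trivial, fun _ => this⟩
    exact hM ⟨htop ▸ hfin n⟩
  refine ⟨F, ⟨s, rfl⟩, fun n => ?_⟩
  induction n with
  | zero => exact Nat.zero_le _
  | succ n ih =>
    have : Module.Finite k (V ^ (n + 1) • F : Submodule k M) := Module.Finite.iff_fg.2 (hfin _)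
    exact ih.trans_lt (Submodule.finrank_lt_finrank_of_lt (hlt n))

end PlaneData

namespace SkewData

variable {k A G T : Type*} [Field k] [Ring A] [Algebra k A] [Group G] [Fintype G] [Ring T]
  [Algebra k T] [Module A T] {u v : A} (S : SkewData k G T u v) {q c : k} (P : PlaneData k q c u v)

lemma act_pow_mul_mem_fl {w : A} (hw : w ∈ Submodule.span k {u, v}) (i : ℕ) {d : ℕ} {x : A}
    (hx : x ∈ P.fl d) : w ^ i * x ∈ P.fl (i + d) := by
  obtain ⟨α, β, rfl⟩ := Submodule.mem_span_pair.1 hw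
  induction i with
  | zero => simpa using hx
  | succ i ih =>
    rw [pow_succ', mul_assoc, add_mul, smul_mul_assoc, smul_mul_assoc, add_right_comm]
    exact add_mem (Submodule.smul_mem _ _ (P.u_mul_mem_fl ih))
      (Submodule.smul_mem _ _ (P.v_mul_mem_fl ih))

lemma act_mem_fl (g : G) {d : ℕ} {x : A} (hx : x ∈ P.fl d) : S.act g x ∈ P.fl d :=
  P.map_mem_of_mem_sp (S.act g).toLinearMap (fun r hr => by
    rw [P.basis_apply, AlgHom.toLinearMap_apply, map_mul, map_pow, map_pow,
      ← mul_one (S.act g v ^ r.2)]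
    exact P.fl_mono (by simp only [Set.mem_ofPred_eq] at hr; omega)
      (act_pow_mul_mem_fl P (S.act_u g) _ (act_pow_mul_mem_fl P (S.act_v g) _ P.one_mem_fl))) hx

/-- The elements of the skew group ring whose coefficients have degree less than `d`. -/
def filt (d : ℕ) : AddSubmonoid T where
  carrier := {t | ∀ g, S.equiv.symm t g ∈ P.fl d}
  zero_mem' g := by rw [map_zero]; exact zero_mem _
  add_mem' hs ht g := by rw [map_add]; exact add_mem (hs g) (ht g)

lemma ι_mul_j_mem_filt {d : ℕ} {a : A} (ha : a ∈ P.fl d) (g : G) :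
    S.ι a * S.j g ∈ S.filt P d := by
  classical
  intro h
  rw [S.equiv_symm_single, Pi.single_apply]
  split_ifs
  exacts [ha, zero_mem _]

lemma filt_mono {d e : ℕ} (h : d ≤ e) : S.filt P d ≤ S.filt P e :=
  fun _ ht g => P.fl_mono h (ht g)

lemma mul_mem_filt {d e : ℕ} {t s : T} (ht : t ∈ S.filt P (d + 1)) (hs : s ∈ S.filt P e) :
    t * s ∈ S.filt P (d + e) := by
  rw [← S.sum_equiv_symm t, ← S.sum_equiv_symm s, Finset.sum_mul_sum]
  refine sum_mem fun g _ => sum_mem fun h _ => ?_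
  rw [mul_assoc, ← mul_assoc (S.j g), S.comm, mul_assoc, S.j_mul, ← mul_assoc, ← map_mul]
  exact S.ι_mul_j_mem_filt P (P.mul_mem_fl (ht g) (S.act_mem_fl P g (hs h))) _

lemma exists_mem_filt (t : T) : ∃ d, t ∈ S.filt P d :=
  P.exists_forall_mem_fl (S.equiv.symm t)

lemma smul_mem_filt (r : k) {d : ℕ} {t : T} (ht : t ∈ S.filt P d) : r • t ∈ S.filt P d := by
  rw [← S.sum_equiv_symm t, Finset.smul_sum]
  refine sum_mem fun g _ => ?_
  rw [← smul_mul_assoc, ← map_smul]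
  exact S.ι_mul_j_mem_filt P (Submodule.smul_mem _ _ (ht g)) g

/-- The powers of a finite-dimensional subspace have linearly growing degree. -/
lemma exists_pow_le_filt {V : Submodule k T} (hV : V.FG) :
    ∃ c : ℕ, ∀ n, ∀ t ∈ V ^ n, t ∈ S.filt P (c * n + 1) := by
  classical
  obtain ⟨s, rfl⟩ := hV
  choose d hd using S.exists_mem_filt P
  have hs : ∀ t ∈ Submodule.span k (s : Set T), t ∈ S.filt P (s.sup d + 1) := by
    intro t ht
    induction ht using Submodule.span_induction with
    | mem t ht => exact S.filt_mono P ((Finset.le_sup ht).trans (Nat.le_succ _)) (hd t)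
    | zero => exact zero_mem _
    | add x y _ _ hx hy => exact add_mem hx hy
    | smul r x _ hx => exact S.smul_mem_filt P r hx
  refine ⟨s.sup d, fun n => ?_⟩
  induction n with
  | zero =>
    intro t ht
    obtain ⟨r, rfl⟩ := Submodule.mem_one.1 ht
    rw [mul_zero, zero_add, Algebra.algebraMap_eq_smul_one]
    refine S.smul_mem_filt P r ?_
    have := S.ι_mul_j_mem_filt P P.one_mem_fl 1
    rwa [map_one, S.j_one, one_mul] at this
  | succ n ih =>
    intro t ht
    rw [pow_succ'] at ht
    refine Submodule.mul_induction_on ht (fun x hx y hy => ?_) fun x y hx hy => add_mem hx hy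
    have := S.mul_mem_filt P (hs x hx) (ih y hy)
    rwa [show s.sup d * (n + 1) + 1 = s.sup d + (s.sup d * n + 1) by ring]

variable {M : Type*} [AddCommGroup M] [Module k M] [Module T M] [Module A M]
  [IsScalarTower k A M] [IsScalarTower k T M] [IsScalarTower A T M]

include S in
lemma finrank_pow_smul_le {d : ℕ}
    (h : ∀ m : M, ∃ C : ℕ, ∀ n, 1 ≤ n → Module.finrank k (P.flSMul m n) ≤ C * n ^ d)
    {V : Submodule k T} (hV : V.FG) {F : Submodule k M} (hF : F.FG) :
    ∃ C : ℕ, ∀ n, 1 ≤ n → Module.finrank k (V ^ n • F : Submodule k M) ≤ C * n ^ d := by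
  classical
  obtain ⟨c, hc⟩ := S.exists_pow_le_filt P hV
  obtain ⟨s, rfl⟩ := hF
  choose C hC using h
  let I := (Finset.univ : Finset G) ×ˢ s
  refine ⟨(∑ p ∈ I, C (S.j p.1 • p.2)) * (c + 1) ^ d, fun n hn => ?_⟩
  have hle : V ^ n • Submodule.span k (s : Set M) ≤
      I.sup fun p => P.flSMul (S.j p.1 • p.2) (c * n + 1) := by
    refine Submodule.smul_le.2 fun t ht x hx => ?_
    induction hx using Submodule.span_induction with
    | mem x hx =>
      rw [← S.sum_equiv_symm t, Finset.sum_smul]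
      refine sum_mem fun g _ => ?_
      rw [mul_smul, S.ι_smul]
      exact Finset.le_sup (f := fun p : G × M => P.flSMul (S.j p.1 • p.2) (c * n + 1))
        (Finset.mem_product.2 ⟨Finset.mem_univ g, hx⟩ : (g, x) ∈ I)
        (P.smul_mem_flSMul _ (hc n t ht g))
    | zero => rw [smul_zero]; exact zero_mem _
    | add x y _ _ hx hy => rw [smul_add]; exact add_mem hx hy
    | smul r x _ hx => rw [smul_comm]; exact Submodule.smul_mem _ _ hx
  have hsup : ∀ J : Finset (G × M), Module.Finite k
        (J.sup fun p => P.flSMul (S.j p.1 • p.2) (c * n + 1) : Submodule k M) ∧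
      Module.finrank k (J.sup fun p => P.flSMul (S.j p.1 • p.2) (c * n + 1) : Submodule k M) ≤
        ∑ p ∈ J, Module.finrank k (P.flSMul (S.j p.1 • p.2) (c * n + 1)) := by
    intro J
    induction J using Finset.induction_on with
    | empty =>
      rw [Finset.sup_empty, Finset.sum_empty]
      exact ⟨inferInstance, (finrank_bot k M).le⟩
    | insert p J hp ih =>
      have := ih.1
      rw [Finset.sup_insert, Finset.sum_insert hp]
      exact ⟨inferInstance, (Submodule.finrank_add_le_finrank_add_finrank _ _).trans
        (Nat.add_le_add_left ih.2 _)⟩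
  have := (hsup I).1
  refine (Submodule.finrank_mono hle).trans ((hsup I).2.trans ?_)
  rw [mul_assoc, ← mul_pow, Finset.sum_mul]
  refine Finset.sum_le_sum fun p _ => (hC _ _ (by omega)).trans ?_
  refine Nat.mul_le_mul_left _ (Nat.pow_le_pow_left ?_ d)
  rw [add_mul, one_mul]
  omega

end SkewData

lemma Submodule.span_image2_smul {k T M : Type*} [Field k] [Ring T] [Algebra k T] [AddCommGroup M]
    [Module k M] [Module T M] [IsScalarTower k T M] (V : Submodule k T) (F : Submodule k M) :
    Submodule.span k (Set.image2 (fun (a : T) (m : M) => a • m) V F) = V • F :=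
  le_antisymm
    (Submodule.span_le.2 (by rintro _ ⟨a, ha, m, hm, rfl⟩; exact Submodule.smul_mem_smul ha hm))
    (Submodule.smul_le.2 fun a ha m hm => Submodule.subset_span ⟨a, ha, m, hm, rfl⟩)

namespace PlaneData

variable {k A : Type*} [Field k] [Ring A] [Algebra k A] {q c : k} {u v : A}
  (P : PlaneData k q c u v) {M : Type*} [AddCommGroup M] [Module k M] [Module A M]
  [IsScalarTower k A M]

lemma flSMul_le (m : M) (n : ℕ) :
    P.flSMul m (n + 1) ≤ Submodule.span k {(1 : A), u, v} ^ n • Submodule.span k {m} := by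
  rintro _ ⟨a, ha, rfl⟩
  exact Submodule.smul_mem_smul (P.fl_succ_le_pow n ha) (Submodule.mem_span_singleton_self m)

lemma hd_le_sq {n : ℕ} (hn : 1 ≤ n) : hd n ≤ 1 * n ^ 2 := by
  have := two_mul_hd n
  nlinarith

lemma sq_le_hd (n : ℕ) : n ^ 2 ≤ 2 * hd (n + 1) := by
  have := two_mul_hd (n + 1)
  nlinarith

end PlaneData

namespace SkewData

variable {k A G T : Type*} [Field k] [Ring A] [Algebra k A] [Group G] [Fintype G] [Ring T]
  [Algebra k T] [Module A T] {u v : A} (S : SkewData k G T u v) {q c : k} (P : PlaneData k q c u v)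

include S in
lemma isScalarTower_field : IsScalarTower k A T :=
  ⟨fun r a t => by rw [S.smul_eq, S.smul_eq, map_smul, smul_mul_assoc]⟩

include S P in
lemma gkDim_eq : gkDim k T = 2 := by
  have := S.isScalarTower_field
  have := S.isScalarTower
  let V : Submodule k A := Submodule.span k {1, u, v}
  have hV : V.FG := Submodule.fg_span (by simp)
  refine (iSup_limsup_logb_eq _ 2 (fun V => ?_) ⟨⟨V.map S.ι.toLinearMap, hV.map _, 1,
    Submodule.subset_span (by simp), map_one S.ι⟩, 2, fun n _ => ?_⟩).trans (by norm_num)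
  · obtain ⟨C, hC⟩ := S.finrank_pow_smul_le P (M := T) (d := 2)
      (fun m => ⟨1, fun n hn => (P.finrank_flSMul_le m n).trans (PlaneData.hd_le_sq hn)⟩) V.2.1
      (Submodule.fg_span_singleton (1 : T))
    refine ⟨C, fun n hn => ?_⟩
    have := hC n hn
    rwa [← Submodule.one_eq_span, smul_eq_mul, mul_one] at this
  · refine (PlaneData.sq_le_hd n).trans (Nat.mul_le_mul_left 2 ?_)
    have hfin : Module.Finite k (V.map S.ι.toLinearMap ^ n : Submodule k T) :=
      Module.Finite.iff_fg.2 ((hV.map _).pow n)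
    rw [← P.finrank_fl, LinearEquiv.finrank_eq (Submodule.equivMapOfInjective S.ι.toLinearMap
      S.ι_injective (P.fl (n + 1)))]
    refine Submodule.finrank_mono ?_
    rw [← Submodule.map_pow]
    exact Submodule.map_mono (P.fl_succ_le_pow n)

variable {M : Type*} [AddCommGroup M] [Module k M] [Module T M] [Module A M]
  [IsScalarTower k A M] [IsScalarTower k T M] [IsScalarTower A T M]

include S P in
lemma gkModuleDim_eq {d : ℕ}
    (hub : ∀ m : M, ∃ C : ℕ, ∀ n, 1 ≤ n → Module.finrank k (P.flSMul m n) ≤ C * n ^ d)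
    (hlb : ∃ F : Submodule k M, F.FG ∧ ∃ C : ℕ, ∀ n, 1 ≤ n → n ^ d ≤
      C * Module.finrank k (Submodule.span k {(1 : A), u, v} ^ n • F : Submodule k M)) :
    gkModuleDim k T M = d := by
  obtain ⟨F, hF, C, hC⟩ := hlb
  let V : Submodule k A := Submodule.span k {1, u, v}
  have hV : V.FG := Submodule.fg_span (by simp)
  refine iSup_limsup_logb_eq _ d (fun VF => ?_) ⟨⟨⟨V.map S.ι.toLinearMap, F⟩, hV.map _,
    ⟨1, Submodule.subset_span (by simp), map_one S.ι⟩, hF⟩, C, fun n hn => ?_⟩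
  · obtain ⟨C, hC⟩ := S.finrank_pow_smul_le P hub VF.2.1 VF.2.2.2
    refine ⟨C, fun n hn => ?_⟩
    rw [Submodule.span_image2_smul]
    exact hC n hn
  · refine (hC n hn).trans (Nat.mul_le_mul_left C ?_)
    rw [Submodule.span_image2_smul]
    have hfin : Module.Finite k (V.map S.ι.toLinearMap ^ n • F : Submodule k M) :=
      Module.Finite.iff_fg.2 (((hV.map _).pow n).smul_submodule hF)
    refine Submodule.finrank_mono (Submodule.smul_le.2 fun a ha x hx => ?_)
    rw [← S.ι_smul]
    refine Submodule.smul_mem_smul ?_ hx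
    rw [← Submodule.map_pow]
    exact Submodule.mem_map_of_mem ha

include S P in
lemma gkModuleDim_eq_two {φ : M →ₗ[A] A} (hφ : φ ≠ 0) : gkModuleDim k T M = 2 := by
  have := P.noZeroDivisors
  obtain ⟨m, hm⟩ := DFunLike.ne_iff.1 hφ
  refine (S.gkModuleDim_eq P (d := 2)
    (fun m => ⟨1, fun n hn => (P.finrank_flSMul_le m n).trans (PlaneData.hd_le_sq hn)⟩)
    ⟨Submodule.span k {m}, Submodule.fg_span_singleton m, 2, fun n _ => ?_⟩).trans (by norm_num)
  refine (PlaneData.sq_le_hd n).trans (Nat.mul_le_mul_left 2 ?_)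
  have hfin : Module.Finite k (Submodule.span k {(1 : A), u, v} ^ n • Submodule.span k {m} :
      Submodule k M) := Module.Finite.iff_fg.2
    (((Submodule.fg_span (by simp)).pow n).smul_submodule (Submodule.fg_span_singleton m))
  rw [← P.finrank_flSMul_of_injective (m := m) fun a ha => ?_]
  · exact Submodule.finrank_mono (P.flSMul_le m n)
  · have h := φ.map_smul a m
    rw [ha, map_zero, smul_eq_mul] at h
    exact (mul_eq_zero.1 h.symm).resolve_right hm

include S P in
lemma gkModuleDim_eq_one [Module.Finite A M] (ht : IsTorsionModule A M)
    (hM : ¬ Module.Finite k M) : gkModuleDim k T M = 1 := by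
  obtain ⟨F, hF, h⟩ := P.exists_le_finrank hM
  refine (S.gkModuleDim_eq P (d := 1) (fun m => ?_) ⟨F, hF, 1, fun n _ => ?_⟩).trans (by norm_num)
  · obtain ⟨b, hb, hbm⟩ := ht m
    obtain ⟨C, hC⟩ := P.finrank_flSMul_le_of_smul_eq_zero hb hbm
    exact ⟨C, fun n _ => by rw [pow_one]; exact hC n⟩
  · rw [pow_one, one_mul]
    exact h n

include S P in
lemma gkModuleDim_eq_zero [Module.Finite k M] [Nontrivial M] : gkModuleDim k T M = 0 := by
  obtain ⟨m, hm⟩ := exists_ne (0 : M)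
  refine (S.gkModuleDim_eq P (d := 0)
    (fun m => ⟨Module.finrank k M, fun n hn => by
      rw [pow_zero, mul_one]; exact Submodule.finrank_le _⟩)
    ⟨Submodule.span k {m}, Submodule.fg_span_singleton m, 1, fun n _ => ?_⟩).trans (by norm_num)
  rw [pow_zero, one_mul, Nat.one_le_iff_ne_zero, Ne, Submodule.finrank_eq_zero]
  intro h
  refine hm ((Submodule.mem_bot k).1 (h ▸ P.flSMul_le m n ?_))
  have := P.smul_mem_flSMul m (P.fl_mono (Nat.le_add_left 1 n) P.one_mem_fl)
  rwa [one_smul] at this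

end SkewData

/-- Finitely generated torsion modules of infinite dimension map nontrivially to a cyclic module
with one relation. -/
def HasCyclicImages.{w, w₁, w₂} (k : Type w₁) (A : Type w₂) [Field k] [Ring A] [Algebra k A] :
    Prop :=
  ∀ (M : Type w) [AddCommGroup M] [Module k M] [Module A M] [IsScalarTower k A M]
    [Module.Finite A M], IsTorsionModule A M → ¬ Module.Finite k M →
    ∃ (a : A) (φ : M →ₗ[A] A ⧸ Submodule.span A {a}), a ≠ 0 ∧ φ ≠ 0

lemma SkewData.exists_moduleGrade_eq {k A G : Type*} {T : Type u} [Field k] [Ring A] [Algebra k A]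
    [Group G] [Fintype G] [Ring T] [Algebra k T] [Module A T] {u v : A}
    (S : SkewData k G T u v) {q c : k} (P : PlaneData k q c u v)
    (hA : HasCyclicImages.{u} k A) (M : Type u) [AddCommGroup M] [Module k M] [Module T M]
    [IsScalarTower k T M] [Module.Finite T M] [Nontrivial M] :
    ∃ j : ℕ, moduleGrade T M = j ∧ gkModuleDim k T M + j = gkDim k T := by
  let _ := Module.compHom M S.ι.toRingHom
  have : IsScalarTower A T M := ⟨fun a t x => by rw [S.smul_eq, mul_smul]; rfl⟩
  have : IsScalarTower k A M := ⟨fun r a x => by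
    change S.ι (r • a) • x = r • S.ι a • x
    rw [map_smul, smul_assoc]⟩
  have : Module.Finite A M := S.finite_restrict
  rw [S.gkDim_eq P]
  by_cases hφ : ∃ φ : M →ₗ[A] A, φ ≠ 0
  · obtain ⟨φ, hφ⟩ := hφ
    refine ⟨0, S.moduleGrade_eq_zero M hφ, ?_⟩
    rw [S.gkModuleDim_eq_two P hφ]
    norm_num
  · have ht : IsTorsionModule A M := P.isTorsionModule_of_forall_eq_zero fun φ => by
      by_contra h
      exact hφ ⟨φ, h⟩
    by_cases hM : Module.Finite k M
    · refine ⟨2, (S.moduleGrade_of_isTorsionModule P M ht).2, ?_⟩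
      rw [S.gkModuleDim_eq_zero P]
      norm_num
    · obtain ⟨a, φ, ha, hφ⟩ := hA M ht hM
      refine ⟨1, (S.moduleGrade_of_isTorsionModule P M ht).1 ha hφ, ?_⟩
      rw [S.gkModuleDim_eq_one P ht hM]
      norm_num

namespace SkewData

open MulOpposite

variable {k A G : Type*} {T : Type u} [Field k] [Ring A] [Algebra k A] [Group G] [Fintype G]
  [Ring T] [Algebra k T] [Module A T] {u v : A} (S : SkewData k G T u v) {q c : k}
  (P : PlaneData k q c u v)

/-- The opposite skew group ring as a module over the opposite coefficient ring. -/
abbrev opModule : Module Aᵐᵒᵖ Tᵐᵒᵖ := Module.compHom Tᵐᵒᵖ (AlgHom.op S.ι).toRingHom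

lemma op_j_comm (g : G) (a : A) : S.ι a * S.j g⁻¹ = S.j g⁻¹ * S.ι (S.act g a) := by
  rw [S.comm, S.act_inv_act]

lemma span_pair_op {w : A} (hw : w ∈ Submodule.span k {u, v}) :
    op w ∈ Submodule.span k {op u, op v} := by
  obtain ⟨α, β, rfl⟩ := Submodule.mem_span_pair.1 hw
  exact Submodule.mem_span_pair.2 ⟨α, β, rfl⟩

/-- The opposite of a skew group ring. -/
def op : @SkewData k Aᵐᵒᵖ G Tᵐᵒᵖ _ _ _ _ _ _ _ S.opModule (op u) (op v) :=
  @SkewData.mk k Aᵐᵒᵖ G Tᵐᵒᵖ _ _ _ _ _ _ _ S.opModule (MulOpposite.op u) (MulOpposite.op v)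
    (AlgHom.op S.ι) (fun g => MulOpposite.op (S.j g⁻¹)) (fun g => AlgHom.op (S.act g))
    (fun _ _ => rfl)
    (by rw [inv_one, S.j_one, op_one])
    (fun g h => by rw [← op_mul, S.j_mul, mul_inv_rev])
    (fun g a => unop_injective (S.op_j_comm g a.unop))
    (fun t => by
      have key : ∀ c : G → Aᵐᵒᵖ,
          ∑ g, AlgHom.op S.ι (c g) * MulOpposite.op (S.j g⁻¹) =
            MulOpposite.op (S.equiv fun g => S.act g (c g⁻¹).unop) := by
        intro c
        rw [S.equiv_apply, Finset.op_sum]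
        refine Fintype.sum_equiv (Equiv.inv G) _ _ fun g => unop_injective ?_
        rw [Equiv.inv_apply, inv_inv]
        exact S.comm _ _
      refine ⟨fun g => MulOpposite.op (S.act g (S.equiv.symm t.unop g⁻¹)), ?_, fun c hc => ?_⟩
      · change t = ∑ g, AlgHom.op S.ι (_ : Aᵐᵒᵖ) * _
        rw [key]
        simp only [unop_op, S.act_act_inv, inv_inv]
        exact unop_injective (S.equiv.apply_symm_apply _).symm
      · change t = ∑ g, _ at hc
        rw [key] at hc
        funext g
        rw [hc, unop_op, LinearEquiv.symm_apply_apply, S.act_act_inv, inv_inv, op_unop])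
    (fun g => span_pair_op (S.act_u g))
    (fun g => span_pair_op (S.act_v g))

include S P in
lemma isTwoSidedNoetherianRing : IsTwoSidedNoetherianRing T := by
  have := P.isNoetherianRing
  have := P.op.isNoetherianRing
  let _ := S.opModule
  exact ⟨S.isNoetherianRing, S.op.isNoetherianRing⟩

include S P in
lemma finiteType : Algebra.FiniteType k T := by
  classical
  refine ⟨⟨{S.ι u, S.ι v} ∪ Finset.univ.image S.j, Algebra.eq_top_iff.2 fun t => ?_⟩⟩
  rw [← S.sum_equiv_symm t]
  refine sum_mem fun g _ => mul_mem ?_ (Algebra.subset_adjoin (by simp))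
  set B := Algebra.adjoin k (({S.ι u, S.ι v} ∪ Finset.univ.image S.j : Finset T) : Set T)
  obtain ⟨d, hd⟩ := P.exists_mem_fl (S.equiv.symm t g)
  refine P.map_mem_of_mem_sp (N := Subalgebra.toSubmodule B) S.ι.toLinearMap (fun r _ => ?_) hd
  rw [P.basis_apply, AlgHom.toLinearMap_apply, map_mul, map_pow, map_pow,
    Subalgebra.mem_toSubmodule]
  exact mul_mem (pow_mem (Algebra.subset_adjoin (by simp)) _)
    (pow_mem (Algebra.subset_adjoin (by simp)) _)

include S P in
lemma isGKCohenMacaulay (hA : HasCyclicImages.{u} k A) (hA' : HasCyclicImages.{u} k Aᵐᵒᵖ) :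
    IsGKCohenMacaulay k T := by
  refine ⟨fun M _ _ _ _ _ _ => S.exists_moduleGrade_eq P hA M, fun M _ _ _ _ _ _ => ?_⟩
  let _ := S.opModule
  rw [S.gkDim_eq P, ← S.op.gkDim_eq P.op]
  exact S.op.exists_moduleGrade_eq P.op hA' M

end SkewData

lemma eq_zero_of_sum_pow_mul_eq_zero {k ι : Type*} [Field k] {D : Finset ι} {χ γ : ι → k}
    (hχ : Set.InjOn χ D) (hχ0 : ∀ x ∈ D, χ x ≠ 0) {N : ℕ}
    (h : ∀ m, N ≤ m → ∑ x ∈ D, χ x ^ m * γ x = 0) : ∀ x ∈ D, γ x = 0 := by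
  classical
  intro x hx
  have key : ∀ p : Polynomial k, ∑ y ∈ D, p.eval (χ y) * (χ y ^ N * γ y) = 0 := by
    intro p
    induction p using Polynomial.induction_on' with
    | add p r hp hr => simp only [Polynomial.eval_add, add_mul, Finset.sum_add_distrib, hp, hr,
        add_zero]
    | monomial n a =>
      have := h (n + N) (Nat.le_add_left _ _)
      simp only [Polynomial.eval_monomial]
      simp only [pow_add, mul_assoc] at this ⊢
      rw [← Finset.mul_sum, this, mul_zero]
  have := key (∏ y ∈ D.erase x, (Polynomial.X - Polynomial.C (χ y)))
  rw [Finset.sum_eq_single_of_mem x hx fun y hy hyx => ?_] at this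
  · rw [Polynomial.eval_prod] at this
    refine (mul_eq_zero.1 ((mul_eq_zero.1 this).resolve_left ?_)).resolve_left
      (pow_ne_zero _ (hχ0 x hx))
    refine Finset.prod_ne_zero_iff.2 fun y hy => ?_
    rw [Polynomial.eval_sub, Polynomial.eval_X, Polynomial.eval_C, sub_ne_zero]
    exact fun he => Finset.ne_of_mem_erase hy (hχ (Finset.mem_of_mem_erase hy) hx he.symm)
  · rw [Polynomial.eval_prod, Finset.prod_eq_zero (Finset.mem_erase.2 ⟨hyx, hy⟩) (by simp),
      zero_mul]

namespace PlaneData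

variable {k A : Type*} [Field k] [Ring A] [Algebra k A] {q c : k} {u v : A}
  {P : PlaneData k q c u v}

lemma Ld.map_diagonal {f : A →ₐ[k] A} {μ χ : k} (hu : f u = μ • u) (hv : f v = χ • v) {x : A}
    {p : ℕ × ℕ} {α : k} (h : P.Ld x p α) : P.Ld (f x) p (μ ^ p.1 * χ ^ p.2 * α) := by
  have hf : ∀ r, f (P.basis r) = (μ ^ r.1 * χ ^ r.2) • P.basis r := fun r => by
    rw [basis_apply, map_mul, map_pow, map_pow, hu, hv, smul_pow, smul_pow, smul_mul_smul_comm]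
  have := P.map_mem_of_mem_sp (N := P.below p) f.toLinearMap (fun r hr => by
    rw [AlgHom.toLinearMap_apply, hf]
    exact Submodule.smul_mem _ _ (P.basis_mem_sp hr)) h
  rwa [AlgHom.toLinearMap_apply, map_sub, map_smul, hf, smul_smul, mul_comm α] at this

lemma Ld.mem_fl {x : A} {p : ℕ × ℕ} {α : k} (h : P.Ld x p α) : x ∈ P.fl (p.1 + p.2 + 1) := by
  refine P.mem_fl.2 fun r hr => h.repr_eq_zero ?_
  simp only [lt]
  omega

lemma Ld.lt_of_mem_fl {x : A} {p : ℕ × ℕ} {α : k} (h : P.Ld x p α) (hα : α ≠ 0) {d : ℕ}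
    (hx : x ∈ P.fl d) : p.1 + p.2 < d := by
  by_contra hd
  exact hα (h.repr.symm.trans (P.mem_fl.1 hx p (not_lt.1 hd)))

end PlaneData

namespace SkewData

variable {k A G T : Type*} [Field k] [Ring A] [Algebra k A] [Group G] [Fintype G] [Ring T]
  [Algebra k T] [Module A T] {u v : A} (S : SkewData k G T u v) {q c : k} {P : PlaneData k q c u v}

lemma equiv_symm_mul (a b : T) (r : G) :
    S.equiv.symm (a * b) r =
      ∑ x, S.equiv.symm a x * S.act x (S.equiv.symm b (x⁻¹ * r)) := by
  conv_lhs => rw [← S.sum_equiv_symm a, Finset.sum_mul, map_sum, Finset.sum_apply]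
  refine Finset.sum_congr rfl fun x _ => ?_
  rw [mul_assoc, ← S.smul_eq, S.equiv.symm.map_smul, Pi.smul_apply, S.equiv_symm_j_mul, smul_eq_mul]

lemma equiv_symm_ι_mul (a : A) (b : T) (r : G) :
    S.equiv.symm (S.ι a * b) r = a * S.equiv.symm b r := by
  rw [← S.smul_eq, S.equiv.symm.map_smul, Pi.smul_apply, smul_eq_mul]

/-- If the elements of `D` send `w` to distinct multiples of `v` and the others send it to multiples
of `u`, then the leading coefficients of `a` vanish on `D` as soon as `a T b = 0`. -/
lemma coeff_eq_zero_of_mul_eq_zero {a b : T} (hab : ∀ t, a * t * b = 0) (D : Finset G) {w : A}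
    {χ ψ : G → k} (hD : ∀ x ∈ D, S.act x w = χ x • v) (hD' : ∀ x ∉ D, S.act x w = χ x • u)
    (hχ : Set.InjOn χ D) (hχ0 : ∀ x ∈ D, χ x ≠ 0) (hψ : ∀ x ∈ D, ψ x ≠ 0) {p s s' : ℕ × ℕ}
    {α β : G → k} {β' : G → G → k} (hα : ∀ x, P.Ld (S.equiv.symm a x) p (α x)) (hβ : β ≠ 0)
    (hs : ∀ x ∈ D, ∀ y, P.Ld (S.act x (S.equiv.symm b y)) s (ψ x * β y))
    (hs' : ∀ x ∉ D, ∀ y, P.Ld (S.act x (S.equiv.symm b y)) s' (β' x y))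
    (hss : s'.1 + s'.2 = s.1 + s.2) : ∀ x ∈ D, α x = 0 := by
  classical
  have key : ∀ r m, s'.2 + 1 ≤ m →
      ∑ x ∈ D, χ x ^ m * (α x * (ψ x * β (x⁻¹ * r))) = 0 := by
    intro r m hm
    have hsum : ∑ x, S.equiv.symm a x * S.act x (w ^ m * S.equiv.symm b (x⁻¹ * r)) = 0 := by
      rw [← Pi.zero_apply (M := fun _ => A) r, ← map_zero S.equiv.symm, ← hab (S.ι (w ^ m)),
        mul_assoc, S.equiv_symm_mul]
      simp only [S.equiv_symm_ι_mul]
    have hLd : ∀ x ∈ Finset.univ, P.Ld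
        (S.equiv.symm a x * S.act x (w ^ m * S.equiv.symm b (x⁻¹ * r))) (p + ((0, m) + s))
        (if x ∈ D then q ^ (p.2 * s.1) * q ^ (m * s.1) *
          (χ x ^ m * (α x * (ψ x * β (x⁻¹ * r)))) else 0) := by
      intro x _
      split_ifs with hx
      · have h1 := (hα x).mul (((P.ld_basis (0, m)).smul (χ x ^ m)).mul (hs x hx (x⁻¹ * r)))
        rw [P.basis_apply, pow_zero, one_mul, ← smul_pow, ← hD x hx, ← map_pow, ← map_mul] at h1
        convert h1 using 1
        simp only [Prod.fst_add, zero_add]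
        ring
      · have h1 := (hα x).mul (((P.ld_basis (m, 0)).smul (χ x ^ m)).mul (hs' x hx (x⁻¹ * r)))
        rw [P.basis_apply, pow_zero, mul_one, ← smul_pow, ← hD' x hx, ← map_pow, ← map_mul] at h1
        refine PlaneData.ld_zero_iff.2 (h1.of_lt ?_)
        simp only [PlaneData.lt, Prod.fst_add, Prod.snd_add]
        omega
    have := (PlaneData.Ld.sum Finset.univ hLd).repr
    rw [hsum, map_zero, Finsupp.zero_apply, Finset.sum_ite_mem, Finset.univ_inter,
      ← Finset.mul_sum] at this
    exact (mul_eq_zero.1 this.symm).resolve_left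
      (mul_ne_zero (pow_ne_zero _ P.q_ne) (pow_ne_zero _ P.q_ne))
  obtain ⟨y, hy⟩ := Function.ne_iff.1 hβ
  intro x hx
  have := eq_zero_of_sum_pow_mul_eq_zero hχ hχ0 (key (x * y)) x hx
  rw [inv_mul_cancel_left] at this
  exact (mul_eq_zero.1 this).resolve_right (mul_ne_zero (hψ x hx) hy)

include S P in
/-- The case of a group acting by distinct diagonal matrices. -/
lemma isPrimeRing_of_diagonal {μ χ : G → k} (hu : ∀ x, S.act x u = μ x • u)
    (hv : ∀ x, S.act x v = χ x • v) (hμ : ∀ x, μ x ≠ 0) (hχ0 : ∀ x, χ x ≠ 0)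
    (hχ : Function.Injective χ) : IsPrimeRing T := by
  intro a b hab
  by_contra! hne
  obtain ⟨p, α, hα, hα0⟩ := P.exists_ld_family _ (S.equiv.symm.map_ne_zero_iff.2 hne.1)
  obtain ⟨s, β, hβ, hβ0⟩ := P.exists_ld_family _ (S.equiv.symm.map_ne_zero_iff.2 hne.2)
  exact hα0 (funext fun x => S.coeff_eq_zero_of_mul_eq_zero hab Finset.univ (s' := s) (β' := 0)
    (fun x _ => hv x) (by simp) hχ.injOn (fun x _ => hχ0 x)
    (fun x _ => mul_ne_zero (pow_ne_zero s.1 (hμ x)) (pow_ne_zero s.2 (hχ0 x))) hα hβ0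
    (fun x _ y => (hβ y).map_diagonal (hu x) (hv x)) (by simp) rfl x (Finset.mem_univ x))

include S P in
/-- The case of a group acting by distinct monomial matrices. -/
lemma isPrimeRing_of_monomial (D : Finset G) (h : G) (hDh : ∀ x, x ∉ D → x * h⁻¹ ∈ D)
    {μ χ : G → k} (hu : ∀ x ∈ D, S.act x u = μ x • u) (hv : ∀ x ∈ D, S.act x v = χ x • v)
    (hu' : ∀ x ∉ D, S.act x u = χ x • v) (hv' : ∀ x ∉ D, S.act x v = μ x • u)
    (hμ : ∀ x, μ x ≠ 0) (hχ0 : ∀ x, χ x ≠ 0) (hχ : Set.InjOn χ D)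
    (hχ' : Set.InjOn χ ((D : Set G)ᶜ)) : IsPrimeRing T := by
  classical
  intro a b hab
  by_contra! hne
  obtain ⟨p, α, hα, hα0⟩ := P.exists_ld_family _ (S.equiv.symm.map_ne_zero_iff.2 hne.1)
  have hb := S.equiv.symm.map_ne_zero_iff.2 hne.2
  obtain ⟨s, β, hβ, hβ0⟩ := P.exists_ld_family _ hb
  have hb' : (fun y => S.act h (S.equiv.symm b y)) ≠ 0 := fun h0 => hb (funext fun y => by
    have hy : S.act h (S.equiv.symm b y) = 0 := congrFun h0 y
    rw [← S.act_inv_act h (S.equiv.symm b y), hy, map_zero, Pi.zero_apply])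
  obtain ⟨s', β', hβ', hβ0'⟩ := P.exists_ld_family _ hb'
  have hss : s'.1 + s'.2 = s.1 + s.2 := by
    obtain ⟨y, hy⟩ := Function.ne_iff.1 hβ0
    obtain ⟨y', hy'⟩ := Function.ne_iff.1 hβ0'
    have h1 := (hβ' y').lt_of_mem_fl hy' (S.act_mem_fl P h (hβ y').mem_fl)
    have h2 := (hβ y).lt_of_mem_fl hy (S.act_inv_act h (S.equiv.symm b y) ▸
      S.act_mem_fl P h⁻¹ (hβ' y).mem_fl)
    omega
  have hdiag : ∀ x ∈ D, ∀ y, P.Ld (S.act x (S.equiv.symm b y)) s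
      (μ x ^ s.1 * χ x ^ s.2 * β y) := fun x hx y => (hβ y).map_diagonal (hu x hx) (hv x hx)
  have hanti : ∀ x ∉ D, ∀ y, P.Ld (S.act x (S.equiv.symm b y)) s'
      (μ (x * h⁻¹) ^ s'.1 * χ (x * h⁻¹) ^ s'.2 * β' y) := fun x hx y => by
    have := (hβ' y).map_diagonal (hu _ (hDh x hx)) (hv _ (hDh x hx))
    rwa [← S.act_mul, inv_mul_cancel_right] at this
  refine hα0 (funext fun x => ?_)
  by_cases hx : x ∈ D
  · refine S.coeff_eq_zero_of_mul_eq_zero hab D (w := v) (χ := fun x => if x ∈ D then χ x else μ x)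
      (fun x hx => by rw [if_pos hx, hv x hx]) (fun x hx => by rw [if_neg hx, hv' x hx])
      (fun x hx y hy hxy => hχ hx hy (by
        rw [Finset.mem_coe] at hx hy
        simpa only [if_pos hx, if_pos hy] using hxy))
      (fun x hx => by rw [if_pos hx]; exact hχ0 x)
      (fun x _ => mul_ne_zero (pow_ne_zero s.1 (hμ x)) (pow_ne_zero s.2 (hχ0 x)))
      hα hβ0 hdiag hanti hss x hx
  · have hmem : ∀ {x}, x ∈ Dᶜ ↔ x ∉ D := Finset.mem_compl
    refine S.coeff_eq_zero_of_mul_eq_zero hab Dᶜ (w := u) (χ := fun x => if x ∈ D then μ x else χ x)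
      (fun x hx => by rw [if_neg (hmem.1 hx), hu' x (hmem.1 hx)])
      (fun x hx => by rw [if_pos (by simpa using hx), hu x (by simpa using hx)])
      (fun x hx y hy hxy => hχ' (by simpa using hx) (by simpa using hy)
        (by
          rw [Finset.mem_coe, hmem] at hx hy
          simpa only [if_neg hx, if_neg hy] using hxy))
      (fun x hx => by rw [if_neg (hmem.1 hx)]; exact hχ0 x)
      (fun x _ => mul_ne_zero (pow_ne_zero s'.1 (hμ _)) (pow_ne_zero s'.2 (hχ0 _)))
      hα hβ0' (fun x hx => hanti x (hmem.1 hx)) (fun x hx => hdiag x (by simpa using hx)) hss.symm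
      x (hmem.2 hx)

end SkewData

namespace PlaneData

variable {k A : Type*} [Field k] [Ring A] [Algebra k A] {q c : k} {u v : A}

lemma hasCyclicImages_quantum (P : PlaneData k q 0 u v) : HasCyclicImages k A :=
  fun _ _ _ _ _ _ => P.exists_hom_quantum

lemma hasCyclicImages_jordan [IsAlgClosed k] [CharZero k] (P : PlaneData k 1 c u v) (hc : c ≠ 0) :
    HasCyclicImages k A :=
  fun _ _ _ _ _ _ => P.exists_hom_jordan hc

end PlaneData

namespace SkewData

section

variable {k A G : Type*} {T : Type u} [Field k] [Ring A] [Algebra k A] [Group G] [Fintype G]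
  [Ring T] [Algebra k T] [Module A T] {u v : A} (S : SkewData k G T u v)

include S

lemma properties_quantum {q : k} (P : PlaneData k q 0 u v) :
    IsTwoSidedNoetherianRing T ∧ Algebra.FiniteType k T ∧ IsGKCohenMacaulay k T ∧
      gkDim k T = 2 := by
  refine ⟨S.isTwoSidedNoetherianRing P, S.finiteType P, S.isGKCohenMacaulay P
    P.hasCyclicImages_quantum ?_, S.gkDim_eq P⟩
  have P' := P.op
  rw [mul_zero, neg_zero] at P'
  exact P'.hasCyclicImages_quantum

lemma properties_jordan [IsAlgClosed k] [CharZero k] {c : k} (P : PlaneData k 1 c u v)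
    (hc : c ≠ 0) :
    IsTwoSidedNoetherianRing T ∧ Algebra.FiniteType k T ∧ IsGKCohenMacaulay k T ∧
      gkDim k T = 2 := by
  refine ⟨S.isTwoSidedNoetherianRing P, S.finiteType P, S.isGKCohenMacaulay P
    (P.hasCyclicImages_jordan hc) ?_, S.gkDim_eq P⟩
  have P' := P.op
  rw [inv_one, one_mul] at P'
  exact P'.hasCyclicImages_jordan (neg_ne_zero.2 hc)

end

variable {k A G T : Type*} [Field k] [Ring A] [Algebra k A] [Group G] [Fintype G]
  [MulSemiringAction G A] [SMulCommClass G k A] [Ring T] [Algebra k T] {u v : A}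

/-- The data of a skew group ring for an action by `k`-linear automorphisms. -/
abbrev ofIsSkewGroupRing {ι : A →+* T} {j : G → T} (hT : IsSkewGroupRing A G T ι j)
    (hι : ∀ c : k, ι (algebraMap k A c) = algebraMap k T c)
    (hu : ∀ g : G, g • u ∈ Submodule.span k {u, v})
    (hv : ∀ g : G, g • v ∈ Submodule.span k {u, v}) :
    @SkewData k A G T _ _ _ _ _ _ _ (Module.compHom T ι) u v :=
  @SkewData.mk k A G T _ _ _ _ _ _ _ (Module.compHom T ι) u v { ι with commutes' := hι } j
    (MulSemiringAction.toAlgHom k A) (fun _ _ => rfl) hT.j_one hT.j_mul hT.comm hT.basis hu hv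

end SkewData

section

variable {k A G : Type*} [Field k] [Group G]

lemma smul_pow_eq_pow_smul [Ring A] [Algebra k A] [MulSemiringAction G A]
    [SMulCommClass G k A]
    {g : G} {w : A} {a : k} (h : g • w = a • w) (i : ℕ) : g ^ i • w = a ^ i • w := by
  induction i with
  | zero => rw [pow_zero, pow_zero, one_smul, one_smul]
  | succ i ih => rw [pow_succ, pow_succ', mul_smul, h, smul_comm, ih, mul_smul]

lemma injOn_pow_of_isPrimitiveRoot {g : G} {a : k} (ha : IsPrimitiveRoot a (orderOf g))
    (ha0 : a ≠ 0) {e : G → ℕ} {f : G → G} {D : Set G} (hf : Function.Injective f)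
    (he : ∀ x ∈ D, f x = g ^ e x) : Set.InjOn (fun x => a ^ e x) D := by
  intro x hx y hy hxy
  refine hf ?_
  rw [he x hx, he y hy, pow_inj_mod, ha.eq_orderOf, ← Units.val_mk0 ha0, orderOf_units]
  exact pow_inj_mod.1 (Units.ext (by simpa using hxy))

end

section

variable {k A G T : Type*} [Field k] [Ring A] [Algebra k A] [Group G] [Fintype G]
  [MulSemiringAction G A] [SMulCommClass G k A] [Ring T] [Algebra k T] {q c : k} {u v : A}
  {ι : A →+* T} {j : G → T}

lemma IsSkewGroupRing.cyclic (hT : IsSkewGroupRing A G T ι j) (P : PlaneData k q c u v)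
    (hι : ∀ c : k, ι (algebraMap k A c) = algebraMap k T c) {g : G} {ω : k}
    (hω : IsPrimitiveRoot ω (orderOf g)) (hg : ∀ x : G, ∃ i : ℕ, x = g ^ i)
    (hu : g • u = ω • u) (hv : g • v = ω⁻¹ • v) :
    IsPrimeRing T ∧ Nonempty (@SkewData k A G T _ _ _ _ _ _ _ (Module.compHom T ι) u v) := by
  have hω0 : ω ≠ 0 := hω.ne_zero (orderOf_pos g).ne'
  choose e he using hg
  have hu' : ∀ x : G, x • u = ω ^ e x • u := fun x => by
    conv_lhs => rw [he x, smul_pow_eq_pow_smul hu]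
  have hv' : ∀ x : G, x • v = ω⁻¹ ^ e x • v := fun x => by
    conv_lhs => rw [he x, smul_pow_eq_pow_smul hv]
  let _ := Module.compHom T ι
  let S : SkewData k G T u v := SkewData.ofIsSkewGroupRing hT hι
    (fun x => hu' x ▸ Submodule.smul_mem _ _ (Submodule.subset_span (by simp)))
    (fun x => hv' x ▸ Submodule.smul_mem _ _ (Submodule.subset_span (by simp)))
  refine ⟨S.isPrimeRing_of_diagonal (P := P) hu' hv' (fun x => pow_ne_zero _ hω0)
    (fun x => pow_ne_zero _ (inv_ne_zero hω0)) ?_, ⟨S⟩⟩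
  exact Set.injOn_univ.1 (injOn_pow_of_isPrimitiveRoot hω.inv (inv_ne_zero hω0)
    Function.injective_id fun x _ => he x)

lemma IsSkewGroupRing.dihedral (hT : IsSkewGroupRing A G T ι j) (P : PlaneData k q c u v)
    (hι : ∀ c : k, ι (algebraMap k A c) = algebraMap k T c) {g h : G} {ω : k}
    (hω : IsPrimitiveRoot ω (orderOf g)) (hg : ∀ x : G, ∃ i : ℕ, x = g ^ i ∨ x = g ^ i * h)
    (hu : g • u = ω • u) (hv : g • v = ω⁻¹ • v) (hhu : h • u = v) (hhv : h • v = u) :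
    IsPrimeRing T ∧ Nonempty (@SkewData k A G T _ _ _ _ _ _ _ (Module.compHom T ι) u v) := by
  classical
  have hω0 : ω ≠ 0 := hω.ne_zero (orderOf_pos g).ne'
  let D : Finset G := {x | ∃ i, x = g ^ i}
  have hmemD : ∀ {x}, x ∈ D ↔ ∃ i, x = g ^ i := by simp [D]
  have hg' : ∀ x, ∃ i, (x ∈ D → x = g ^ i) ∧ (x ∉ D → x = g ^ i * h) := fun x => by
    by_cases hx : x ∈ D
    · obtain ⟨i, hi⟩ := hmemD.1 hx
      exact ⟨i, fun _ => hi, fun h => absurd hx h⟩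
    · obtain ⟨i, hi⟩ := hg x
      exact ⟨i, fun h => absurd h hx, fun _ => hi.resolve_left fun h => hx (hmemD.2 ⟨i, h⟩)⟩
  choose e he using hg'
  have hD := fun x => (he x).1
  have hD' := fun x => (he x).2
  have huD : ∀ x ∈ D, x • u = ω ^ e x • u := fun x hx => by
    conv_lhs => rw [hD x hx, smul_pow_eq_pow_smul hu]
  have hvD : ∀ x ∈ D, x • v = ω⁻¹ ^ e x • v := fun x hx => by
    conv_lhs => rw [hD x hx, smul_pow_eq_pow_smul hv]
  have huD' : ∀ x ∉ D, x • u = ω⁻¹ ^ e x • v := fun x hx => by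
    conv_lhs => rw [hD' x hx, mul_smul, hhu, smul_pow_eq_pow_smul hv]
  have hvD' : ∀ x ∉ D, x • v = ω ^ e x • u := fun x hx => by
    conv_lhs => rw [hD' x hx, mul_smul, hhv, smul_pow_eq_pow_smul hu]
  have hmem : ∀ (a : k) (w : A), w = u ∨ w = v → a • w ∈ Submodule.span k {u, v} := fun a w hw =>
    Submodule.smul_mem _ _ (Submodule.subset_span (by simpa using hw))
  let _ := Module.compHom T ι
  let S : SkewData k G T u v := SkewData.ofIsSkewGroupRing hT hι
    (fun x => by
      by_cases hx : x ∈ D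
      · exact huD x hx ▸ hmem _ u (.inl rfl)
      · exact huD' x hx ▸ hmem _ v (.inr rfl))
    (fun x => by
      by_cases hx : x ∈ D
      · exact hvD x hx ▸ hmem _ v (.inr rfl)
      · exact hvD' x hx ▸ hmem _ u (.inl rfl))
  refine ⟨S.isPrimeRing_of_monomial (P := P) D h ?_ huD hvD huD' hvD' (fun x => pow_ne_zero _ hω0)
    (fun x => pow_ne_zero _ (inv_ne_zero hω0)) ?_ ?_, ⟨S⟩⟩
  · exact fun x hx => hmemD.2 ⟨e x, mul_inv_eq_of_eq_mul (hD' x hx)⟩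
  · exact injOn_pow_of_isPrimitiveRoot hω.inv (inv_ne_zero hω0)
      Function.injective_id fun x hx => hD x hx
  · exact injOn_pow_of_isPrimitiveRoot hω.inv (inv_ne_zero hω0)
      (mul_left_injective h⁻¹) fun x hx => mul_inv_eq_of_eq_mul (hD' x hx)

end

/-- For every quantum Kleinian pair `(A, G)`, the skew group ring `A # G` is a prime
noetherian finitely generated `k`-algebra which is GK-Cohen-Macaulay of GK dimension 2. -/
theorem quantumKleinian_skewGroupRing_prime_noetherian_CM
    (k : Type) [Field k] [IsAlgClosed k] [CharZero k] :
    (∀ (n : ℕ), 0 < n → ∀ ω : k, IsPrimitiveRoot ω n → ∀ q : k, q ≠ 0 →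
      ∀ (G : Type) [Group G] [Fintype G], ∀ g : G,
        orderOf g = n → (∀ x : G, ∃ i : ℕ, x = g ^ i) →
      ∀ [MulSemiringAction G (QuantumPlane k q)] [SMulCommClass G k (QuantumPlane k q)],
        g • qU k q = ω • qU k q → g • qV k q = ω⁻¹ • qV k q →
      ∀ (T : Type) [Ring T] [Algebra k T] (iota : (QuantumPlane k q) →+* T) (j : G → T),
        IsSkewGroupRing (QuantumPlane k q) G T iota j →
        (∀ c : k, iota (algebraMap k (QuantumPlane k q) c) = algebraMap k T c) →
        (IsPrimeRing T ∧ IsTwoSidedNoetherianRing T ∧ Algebra.FiniteType k T ∧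
          IsGKCohenMacaulay k T ∧ gkDim k T = 2)) ∧
    (∀ (G : Type) [Group G] [Fintype G], ∀ h : G,
        orderOf h = 2 → (∀ x : G, x = 1 ∨ x = h) →
      ∀ [MulSemiringAction G (QuantumPlane k (-1 : k))] [SMulCommClass G k (QuantumPlane k (-1 : k))],
        h • qU k (-1 : k) = qV k (-1 : k) → h • qV k (-1 : k) = qU k (-1 : k) →
      ∀ (T : Type) [Ring T] [Algebra k T] (iota : (QuantumPlane k (-1 : k)) →+* T) (j : G → T),
        IsSkewGroupRing (QuantumPlane k (-1 : k)) G T iota j →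
        (∀ c : k, iota (algebraMap k (QuantumPlane k (-1 : k)) c) = algebraMap k T c) →
        (IsPrimeRing T ∧ IsTwoSidedNoetherianRing T ∧ Algebra.FiniteType k T ∧
          IsGKCohenMacaulay k T ∧ gkDim k T = 2)) ∧
    (∀ (n : ℕ), 0 < n → ∀ ω : k, IsPrimitiveRoot ω n →
      ∀ (G : Type) [Group G] [Fintype G], ∀ g h : G,
        orderOf g = n → orderOf h = 2 → h * g * h = g⁻¹ →
        Fintype.card G = 2 * n →
        (∀ x : G, ∃ i : ℕ, x = g ^ i ∨ x = g ^ i * h) →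
      ∀ [MulSemiringAction G (QuantumPlane k (-1 : k))] [SMulCommClass G k (QuantumPlane k (-1 : k))],
        g • qU k (-1 : k) = ω • qU k (-1 : k) →
        g • qV k (-1 : k) = ω⁻¹ • qV k (-1 : k) →
        h • qU k (-1 : k) = qV k (-1 : k) → h • qV k (-1 : k) = qU k (-1 : k) →
      ∀ (T : Type) [Ring T] [Algebra k T] (iota : (QuantumPlane k (-1 : k)) →+* T) (j : G → T),
        IsSkewGroupRing (QuantumPlane k (-1 : k)) G T iota j →
        (∀ c : k, iota (algebraMap k (QuantumPlane k (-1 : k)) c) = algebraMap k T c) →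
        (IsPrimeRing T ∧ IsTwoSidedNoetherianRing T ∧ Algebra.FiniteType k T ∧
          IsGKCohenMacaulay k T ∧ gkDim k T = 2)) ∧
    (∀ (G : Type) [Group G] [Fintype G], ∀ h : G,
        orderOf h = 2 → (∀ x : G, x = 1 ∨ x = h) →
      ∀ [MulSemiringAction G (JordanPlane k)] [SMulCommClass G k (JordanPlane k)],
        h • jU k = - jU k → h • jV k = - jV k →
      ∀ (T : Type) [Ring T] [Algebra k T] (iota : (JordanPlane k) →+* T) (j : G → T),
        IsSkewGroupRing (JordanPlane k) G T iota j →
        (∀ c : k, iota (algebraMap k (JordanPlane k) c) = algebraMap k T c) →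
        (IsPrimeRing T ∧ IsTwoSidedNoetherianRing T ∧ Algebra.FiniteType k T ∧
          IsGKCohenMacaulay k T ∧ gkDim k T = 2)) := by
  have hq : (-1 : k) ≠ 0 := neg_ne_zero.2 one_ne_zero
  refine ⟨?_, ?_, ?_, ?_⟩
  · intro n _ ω hω q hq G _ _ g hn hg _ _ hu hv T _ _ ι j hT hι
    have P := PlaneData.quantumPlane hq
    obtain ⟨hprime, ⟨S⟩⟩ := hT.cyclic P hι (hn ▸ hω) hg hu hv
    let _ := Module.compHom T ι
    exact ⟨hprime, S.properties_quantum P⟩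
  · intro G _ _ h _ hh _ _ hu hv T _ _ ι j hT hι
    have P := PlaneData.quantumPlane hq
    obtain ⟨hprime, ⟨S⟩⟩ := hT.dihedral P hι (g := 1) (ω := 1) (orderOf_one (G := G) ▸ .one)
      (fun x => ⟨0, by simpa using hh x⟩) (by simp) (by simp) hu hv
    let _ := Module.compHom T ι
    exact ⟨hprime, S.properties_quantum P⟩
  · intro n _ ω hω G _ _ g h hn _ _ _ hg _ _ hu hv hhu hhv T _ _ ι j hT hι
    have P := PlaneData.quantumPlane hq
    obtain ⟨hprime, ⟨S⟩⟩ := hT.dihedral P hι (hn ▸ hω) hg hu hv hhu hhv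
    let _ := Module.compHom T ι
    exact ⟨hprime, S.properties_quantum P⟩
  · intro G _ _ h h2 hh _ _ hu hv T _ _ ι j hT hι
    have P := PlaneData.jordanPlane (k := k)
    obtain ⟨hprime, ⟨S⟩⟩ := hT.cyclic P hι (g := h) (ω := -1)
      (h2 ▸ IsPrimitiveRoot.neg_one 0 (by norm_num))
      (fun x => (hh x).elim (fun hx => ⟨0, by rw [hx, pow_zero]⟩)
        fun hx => ⟨1, by rw [hx, pow_one]⟩)
      (hu.trans (neg_one_smul k _).symm)
      (hv.trans (by rw [inv_neg_one]; exact (neg_one_smul k _).symm))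
    let _ := Module.compHom T ι
    exact ⟨hprime, S.properties_jordan P one_ne_zero⟩
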